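/- Let G be a finite non-solvable GC*-group. Then G is perfect, i.e., G = G'. -/

import Mathlib

noncomputable section

/-- `χ : G → ℂ` is the character of some irreducible complex representation of `G`. -/
def IsIrrChar {G : Type*} [Group G] (χ : G → ℂ) : Prop :=
  ∃ (n : ℕ) (ρ : Representation ℂ G (Fin n → ℂ)),
    0 < n ∧
    (∀ U : Submodule ℂ (Fin n → ℂ), (∀ g : G, U.map (ρ g) ≤ U) → U = ⊥ ∨ U = ⊤) ∧
    (∀ g : G, χ g = LinearMap.trace ℂ (Fin n → ℂ) (ρ g))

/-- Two complex characters are Galois conjugate: some field automorphism (which, on the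
cyclotomic field generated by the character values, restricts to a Galois automorphism
over `ℚ`) carries the values of `χ` to those of `ψ`. -/
def GaloisConj {G : Type*} [Group G] (χ ψ : G → ℂ) : Prop :=
  ∃ σ : ℂ ≃+* ℂ, ∀ g : G, ψ g = σ (χ g)

/-- `G` is a `GC*`-group: any two non-linear irreducible complex characters of the same
degree are Galois conjugate. -/
def IsGCStar (G : Type*) [Group G] : Prop :=
  ∀ χ ψ : G → ℂ, IsIrrChar χ → IsIrrChar ψ → χ 1 ≠ 1 → ψ 1 ≠ 1 →
    χ 1 = ψ 1 → GaloisConj χ ψ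

/-- A group is `q`-nilpotent if its elements of order prime to `q` form a subgroup. -/
def IsPNilpotent (q : ℕ) (G : Type*) [Group G] : Prop :=
  ∃ K : Subgroup G, ∀ g, g ∈ K ↔ (orderOf g).Coprime q

namespace IsPNilpotent

variable {q : ℕ} {G H : Type*} [Group G] [Group H]

theorem of_injective (f : H →* G) (hf : Function.Injective f) (h : IsPNilpotent q G) :
    IsPNilpotent q H := by
  obtain ⟨K, hK⟩ := h
  refine ⟨K.comap f, fun g => ?_⟩
  rw [Subgroup.mem_comap, hK, orderOf_injective f hf]

theorem subgroup (h : IsPNilpotent q G) (L : Subgroup G) : IsPNilpotent q L :=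
  of_injective L.subtype L.subtype_injective h

theorem mono {L L' : Subgroup G} (hL : L ≤ L') (h : IsPNilpotent q L') : IsPNilpotent q L :=
  of_injective (Subgroup.inclusion hL) (Subgroup.inclusion_injective hL) h

theorem of_map_le {f : H →* G} (hf : Function.Injective f) {L : Subgroup H} {L' : Subgroup G}
    (hL : L.map f ≤ L') (h : IsPNilpotent q L') : IsPNilpotent q L :=
  of_injective (L.equivMapOfInjective f hf).toMonoidHom
    (L.equivMapOfInjective f hf).injective (h.mono hL)

theorem mem_of_pow_mem {K : Subgroup G} {g : G} {k : ℕ} (hg : (orderOf g).Coprime q)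
    (hk : g ^ q ^ k ∈ K) : g ∈ K := by
  obtain ⟨m, hm⟩ := exists_pow_eq_self_of_coprime (n := q ^ k) (x := g) (hg.pow_right k).symm
  rw [← hm]
  exact K.pow_mem hk m

theorem of_compl {K : Subgroup G} (hc : (Nat.card K).Coprime q)
    (hp : ∀ g : G, ∃ k, g ^ q ^ k ∈ K) : IsPNilpotent q G := by
  refine ⟨K, fun g => ⟨fun hg => ?_, fun hg => ?_⟩⟩
  · exact Nat.Coprime.coprime_dvd_left (Subgroup.orderOf_dvd_natCard K hg) hc
  · obtain ⟨k, hk⟩ := hp g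
    exact mem_of_pow_mem hg hk

theorem exists_pow_coprime [Finite G] (hq : q.Prime) (g : G) :
    ∃ k, (orderOf (g ^ q ^ k)).Coprime q := by
  obtain ⟨k, l, hl, h⟩ := Nat.exists_eq_pow_mul_and_not_dvd (orderOf_pos g).ne' q hq.ne_one
  refine ⟨k, ?_⟩
  rw [orderOf_pow, h, Nat.gcd_eq_right (Dvd.intro _ rfl),
    Nat.mul_div_cancel_left _ (pow_pos hq.pos k)]
  exact ((Nat.Prime.coprime_iff_not_dvd hq).2 hl).symm

theorem exists_compl [Finite G] (hq : q.Prime) (h : IsPNilpotent q G) :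
    ∃ K : Subgroup G, K.Characteristic ∧ (Nat.card K).Coprime q ∧
      (∀ g : G, ∃ k, g ^ q ^ k ∈ K) ∧ ∀ g, g ∈ K ↔ (orderOf g).Coprime q := by
  obtain ⟨K, hK⟩ := h
  refine ⟨K, ?_, ?_, fun g => ?_, hK⟩
  · refine Subgroup.characteristic_iff_comap_eq.2 fun e => ?_
    ext g
    rw [Subgroup.mem_comap, hK, hK, MulEquiv.coe_toMonoidHom, MulEquiv.orderOf_eq]
  · refine ((Nat.Prime.coprime_iff_not_dvd hq).2 fun hd => ?_).symm
    have := Fact.mk hq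
    obtain ⟨x, hx⟩ := exists_prime_orderOf_dvd_card' q hd
    have := (hK x).1 x.2
    rw [Subgroup.orderOf_coe, hx, Nat.coprime_self] at this
    exact hq.ne_one this
  · obtain ⟨k, hk⟩ := exists_pow_coprime hq g
    exact ⟨k, (hK _).2 hk⟩

theorem of_surjective [Finite G] (hq : q.Prime) (f : G →* H) (hf : Function.Surjective f)
    (h : IsPNilpotent q G) : IsPNilpotent q H := by
  obtain ⟨K, -, hc, hp, -⟩ := h.exists_compl hq
  refine of_compl (K := K.map f) (Nat.Coprime.coprime_dvd_left (K.card_map_dvd f) hc) fun y => ?_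
  obtain ⟨x, rfl⟩ := hf y
  obtain ⟨k, hk⟩ := hp x
  exact ⟨k, by rw [← map_pow]; exact Subgroup.mem_map_of_mem f hk⟩

theorem of_subgroup {L : Subgroup G} (hL : ∀ g : G, ∃ k, g ^ q ^ k ∈ L) (h : IsPNilpotent q L) :
    IsPNilpotent q G := by
  obtain ⟨K, hK⟩ := h
  refine ⟨K.map L.subtype, fun g => ⟨?_, fun hg => ?_⟩⟩
  · rintro ⟨x, hx, rfl⟩
    rw [Subgroup.coe_subtype, Subgroup.orderOf_coe]
    exact (hK x).1 hx
  · obtain ⟨k, hk⟩ := hL g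
    have hgL := mem_of_pow_mem hg hk
    exact ⟨⟨g, hgL⟩, (hK _).2 (by rwa [Subgroup.orderOf_mk]), rfl⟩

theorem of_quotient {L : Subgroup G} [L.Normal] (hL : (Nat.card L).Coprime q)
    (h : IsPNilpotent q (G ⧸ L)) : IsPNilpotent q G := by
  obtain ⟨K, hK⟩ := h
  refine ⟨K.comap (QuotientGroup.mk' L), fun g => ?_⟩
  rw [Subgroup.mem_comap, hK]
  refine ⟨fun hg => ?_, fun hg => Nat.Coprime.coprime_dvd_left (orderOf_map_dvd _ g) hg⟩
  have h1 : g ^ orderOf (QuotientGroup.mk' L g) ∈ L := by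
    rw [← QuotientGroup.eq_one_iff]
    exact pow_orderOf_eq_one (QuotientGroup.mk' L g)
  have h2 : orderOf g ∣ orderOf (QuotientGroup.mk' L g) * Nat.card L := by
    rw [orderOf_dvd_iff_pow_eq_one, pow_mul]
    exact orderOf_dvd_iff_pow_eq_one.1 (Subgroup.orderOf_dvd_natCard L h1)
  exact Nat.Coprime.coprime_dvd_left h2 (Nat.Coprime.mul_left hg hL)

theorem eq_one_of_mem_of_mem {K U : Subgroup G} (hK : ∀ g ∈ K, (orderOf g).Coprime q)
    (hU : IsPGroup q U) {x : G} (hxK : x ∈ K) (hxU : x ∈ U) : x = 1 := by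
  obtain ⟨k, hk⟩ := hU ⟨x, hxU⟩
  have hk' : x ^ q ^ k = 1 := by simpa [Subtype.ext_iff] using hk
  have := Nat.Coprime.eq_one_of_dvd ((hK x hxK).pow_right k) (orderOf_dvd_of_pow_eq_one hk')
  exact orderOf_eq_one_iff.1 this

theorem commute_of_normal [Finite G] (hq : q.Prime) (h : IsPNilpotent q G) {U : Subgroup G}
    [U.Normal] (hU : IsPGroup q U) {k u : G} (hk : (orderOf k).Coprime q) (hu : u ∈ U) :
    k * u = u * k := by
  obtain ⟨K, hKc, -, -, hK⟩ := h.exists_compl hq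
  have hKn : K.Normal := inferInstance
  have hUn : U.Normal := inferInstance
  have hkK := (hK k).2 hk
  have h1 : k * u * k⁻¹ * u⁻¹ = 1 := by
    refine eq_one_of_mem_of_mem (fun g hg => (hK g).1 hg) hU (K := K) ?_ ?_
    · rw [mul_assoc, mul_assoc, ← mul_assoc u]
      exact K.mul_mem hkK (hKn.conj_mem _ (K.inv_mem hkK) u)
    · exact U.mul_mem (hUn.conj_mem _ hu k) (U.inv_mem hu)
  calc k * u = (k * u * k⁻¹ * u⁻¹) * (u * k) := by group
    _ = u * k := by rw [h1, one_mul]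

theorem exists_mul_of_sylow [Finite G] (hq : q.Prime) (h : IsPNilpotent q G) (S : Sylow q G)
    (g : G) : ∃ k s : G, (orderOf k).Coprime q ∧ s ∈ S ∧ g = k * s := by
  have := Fact.mk hq
  obtain ⟨K, hKc, -, hp, hK⟩ := h.exists_compl hq
  have hKn : K.Normal := inferInstance
  have htop : K ⊔ (S : Subgroup G) = ⊤ := by
    rw [← Subgroup.index_eq_one]
    have h1 : (K ⊔ (S : Subgroup G)).index ∣ K.index := Subgroup.index_dvd_of_le le_sup_left
    have h2 : (K ⊔ (S : Subgroup G)).index ∣ (S : Subgroup G).index :=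
      Subgroup.index_dvd_of_le le_sup_right
    have h3 : IsPGroup q (G ⧸ K) := by
      intro x
      obtain ⟨x, rfl⟩ := QuotientGroup.mk_surjective x
      obtain ⟨k, hk⟩ := hp x
      exact ⟨k, by rw [← QuotientGroup.mk_pow, QuotientGroup.eq_one_iff]; exact hk⟩
    obtain ⟨n, hn⟩ := IsPGroup.iff_card.1 h3
    rw [Subgroup.index_eq_card K, hn] at h1
    have h4 := ((Nat.Prime.coprime_iff_not_dvd hq).2 S.not_dvd_index)
    exact Nat.Coprime.eq_one_of_dvd (Nat.Coprime.coprime_dvd_left h2 (h4.pow_left n).symm) h1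
  have hg : g ∈ K ⊔ (S : Subgroup G) := htop ▸ Subgroup.mem_top g
  obtain ⟨k, hk, s, hs, rfl⟩ := Subgroup.mem_sup_of_normal_left.1 hg
  exact ⟨k, s, (hK k).1 hk, hs, rfl⟩

end IsPNilpotent

section
variable {q : ℕ} {G H : Type*} [Group G] [Group H]

theorem IsPGroup.lt_inf_normalizer [Finite G] (hq : q.Prime) {P D : Subgroup G}
    (hP : IsPGroup q P) (hD : D < P) : D < P ⊓ Subgroup.normalizer (D : Set G) := by
  have := Fact.mk hq
  have hnil : Group.IsNilpotent P := hP.isNilpotent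
  have h1 : D.subgroupOf P < ⊤ := by
    rw [lt_top_iff_ne_top, Ne, Subgroup.subgroupOf_eq_top]
    exact not_le_of_gt hD
  have h2 := Group.normalizerCondition_of_isNilpotent (G := P) _ h1
  refine lt_of_le_of_ne (le_inf hD.le Subgroup.le_normalizer) fun h => ?_
  refine (SetLike.lt_iff_le_and_exists.1 h2).2.elim fun x hx => hx.2 ?_
  rw [Subgroup.mem_subgroupOf, h]
  refine ⟨x.2, ?_⟩
  have h3 := hx.1
  rw [← Subgroup.subgroupOf_normalizer_eq hD.le] at h3
  exact h3

theorem Subgroup.card_lt_card_of_lt' [Finite G] {A B : Subgroup G} (h : A < B) :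
    Nat.card A < Nat.card B := by
  refine lt_of_not_ge fun h' => h.ne (Subgroup.eq_of_le_of_card_ge h.le h')

open scoped Pointwise in
theorem Sylow.mem_smul_iff {P : Sylow q G} {g x : G} : x ∈ g • P ↔ g⁻¹ * x * g ∈ P := by
  rw [← SetLike.mem_coe, Sylow.coe_smul, Set.mem_smul_set_iff_inv_smul_mem]
  simp [← map_inv]

theorem Sylow.smul_eq_of_mem {P : Sylow q G} {g : G} (hg : g ∈ P) : g • P = P :=
  Sylow.smul_eq_iff_mem_normalizer.2 (Subgroup.le_normalizer hg)
end

open scoped Pointwise in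
theorem Sylow.exists_commute_smul_eq {q : ℕ} {G : Type*} [Group G] [Finite G] (hq : q.Prime)
    (hN : ∀ U : Subgroup G, U ≠ ⊥ → IsPGroup q U →
      IsPNilpotent q (Subgroup.normalizer (U : Set G)))
    (P Q : Sylow q G) :
    ∃ c : G, (∀ d ∈ (P : Subgroup G) ⊓ Q, c * d = d * c) ∧ Q = c • P := by
  have := Fact.mk hq
  induction hn : Nat.card G - Nat.card ((P : Subgroup G) ⊓ Q : Subgroup G)
    using Nat.strong_induction_on generalizing P Q with
  | _ n ih =>
  subst hn
  by_cases hPQ : (P : Subgroup G) ≤ Q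
  · exact ⟨1, by simp, by rw [one_smul]; exact Sylow.ext (P.is_maximal' Q.2 hPQ)⟩
  have hQP : ¬ (Q : Subgroup G) ≤ P := fun h => hPQ (Q.is_maximal' P.2 h).le
  set D : Subgroup G := (P : Subgroup G) ⊓ Q with hDdef
  by_cases hD : D = ⊥
  · obtain ⟨c, hc⟩ := MulAction.exists_smul_eq G P Q
    refine ⟨c, fun d hd => ?_, hc.symm⟩
    rw [hD, Subgroup.mem_bot] at hd
    simp [hd]
  have hDP : IsPGroup q D := P.2.to_le inf_le_left
  have hnil := hN D hD hDP
  set N := Subgroup.normalizer (D : Set G) with hNdef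
  have h1 : D < (P : Subgroup G) ⊓ N :=
    P.2.lt_inf_normalizer hq (lt_of_le_of_ne inf_le_left fun h => hPQ (inf_eq_left.1 h))
  have h2 : D < (Q : Subgroup G) ⊓ N :=
    Q.2.lt_inf_normalizer hq (lt_of_le_of_ne inf_le_right fun h => hQP (inf_eq_right.1 h))
  have hsub : ∀ R : Sylow q G, ∃ S : Sylow q N, ((R : Subgroup G) ⊓ N) ≤
      (S : Subgroup N).map N.subtype := by
    intro R
    have hR : IsPGroup q (((R : Subgroup G)).subgroupOf N) :=
      R.2.comap_of_injective N.subtype N.subtype_injective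
    obtain ⟨S, hS⟩ := hR.exists_le_sylow
    refine ⟨S, fun x hx => ⟨⟨x, hx.2⟩, hS ?_, rfl⟩⟩
    exact hx.1
  obtain ⟨S, hS⟩ := hsub P
  obtain ⟨T, hT⟩ := hsub Q
  obtain ⟨g, hg⟩ := MulAction.exists_smul_eq N S T
  obtain ⟨k, s, hk, hs, rfl⟩ := hnil.exists_mul_of_sylow hq S g
  have hks : k • S = T := by
    rw [← hg, mul_smul, Sylow.smul_eq_of_mem hs]
  have hkD : ∀ d ∈ D, (k : G) * d = d * k := by
    intro d hd
    have hdn : d ∈ N := Subgroup.le_normalizer hd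
    have : (D.subgroupOf N).Normal := Subgroup.normal_in_normalizer
    have := hnil.commute_of_normal hq (U := D.subgroupOf N)
      (hDP.comap_of_injective N.subtype N.subtype_injective) hk (u := ⟨d, hdn⟩) hd
    exact congrArg Subtype.val this
  obtain ⟨P1, hP1⟩ := (S.2.map N.subtype).exists_le_sylow
  have hlt : ∀ P' Q' : Sylow q G, D < (P' : Subgroup G) ⊓ Q' →
      Nat.card G - Nat.card ((P' : Subgroup G) ⊓ Q' : Subgroup G) < Nat.card G - Nat.card D := by
    intro P' Q' h
    have h3 := Subgroup.card_lt_card_of_lt' h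
    have h4 := Subgroup.card_le_card_group ((P' : Subgroup G) ⊓ Q' : Subgroup G)
    omega
  have hl1 : D < (P : Subgroup G) ⊓ P1 :=
    lt_of_lt_of_le h1 (le_inf inf_le_left (hS.trans hP1))
  have hl2 : D < (((k : G) • P1 : Sylow q G) : Subgroup G) ⊓ Q := by
    refine lt_of_lt_of_le h2 (le_inf (hT.trans ?_) inf_le_left)
    rw [← hks]
    rintro _ ⟨x, hx, rfl⟩
    exact Sylow.mem_smul_iff.2 (hP1 ⟨k⁻¹ * x * k, Sylow.mem_smul_iff.1 hx, rfl⟩)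
  obtain ⟨c1, hc1, e1⟩ := ih _ (hlt _ _ hl1) P P1 rfl
  obtain ⟨c2, hc2, e2⟩ := ih _ (hlt _ _ hl2) _ Q rfl
  refine ⟨c2 * k * c1, fun d hd => ?_, ?_⟩
  · have a1 := hc1 d (hl1.le hd)
    have a2 := hc2 d (hl2.le hd)
    have a3 := hkD d hd
    rw [mul_assoc, a1, ← mul_assoc, mul_assoc c2, a3, ← mul_assoc, a2]
    simp only [mul_assoc]
  · rw [e2, e1, mul_smul, mul_smul]

theorem Sylow.exists_mem_conj_eq {q : ℕ} {G : Type*} [Group G] [Finite G] (hq : q.Prime)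
    (hN : ∀ U : Subgroup G, U ≠ ⊥ → IsPGroup q U →
      IsPNilpotent q (Subgroup.normalizer (U : Set G)))
    (P : Sylow q G) {x g : G} (hx : x ∈ P) (hg : g * x * g⁻¹ ∈ P) :
    ∃ s ∈ P, g * x * g⁻¹ = s * x * s⁻¹ := by
  by_cases hP : (P : Subgroup G) = ⊥
  · have : x = 1 := by
      have hx' : x ∈ (P : Subgroup G) := hx
      rwa [hP, Subgroup.mem_bot] at hx'
    exact ⟨1, P.one_mem, by simp [this]⟩
  obtain ⟨c, hc, e⟩ := Sylow.exists_commute_smul_eq hq hN P (g⁻¹ • P)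
  have hcx := hc x ⟨hx, Sylow.mem_smul_iff.2 (by simpa using hg)⟩
  have hn : g * c ∈ Subgroup.normalizer (P : Set G) := by
    rw [← Sylow.smul_eq_iff_mem_normalizer, mul_smul, ← e, smul_inv_smul]
  have hnil := hN P hP P.2
  obtain ⟨k, s, hk, hs, e2⟩ := hnil.exists_mul_of_sylow hq (P.subtype Subgroup.le_normalizer)
    ⟨g * c, hn⟩
  have hs' : (s : G) ∈ P := hs
  have e3 : g * c = k * s := congrArg Subtype.val e2
  have e4 : (k : G) * (s * x * (s : G)⁻¹) = (s * x * (s : G)⁻¹) * k := by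
    have hmem : (s : G) * x * (s : G)⁻¹ ∈ P := P.mul_mem (P.mul_mem hs' hx) (P.inv_mem hs')
    have : ((P : Subgroup G).subgroupOf (Subgroup.normalizer (P : Set G))).Normal :=
      Subgroup.normal_in_normalizer
    have := hnil.commute_of_normal hq (U := (P : Subgroup G).subgroupOf _)
      (P.2.comap_of_injective (Subgroup.subtype _) (Subgroup.subtype_injective _)) hk
      (u := ⟨(s : G) * x * (s : G)⁻¹, Subgroup.le_normalizer hmem⟩) hmem
    exact congrArg Subtype.val this
  refine ⟨s, hs', ?_⟩
  calc g * x * g⁻¹ = (g * c) * (c⁻¹ * x * c) * (g * c)⁻¹ := by group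
    _ = (g * c) * x * (g * c)⁻¹ := by rw [mul_assoc c⁻¹, ← hcx]; group
    _ = (k * (s * x * (s : G)⁻¹)) * (k : G)⁻¹ := by rw [e3]; group
    _ = _ := by rw [e4]; group

open scoped commutatorElement in
theorem IsPNilpotent.of_normalizer {q : ℕ} {G : Type*} [Group G] [Finite G] (hq : q.Prime)
    (hN : ∀ U : Subgroup G, U ≠ ⊥ → IsPGroup q U →
      IsPNilpotent q (Subgroup.normalizer (U : Set G))) : IsPNilpotent q G := by
  have := Fact.mk hq
  induction hn : Nat.card G using Nat.strong_induction_on generalizing G with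
  | _ n ih =>
  subst hn
  have P : Sylow q G := default
  by_cases hP : (P : Subgroup G) = ⊥
  · refine IsPNilpotent.of_compl (K := ⊤) ?_ fun g => ⟨0, trivial⟩
    have h1 := P.card_mul_index
    rw [hP, Subgroup.card_bot, one_mul] at h1
    rw [Subgroup.card_top, ← h1, ← hP]
    exact ((Nat.Prime.coprime_iff_not_dvd hq).2 P.not_dvd_index).symm
  have hPn : Nontrivial P := (Subgroup.nontrivial_iff_ne_bot _).2 hP
  have hfoc : (P : Subgroup G).focalSubgroup ≤ ⁅(P : Subgroup G), (P : Subgroup G)⁆ := by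
    rw [Subgroup.focalSubgroup, Subgroup.closure_le]
    rintro g ⟨hg, x, hx, u, rfl⟩
    have h1 : u * x⁻¹ * u⁻¹ ∈ P := by
      have := P.mul_mem (P.inv_mem hx) hg
      rwa [commutatorElement_def, mul_assoc, mul_assoc, inv_mul_cancel_left, ← mul_assoc] at this
    obtain ⟨s, hs, e⟩ := Sylow.exists_mem_conj_eq hq hN P (P.inv_mem hx) h1
    have : ⁅x, u⁆ = ⁅x, s⁆ := by
      rw [commutatorElement_def, commutatorElement_def, mul_assoc, mul_assoc, ← mul_assoc u, e]
      group
    rw [this]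
    exact Subgroup.commutator_mem_commutator hx hs
  set L := (P : Subgroup G).transferFocal.ker with hLdef
  have hL : L < ⊤ := by
    refine lt_top_iff_ne_top.2 fun h => ?_
    have h1 := Subgroup.ker_transferFocal_inf_eq_focalSubgroup P
    rw [← hLdef, h, top_inf_eq] at h1
    have h2 : Group.IsNilpotent P := P.2.isNilpotent
    have h3 := Group.IsSolvable.commutator_lt_top_of_nontrivial P
    refine h3.not_ge fun x _ => ?_
    have h4 : (x : G) ∈ ⁅(P : Subgroup G), (P : Subgroup G)⁆ := hfoc (h1 ▸ x.2)
    rw [← Subgroup.map_subtype_commutator] at h4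
    obtain ⟨y, hy, e⟩ := h4
    rwa [← Subtype.ext e]
  refine IsPNilpotent.of_subgroup (L := L) (fun g => ?_)
    (ih (Nat.card L) ?_ (fun U hU hUq => ?_) rfl)
  · obtain ⟨k, hk⟩ := (P.2.to_quotient (P : Subgroup G).focalSubgroupOf)
      ((P : Subgroup G).transferFocal g)
    exact ⟨k, by rw [hLdef, MonoidHom.mem_ker, map_pow, hk]⟩
  · have := Subgroup.card_lt_card_of_lt' hL
    rwa [Subgroup.card_top] at this
  · refine IsPNilpotent.of_map_le L.subtype_injective (Subgroup.le_normalizer_map _)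
      (hN (U.map L.subtype) ?_ (hUq.map _))
    rwa [Ne, Subgroup.map_eq_bot_iff_of_injective _ L.subtype_injective]

section Weight

variable {k R W : Type*} [Field k] [CommGroup R] [Fintype R] [AddCommGroup W] [Module k W]

/-- The projection onto the weight space of `l` for a representation of a finite abelian group. -/
def weightProj (ρ : Representation k R W) (l : R →* kˣ) : Module.End k W :=
  (Fintype.card R : k)⁻¹ • ∑ r, ((l r)⁻¹ : kˣ).val • ρ r

theorem mul_weightProj (ρ : Representation k R W) (l : R →* kˣ) (s : R) :
    ρ s * weightProj ρ l = (l s : k) • weightProj ρ l := by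
  rw [weightProj, mul_smul_comm, smul_comm (l s : k), Finset.mul_sum,
    Finset.smul_sum (r := (l s : k))]
  refine congrArg _ (Fintype.sum_equiv (Equiv.mulLeft s) (fun r => ρ s * _)
    (fun r => (l s : k) • ((l r)⁻¹ : kˣ).val • ρ r) fun r => ?_)
  rw [Equiv.coe_mulLeft, map_mul, map_mul, smul_smul, mul_smul_comm,
    mul_inv_rev, Units.val_mul, mul_left_comm, ← Units.val_mul (l s), mul_inv_cancel, Units.val_one,
    mul_one]

theorem weightProj_mul_weightProj [DecidableEq (R →* kˣ)] (hR : (Fintype.card R : k) ≠ 0)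
    (ρ : Representation k R W) (l m : R →* kˣ) :
    weightProj ρ l * weightProj ρ m = if l = m then weightProj ρ m else 0 := by
  classical
  conv_lhs => rw [weightProj]
  rw [smul_mul_assoc, Finset.sum_mul]
  have h : ∀ r, (((l r)⁻¹ : kˣ).val • ρ r) * weightProj ρ m =
      ((Units.coeHom k).comp (l⁻¹ * m) r) • weightProj ρ m := by
    intro r
    rw [smul_mul_assoc, mul_weightProj, smul_smul]
    rfl
  rw [Finset.sum_congr rfl fun r _ => h r, ← Finset.sum_smul, sum_hom_units]
  have h2 : ((Units.coeHom k).comp (l⁻¹ * m) = 1) ↔ l = m := by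
    rw [← inv_mul_eq_one (a := l) (b := m)]
    constructor
    · intro h
      ext r
      exact DFunLike.congr_fun h r
    · intro h
      rw [h]
      rfl
  by_cases h3 : l = m
  · rw [if_pos (h2.2 h3), if_pos h3, smul_smul, inv_mul_cancel₀ hR, one_smul]
  · rw [if_neg (mt h2.1 h3), if_neg h3]
    simp

theorem sum_weightProj [IsAlgClosed k] [Fintype (R →* kˣ)] (hR : (Fintype.card R : k) ≠ 0)
    (ρ : Representation k R W) : ∑ l, weightProj ρ l = 1 := by
  classical
  have : NeZero (Fintype.card R : k) := ⟨hR⟩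
  have : NeZero ((Monoid.exponent R : ℕ) : k) := by
    refine ⟨fun h => hR ?_⟩
    obtain ⟨c, hc⟩ := Group.exponent_dvd_card (G := R)
    rw [hc, Nat.cast_mul, h, zero_mul]
  simp only [weightProj]
  rw [← Finset.smul_sum, Finset.sum_comm]
  have h : ∀ r : R, ∑ l : R →* kˣ, ((l r)⁻¹ : kˣ).val • ρ r =
      if r = 1 then (Fintype.card R : k) • (1 : Module.End k W) else 0 := by
    intro r
    rw [← Finset.sum_smul]
    let f : (R →* kˣ) →* k :=
      { toFun := fun l => ((l r)⁻¹ : kˣ).val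
        map_one' := by simp
        map_mul' := fun a b => by simp [mul_comm] }
    have h1 := sum_hom_units f
    have h2 : f = 1 ↔ r = 1 := by
      constructor
      · intro hf
        by_contra hr
        obtain ⟨l, hl⟩ := CommGroup.exists_apply_ne_one_of_hasEnoughRootsOfUnity R k hr
        have h3 : ((l r)⁻¹ : kˣ).val = 1 := DFunLike.congr_fun hf l
        rw [Units.val_eq_one, inv_eq_one] at h3
        exact hl h3
      · rintro rfl
        ext l
        simp [f]
    change (∑ l, f l) • ρ r = _
    rw [h1]
    by_cases hr : r = 1
    · rw [if_pos (h2.2 hr), if_pos hr, hr, map_one, ← Nat.card_eq_fintype_card,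
        CommGroup.card_monoidHom_of_hasEnoughRootsOfUnity, Nat.card_eq_fintype_card]
    · rw [if_neg (mt h2.1 hr), if_neg hr]
      simp
  rw [Finset.sum_congr rfl fun r _ => h r, Finset.sum_ite_eq' Finset.univ (1 : R),
    if_pos (Finset.mem_univ _), smul_smul, inv_mul_cancel₀ hR, one_smul]

end Weight

theorem Representation.card_lt_pow_finrank {k R A W : Type*} [Field k] [IsAlgClosed k]
    [CommGroup R] [Finite R] [CommGroup A] [Finite A] [AddCommGroup W] [Module k W]
    [FiniteDimensional k W] {q : ℕ} (hq : 3 ≤ q) (hR : (Nat.card R : k) ≠ 0)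
    (ρ : Representation k R W) (hρ : Function.Injective ρ) (τ : Representation k A W)
    (φ : A →* MulAut R) (hφ : Function.Injective φ)
    (hτ : ∀ a r, τ a * ρ r = ρ (φ a r) * τ a) (hA : Nontrivial A)
    {F : Submodule k W} (hF : ∀ w ∈ F, ∀ a, τ a w = w) :
    Nat.card A * q ^ Module.finrank k F < q ^ Module.finrank k W := by
  classical
  have := Fintype.ofFinite R
  have := Fintype.ofFinite (R →* kˣ)
  rw [Nat.card_eq_fintype_card] at hR
  let act : MulAction A (R →* kˣ) :=
    { smul := fun a l => l.comp (φ a)⁻¹.toMonoidHom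
      one_smul := fun l => by
        change l.comp (φ 1)⁻¹.toMonoidHom = l
        rw [map_one, inv_one]; rfl
      mul_smul := fun a b l => by
        change l.comp (φ (a * b))⁻¹.toMonoidHom =
            (l.comp (φ b)⁻¹.toMonoidHom).comp (φ a)⁻¹.toMonoidHom
        rw [map_mul, mul_inv_rev]; rfl }
  have hact : ∀ (a : A) (l : R →* kˣ) (r : R), (a • l) r = l ((φ a)⁻¹ r) := fun _ _ _ => rfl
  set e := weightProj ρ with he
  have he1 : ∀ a l, τ a * e l = e (a • l) * τ a := by
    intro a l
    simp only [he, weightProj]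
    rw [mul_smul_comm, smul_mul_assoc, Finset.mul_sum, Finset.sum_mul]
    refine congrArg _ (Fintype.sum_equiv (φ a).toEquiv _ _ fun r => ?_)
    rw [mul_smul_comm, smul_mul_assoc, hτ, hact]
    simp
  have he2 := weightProj_mul_weightProj hR ρ
  have he3 := sum_weightProj hR ρ
  set n : (R →* kˣ) → ℕ := fun l => Module.finrank k (LinearMap.range (e l)) with hn
  have hn1 : ∑ l, n l ≤ Module.finrank k W := by
    rw [← Module.finrank_pi_fintype (R := k) (M := fun l => LinearMap.range (e l))]
    refine LinearMap.finrank_le_finrank_of_surjective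
      (f := LinearMap.pi fun l => (e l).rangeRestrict) fun y => ⟨∑ l, (y l : W), ?_⟩
    ext l
    rw [LinearMap.pi_apply, LinearMap.codRestrict_apply, map_sum, Finset.sum_eq_single l]
    · obtain ⟨x, hx⟩ := (y l).2
      rw [← hx, ← Module.End.mul_apply, he2, if_pos rfl]
    · intro m _ hm
      obtain ⟨x, hx⟩ := (y m).2
      rw [← hx, ← Module.End.mul_apply, he2, if_neg hm.symm, LinearMap.zero_apply]
    · simp
  let Ω := MulAction.orbitRel.Quotient A (R →* kˣ)
  have : Fintype Ω := Fintype.ofFinite _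
  let pr : (R →* kˣ) → Ω := fun l => Quotient.mk _ l
  let rep : Ω → (R →* kˣ) := fun w => w.out
  have hrep : ∀ l, ∃ a : A, a • rep (pr l) = l := fun l =>
    MulAction.mem_orbit_iff.1 (MulAction.orbitRel_apply.1
      ((MulAction.orbitRel A (R →* kˣ)).symm
        (Quotient.mk_out (s := MulAction.orbitRel A (R →* kˣ)) l)))
  have hprs : ∀ (a : A) l, pr (a • l) = pr l := fun a l =>
    Quotient.sound (MulAction.orbitRel_apply.2 (MulAction.mem_orbit l a))
  have hprr : ∀ w, pr (rep w) = w := fun w => Quotient.out_eq w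
  have hle : ∀ l (a : A), n (a • l) ≤ n l := by
    intro l a
    refine (Submodule.finrank_mono ?_).trans
        (Submodule.finrank_map_le (τ a) (LinearMap.range (e l)))
    rintro _ ⟨x, rfl⟩
    refine ⟨e l (τ a⁻¹ x), ⟨_, rfl⟩, ?_⟩
    rw [← Module.End.mul_apply, he1, Module.End.mul_apply, ← Module.End.mul_apply (τ a), ← map_mul]
    simp
  have hnl : ∀ l (a : A), n (a • l) = n l := fun l a =>
    (hle l a).antisymm (by simpa using hle (a • l) a⁻¹)
  have hn2 : Module.finrank k F ≤ ∑ w, n (rep w) := by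
    rw [← Module.finrank_pi_fintype (R := k) (M := fun w => LinearMap.range (e (rep w)))]
    refine LinearMap.finrank_le_finrank_of_injective
      (f := (LinearMap.pi fun w => (e (rep w)).rangeRestrict).comp F.subtype) ?_
    rw [injective_iff_map_eq_zero]
    intro v hv
    have h1 : ∀ w, e (rep w) v = 0 := fun w => congrArg Subtype.val (congrFun hv w)
    have h2 : ∀ l, e l v = 0 := by
      intro l
      obtain ⟨a, ha⟩ := hrep l
      rw [← ha, ← hF v v.2 a, ← Module.End.mul_apply, ← he1, Module.End.mul_apply, h1, map_zero]
    ext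
    have h3 := LinearMap.congr_fun he3 (v : W)
    rw [LinearMap.sum_apply, Finset.sum_eq_zero fun l _ => h2 l] at h3
    simpa using h3.symm
  let o : Ω → ℕ := fun w => Fintype.card {l // pr l = w}
  have hn3 : ∑ l, n l = ∑ w, o w * n (rep w) := by
    rw [← Finset.sum_fiberwise Finset.univ pr]
    refine Finset.sum_congr rfl fun w _ => ?_
    rw [Finset.sum_const_nat (m := n (rep w))]
    · rw [← Fintype.card_subtype]
    intro l hl
    obtain ⟨a, ha⟩ := hrep l
    rw [Finset.mem_filter] at hl
    rw [← hl.2, ← hnl (rep _) a, ha]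
  have ho : ∀ w, 1 ≤ o w := fun w => Fintype.card_pos_iff.2 ⟨⟨rep w, hprr w⟩⟩
  have hcA : Nat.card A ≤ ∏ w : {w // n (rep w) ≠ 0}, o w := by
    let g : A → ∀ w : {w // n (rep w) ≠ 0}, {l // pr l = w} :=
      fun a w => ⟨a • rep w, (hprs a _).trans (hprr w)⟩
    have hg : Function.Injective g := by
      intro a b hab
      have h1 : ∀ l, e l ≠ 0 → (b⁻¹ * a) • l = l := by
        intro l hl
        obtain ⟨d, hd⟩ := hrep l
        have h2 : n (rep (pr l)) ≠ 0 := by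
          rw [← hnl _ d, hd]
          exact fun h => hl (LinearMap.range_eq_bot.1 (Submodule.finrank_eq_zero.1 h))
        have h3 : a • rep (pr l) = b • rep (pr l) :=
          congrArg Subtype.val (congrFun hab ⟨pr l, h2⟩)
        rw [← hd, smul_smul, mul_comm, mul_smul, mul_smul, h3, inv_smul_smul]
      have h2 : φ (b⁻¹ * a) = 1 := by
        rw [← inv_inj, inv_one]
        ext r
        refine hρ ?_
        have h3 : ∀ s, ρ s = ∑ l, (l s : k) • e l := fun s => by
          rw [← mul_one (ρ s), ← he3, Finset.mul_sum]
          exact Finset.sum_congr rfl fun l _ => mul_weightProj ρ l s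
        rw [h3, h3]
        refine Finset.sum_congr rfl fun l _ => ?_
        by_cases hl : e l = 0
        · rw [hl, smul_zero, smul_zero]
        · rw [← hact, h1 l hl]
          rfl
      exact (inv_mul_eq_one.1 (hφ (h2.trans (map_one φ).symm))).symm
    have := Nat.card_le_card_of_injective g hg
    rwa [Nat.card_eq_fintype_card (α := ∀ w : {w // n (rep w) ≠ 0}, {l // pr l = w}),
      Fintype.card_pi] at this
  have hlt : ∏ w : {w // n (rep w) ≠ 0}, o w < ∏ w, q ^ ((o w - 1) * n (rep w)) := by
    have h1 : ∏ w : {w // n (rep w) ≠ 0}, o w = ∏ w, if n (rep w) ≠ 0 then o w else 1 := by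
      rw [← Finset.prod_filter]
      exact (Finset.prod_subtype (Finset.univ.filter fun w => n (rep w) ≠ 0) (by simp) o).symm
    have h2 : 1 < ∏ w : {w // n (rep w) ≠ 0}, o w := Finite.one_lt_card.trans_le hcA
    obtain ⟨w0, hw0⟩ : ∃ w : {w // n (rep w) ≠ 0}, o w ≠ 1 := by
      by_contra! h
      rw [Finset.prod_eq_one fun w _ => h w] at h2
      exact lt_irrefl _ h2
    have h3 : ∀ t : ℕ, t ≠ 0 → t + 1 < q ^ t := by
      intro t ht
      have h4 : 1 + t * 2 ≤ (1 + 2) ^ t := by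
        have := one_add_mul_le_pow (a := (2 : ℤ)) (by norm_num) t
        exact_mod_cast this
      have h5 : 3 ^ t ≤ q ^ t := Nat.pow_le_pow_left hq t
      norm_num at h4
      omega
    have h4 : ∀ w, n (rep w) ≠ 0 → o w ≠ 1 → o w < q ^ ((o w - 1) * n (rep w)) := by
      intro w hw hw1
      have := h3 (o w - 1) (by have := ho w; omega)
      have h5 : q ^ (o w - 1) ≤ q ^ ((o w - 1) * n (rep w)) :=
        Nat.pow_le_pow_right (by omega) (Nat.le_mul_of_pos_right _ (Nat.pos_of_ne_zero hw))
      have := ho w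
      omega
    rw [h1]
    refine Finset.prod_lt_prod (fun w _ => ?_) (fun w _ => ?_) ⟨w0, Finset.mem_univ _, ?_⟩
    · split_ifs
      · exact ho w
      · exact one_pos
    · split_ifs with h
      · by_cases h5 : o w = 1
        · rw [h5]; simp
        · exact (h4 w h h5).le
      · exact Nat.one_le_pow _ _ (by omega)
    · rw [if_pos w0.2]
      exact h4 _ w0.2 hw0
  rw [Finset.prod_pow_eq_pow_sum] at hlt
  calc Nat.card A * q ^ Module.finrank k F <
      q ^ (∑ w, (o w - 1) * n (rep w)) * q ^ (∑ w, n (rep w)) := by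
        refine Nat.mul_lt_mul_of_lt_of_le (hcA.trans_lt hlt) (Nat.pow_le_pow_right (by omega) hn2)
            (by positivity)
    _ = q ^ (∑ l, n l) := by
        rw [← pow_add, ← Finset.sum_add_distrib, hn3]
        congr 1
        refine Finset.sum_congr rfl fun w _ => ?_
        obtain ⟨c, hc⟩ := Nat.exists_eq_add_of_le' (ho w)
        rw [hc]; simp; ring
    _ ≤ _ := Nat.pow_le_pow_right (by omega) hn1

theorem Representation.card_mul_card_fixed_lt {V R A F : Type*} [Field F] [Finite F]
    [AddCommGroup V] [Module F V] [Finite V] [CommGroup R]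
    [Finite R] [CommGroup A] [Finite A] (hq : 3 ≤ Nat.card F)
    (hR : (Nat.card R : F) ≠ 0) (ρ : Representation F R V)
    (hρ : Function.Injective ρ) (τ : Representation F A V) (φ : A →* MulAut R)
    (hφ : Function.Injective φ) (hτ : ∀ a r, τ a * ρ r = ρ (φ a r) * τ a) (hA : Nontrivial A) :
    Nat.card A * Nat.card {v : V // ∀ a, τ a v = v} < Nat.card V := by
  let k := AlgebraicClosure F
  let B : Module.End F V →* Module.End k (TensorProduct F k V) :=
    (Module.End.baseChangeHom F k V : Module.End F V →* Module.End k (TensorProduct F k V))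
  have hB : ∀ (f : Module.End F V) v, B f (1 ⊗ₜ v) = 1 ⊗ₜ (f v) := fun f v => rfl
  have hinj := Module.Flat.tensorProduct_mk_injective F V k
  have hBi : Function.Injective B := by
    intro f g hfg
    ext v
    have h1 := LinearMap.congr_fun hfg (1 ⊗ₜ v)
    rw [hB, hB] at h1
    exact hinj h1
  let L : Submodule F V :=
    { carrier := {v | ∀ a, τ a v = v}
      zero_mem' := fun a => map_zero _
      add_mem' := fun hx hy a => by rw [map_add, hx a, hy a]
      smul_mem' := fun c x hx a => by rw [map_smul, hx a] }
  let Lk := LinearMap.range (L.subtype.baseChange k)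
  have hLk : Module.finrank k Lk = Module.finrank F L := by
    rw [← Module.finrank_baseChange (R := k) (S := F) (M' := L)]
    refine LinearMap.finrank_range_of_inj ?_
    exact Module.Flat.lTensor_preserves_injective_linearMap L.subtype L.subtype_injective
  have hfix : ∀ w ∈ Lk, ∀ a, B (τ a) w = w := by
    rintro _ ⟨x, rfl⟩ a
    induction x using TensorProduct.induction_on with
    | zero => simp
    | add x y hx hy => rw [map_add, map_add, hx, hy]
    | tmul c x =>
      rw [LinearMap.baseChange_tmul]
      change c ⊗ₜ[F] (τ a x) = _
      rw [x.2 a]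
      rfl
  have hRk : (Nat.card R : k) ≠ 0 := by
    rw [← map_natCast (algebraMap F k), Ne, map_eq_zero]
    exact hR
  have key := Representation.card_lt_pow_finrank (k := k) hq hRk (B.comp ρ) (hBi.comp hρ)
    (B.comp τ) φ hφ (fun a r => by
      simp only [MonoidHom.comp_apply]
      rw [← map_mul, hτ, map_mul]) hA (F := Lk) hfix
  rw [hLk, Module.finrank_baseChange] at key
  have h2 : Nat.card {v : V // ∀ a, τ a v = v} = Nat.card F ^ Module.finrank F L :=
    Module.natCard_eq_pow_finrank (K := F) (V := L)
  rw [Module.natCard_eq_pow_finrank (K := F) (V := V), h2]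
  exact key

/-- The action of the endomorphisms of an elementary abelian group on the associated
vector space. -/
def zmodEndHom (q : ℕ) (V : Type*) [AddCommGroup V] [Module (ZMod q) V] :
    AddMonoid.End V →* Module.End (ZMod q) V where
  toFun f := AddMonoidHom.toZModLinearMap q f
  map_one' := rfl
  map_mul' _ _ := rfl

theorem AddMonoid.End.card_mul_card_fixed_lt {V R A : Type*} [AddCommGroup V] [Finite V]
    [CommGroup R] [Finite R] [CommGroup A] [Finite A] {q : ℕ} [Module (ZMod q) V] (hqp : q.Prime)
        (hq : 3 ≤ q)
    (hR : (Nat.card R).Coprime q) (ρ : R →* AddMonoid.End V)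
    (hρ : Function.Injective ρ) (τ : A →* AddMonoid.End V) (φ : A →* MulAut R)
    (hφ : Function.Injective φ) (hτ : ∀ a r, τ a * ρ r = ρ (φ a r) * τ a) (hA : Nontrivial A) :
    Nat.card A * Nat.card {v : V // ∀ a, τ a v = v} < Nat.card V := by
  have hfact := Fact.mk hqp
  let d : AddMonoid.End V →* Module.End (ZMod q) V := zmodEndHom q V
  have hd : Function.Injective d := fun f g h => by
    ext v
    exact DFunLike.congr_fun h v
  refine Representation.card_mul_card_fixed_lt (V := V) (F := ZMod q)
    (by rwa [Nat.card_zmod]) ?_ (d.comp ρ) (hd.comp hρ) (d.comp τ)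
    φ hφ (fun a r => ?_) hA
  · rw [Ne, ZMod.natCast_eq_zero_iff]
    exact (Nat.Prime.coprime_iff_not_dvd hqp).1 hR.symm
  · simp only [MonoidHom.comp_apply]
    rw [← map_mul, hτ, map_mul]

theorem MulAut.card_mul_card_fixed_lt {V R A : Type*} [CommGroup V] [Finite V] [CommGroup R]
    [Finite R] [CommGroup A] [Finite A] {q : ℕ} (hqp : q.Prime) (hq : 3 ≤ q)
    (hV : ∀ v : V, v ^ q = 1) (hR : (Nat.card R).Coprime q) (ρ : R →* MulAut V)
    (hρ : Function.Injective ρ) (τ : A →* MulAut V) (φ : A →* MulAut R)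
    (hφ : Function.Injective φ) (hτ : ∀ a r, τ a * ρ r = ρ (φ a r) * τ a) (hA : Nontrivial A) :
    Nat.card A * Nat.card {v : V // ∀ a, τ a v = v} < Nat.card V := by
  let c : MulAut V →* AddMonoid.End (Additive V) :=
    { toFun := fun f => MonoidHom.toAdditive f.toMonoidHom
      map_one' := rfl
      map_mul' := fun _ _ => rfl }
  have hc : Function.Injective c := fun f g h => by
    ext v
    exact DFunLike.congr_fun h (Additive.ofMul v)
  let := AddCommGroup.zmodModule (n := q) (G := Additive V) fun v => hV v.toMul
  exact AddMonoid.End.card_mul_card_fixed_lt (V := Additive V) hqp hq hR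
    (c.comp ρ) (hc.comp hρ) (c.comp τ) φ hφ (fun a r => by
      simp only [MonoidHom.comp_apply]
      rw [← map_mul, hτ, map_mul]) hA

section Functors
variable {G H : Type*} [Group G] [Group H]

/-- `A` is an abelian subgroup of `S` of largest possible order. -/
def IsMaxAbelian (S A : Subgroup G) : Prop :=
  A ≤ S ∧ (∀ x ∈ A, ∀ y ∈ A, x * y = y * x) ∧
    ∀ B ≤ S, (∀ x ∈ B, ∀ y ∈ B, x * y = y * x) → Nat.card B ≤ Nat.card A

/-- The Thompson subgroup of `S`, generated by the abelian subgroups of largest order. -/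
def thompsonSubgroup (S : Subgroup G) : Subgroup G := sSup {A | IsMaxAbelian S A}

/-- The elements of order dividing `q` in the centre of `S`. -/
def omegaCenter (q : ℕ) (S : Subgroup G) : Subgroup G where
  carrier := {z | z ∈ S ∧ z ^ q = 1 ∧ ∀ s ∈ S, z * s = s * z}
  one_mem' := ⟨S.one_mem, one_pow q, by simp⟩
  mul_mem' := by
    rintro a b ⟨ha, ha', ha''⟩ ⟨hb, hb', hb''⟩
    refine ⟨S.mul_mem ha hb, ?_, fun s hs => ?_⟩
    · rw [(show Commute a b from ha'' b hb).mul_pow, ha', hb', one_mul]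
    · rw [mul_assoc, hb'' s hs, ← mul_assoc, ha'' s hs, mul_assoc]
  inv_mem' := by
    rintro a ⟨ha, ha', ha''⟩
    refine ⟨S.inv_mem ha, by rw [inv_pow, ha', inv_one], fun s hs => ?_⟩
    exact (show Commute a s from ha'' s hs).inv_left

theorem omegaCenter_le (q : ℕ) (S : Subgroup G) : omegaCenter q S ≤ S := fun _ h => h.1

theorem thompsonSubgroup_le (S : Subgroup G) : thompsonSubgroup S ≤ S :=
  sSup_le fun _ h => h.1

theorem IsMaxAbelian.le_thompsonSubgroup {S A : Subgroup G} (h : IsMaxAbelian S A) :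
    A ≤ thompsonSubgroup S := le_sSup h

theorem exists_isMaxAbelian [Finite G] (S : Subgroup G) : ∃ A, IsMaxAbelian S A := by
  let X := {A : Subgroup G // A ≤ S ∧ ∀ x ∈ A, ∀ y ∈ A, x * y = y * x}
  have : Nonempty X := ⟨⊥, bot_le, by simp [Subgroup.mem_bot]⟩
  obtain ⟨A, hA⟩ := Finite.exists_max (fun A : X => Nat.card A.1)
  exact ⟨A.1, A.2.1, A.2.2, fun B hB hB' => hA ⟨B, hB, hB'⟩⟩

theorem thompsonSubgroup_ne_bot [Finite G] {S : Subgroup G} (hS : S ≠ ⊥) :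
    thompsonSubgroup S ≠ ⊥ := by
  obtain ⟨A, hA⟩ := exists_isMaxAbelian S
  intro h
  have hA' : A = ⊥ := le_bot_iff.1 (h ▸ hA.le_thompsonSubgroup)
  obtain ⟨x, hx, hx1⟩ := Subgroup.ne_bot_iff_exists_ne_one.1 hS |>.elim
    fun x hx => (⟨x, x.2, by simpa using hx⟩ : ∃ x ∈ S, x ≠ 1)
  have h1 := hA.2.2 (Subgroup.zpowers x) (by simpa using hx) (by
    rintro _ ⟨i, rfl⟩ _ ⟨j, rfl⟩
    exact (Commute.refl x).zpow_zpow i j)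
  rw [hA', Subgroup.card_bot] at h1
  have h2 : Subgroup.zpowers x = ⊥ := Subgroup.eq_bot_of_card_le _ h1
  exact hx1 (Subgroup.zpowers_eq_bot.1 h2)

theorem omegaCenter_ne_bot [Finite G] {q : ℕ} (hq : q.Prime) {S : Subgroup G} (hS : S ≠ ⊥)
    (hSq : IsPGroup q S) : omegaCenter q S ≠ ⊥ := by
  have := Fact.mk hq
  have : Nontrivial S := (Subgroup.nontrivial_iff_ne_bot S).2 hS
  have h1 : Nontrivial (Subgroup.center S) := hSq.center_nontrivial
  have h2 : IsPGroup q (Subgroup.center S) := hSq.to_subgroup _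
  obtain ⟨n, hn, hc⟩ := h2.nontrivial_iff_card.1 h1
  obtain ⟨z, hz⟩ := exists_prime_orderOf_dvd_card' (G := Subgroup.center S) q
    (hc ▸ dvd_pow_self q hn.ne')
  intro h
  have h3 : ((z : S) : G) ∈ omegaCenter q S := by
    refine ⟨(z : S).2, ?_, fun s hs => ?_⟩
    · have := pow_orderOf_eq_one z
      rw [hz] at this
      exact_mod_cast congrArg (fun x : Subgroup.center S => ((x : S) : G)) this
    · exact congrArg Subtype.val (Subgroup.mem_center_iff.1 z.2 ⟨s, hs⟩).symm
  rw [h, Subgroup.mem_bot] at h3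
  have h4 : z = 1 := by
    ext
    exact h3
  rw [h4, orderOf_one] at hz
  exact hq.ne_one hz.symm

section Map
variable {f : G →* H} {S : Subgroup G}

theorem injOn_of_ker (hf : ∀ x ∈ S, f x = 1 → x = 1)
    {x y : G} (hx : x ∈ S) (hy : y ∈ S) (h : f x = f y) : x = y := by
  have := hf (x * y⁻¹) (S.mul_mem hx (S.inv_mem hy)) (by rw [map_mul, map_inv, h, mul_inv_cancel])
  exact mul_inv_eq_one.1 this

theorem card_map_of_ker (hf : ∀ x ∈ S, f x = 1 → x = 1)
    {A : Subgroup G} (hA : A ≤ S) : Nat.card (A.map f) = Nat.card A := by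
  refine (Nat.card_congr (Equiv.ofBijective (fun x : A => (⟨f x, x, x.2, rfl⟩ : A.map f))
    ⟨fun x y h => ?_, ?_⟩)).symm
  · exact Subtype.ext (injOn_of_ker hf (hA x.2) (hA y.2) (congrArg Subtype.val h))
  · rintro ⟨_, x, hx, rfl⟩
    exact ⟨⟨x, hx⟩, rfl⟩

theorem exists_eq_map_of_le_map {B : Subgroup H} (hB : B ≤ S.map f) :
    ∃ A ≤ S, A.map f = B := by
  refine ⟨B.comap f ⊓ S, inf_le_right, ?_⟩
  ext y
  constructor
  · rintro ⟨x, hx, rfl⟩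
    exact hx.1
  · intro hy
    obtain ⟨x, hx, rfl⟩ := hB hy
    exact ⟨x, ⟨hy, hx⟩, rfl⟩

theorem comm_map_iff (hf : ∀ x ∈ S, f x = 1 → x = 1)
    {A : Subgroup G} (hA : A ≤ S) :
    (∀ x ∈ A.map f, ∀ y ∈ A.map f, x * y = y * x) ↔ ∀ x ∈ A, ∀ y ∈ A, x * y = y * x := by
  constructor
  · intro h x hx y hy
    refine injOn_of_ker hf (S.mul_mem (hA hx) (hA hy)) (S.mul_mem (hA hy) (hA hx)) ?_
    rw [map_mul, map_mul]
    exact h _ ⟨x, hx, rfl⟩ _ ⟨y, hy, rfl⟩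
  · rintro h _ ⟨x, hx, rfl⟩ _ ⟨y, hy, rfl⟩
    rw [← map_mul, h x hx y hy, map_mul]

theorem isMaxAbelian_map_iff (hf : ∀ x ∈ S, f x = 1 → x = 1)
    {A : Subgroup G} (hA : A ≤ S) :
    IsMaxAbelian (S.map f) (A.map f) ↔ IsMaxAbelian S A := by
  rw [IsMaxAbelian, IsMaxAbelian, comm_map_iff hf hA]
  refine ⟨fun h => ⟨hA, h.2.1, fun B hB hBc => ?_⟩,
    fun h => ⟨Subgroup.map_mono hA, h.2.1, fun B hB hBc => ?_⟩⟩
  · have := h.2.2 (B.map f) (Subgroup.map_mono hB) ((comm_map_iff hf hB).2 hBc)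
    rwa [card_map_of_ker hf hB, card_map_of_ker hf hA] at this
  · obtain ⟨B, hB', rfl⟩ := exists_eq_map_of_le_map hB
    rw [card_map_of_ker hf hB', card_map_of_ker hf hA]
    exact h.2.2 B hB' ((comm_map_iff hf hB').1 hBc)

theorem map_thompsonSubgroup (hf : ∀ x ∈ S, f x = 1 → x = 1) :
    (thompsonSubgroup S).map f = thompsonSubgroup (S.map f) := by
  refine le_antisymm ?_ (sSup_le fun B hB => ?_)
  · rw [thompsonSubgroup, Subgroup.map_le_iff_le_comap]
    refine sSup_le fun A hA => ?_
    rw [← Subgroup.map_le_iff_le_comap]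
    exact ((isMaxAbelian_map_iff hf hA.1).2 hA).le_thompsonSubgroup
  · obtain ⟨A, hA, rfl⟩ := exists_eq_map_of_le_map hB.1
    exact Subgroup.map_mono ((isMaxAbelian_map_iff hf hA).1 hB).le_thompsonSubgroup

theorem map_omegaCenter (hf : ∀ x ∈ S, f x = 1 → x = 1)
    (q : ℕ) : (omegaCenter q S).map f = omegaCenter q (S.map f) := by
  ext y
  constructor
  · rintro ⟨x, ⟨hx, hxq, hxc⟩, rfl⟩
    refine ⟨⟨x, hx, rfl⟩, by rw [← map_pow, hxq, map_one], ?_⟩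
    rintro _ ⟨s, hs, rfl⟩
    rw [← map_mul, hxc s hs, map_mul]
  · rintro ⟨⟨x, hx, rfl⟩, hxq, hxc⟩
    refine ⟨x, ⟨hx, hf _ (S.pow_mem hx q) (by rw [map_pow, hxq]), fun s hs => ?_⟩, rfl⟩
    refine injOn_of_ker hf (S.mul_mem hx hs) (S.mul_mem hs hx) ?_
    rw [map_mul, map_mul]
    exact hxc _ ⟨s, hs, rfl⟩

end Map

/-- The two characteristic pieces of a `q`-group used in Thompson's criterion. -/
def charPart (q : ℕ) (b : Bool) (S : Subgroup G) : Subgroup G :=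
  if b then thompsonSubgroup S else omegaCenter q S

theorem charPart_le (q : ℕ) (b : Bool) (S : Subgroup G) : charPart q b S ≤ S := by
  cases b
  · exact omegaCenter_le q S
  · exact thompsonSubgroup_le S

theorem charPart_ne_bot [Finite G] {q : ℕ} (hq : q.Prime) (b : Bool) {S : Subgroup G}
    (hS : S ≠ ⊥) (hSq : IsPGroup q S) : charPart q b S ≠ ⊥ := by
  cases b
  · exact omegaCenter_ne_bot hq hS hSq
  · exact thompsonSubgroup_ne_bot hS

theorem map_charPart {f : G →* H} {S : Subgroup G} (hf : ∀ x ∈ S, f x = 1 → x = 1)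
    (q : ℕ) (b : Bool) : (charPart q b S).map f = charPart q b (S.map f) := by
  cases b
  · exact map_omegaCenter hf q
  · exact map_thompsonSubgroup hf

theorem map_charPart_of_injective {f : G →* H} (hf : Function.Injective f) (S : Subgroup G)
    (q : ℕ) (b : Bool) : (charPart q b S).map f = charPart q b (S.map f) :=
  map_charPart (fun _ _ h => hf (h.trans (map_one f).symm)) q b

theorem normalizer_le_normalizer_charPart (q : ℕ) (b : Bool) (S : Subgroup G) :
    Subgroup.normalizer (S : Set G) ≤ Subgroup.normalizer (charPart q b S : Set G) := by
  intro g hg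
  rw [Subgroup.mem_normalizer_iff_map_conj_eq] at hg ⊢
  have := map_charPart_of_injective (f := (MulAut.conj g : G →* G)) (MulAut.conj g).injective S q b
  rw [this, hg]

end Functors

/-- Thompson's hypothesis: the normalizers of the two characteristic pieces of every Sylow
`q`-subgroup have normal `q`-complements. -/
def ThompsonHyp (q : ℕ) (G : Type*) [Group G] : Prop :=
  ∀ (P : Sylow q G) (b : Bool),
    IsPNilpotent q (Subgroup.normalizer (charPart q b (P : Subgroup G) : Set G))

section Thompson
variable {q : ℕ} {G : Type*} [Group G]

theorem ThompsonHyp.of_subgroup {H : Subgroup G}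
    (h : ∀ (T : Sylow q H) (b : Bool), IsPNilpotent q
      (Subgroup.normalizer (charPart q b ((T : Subgroup H).map H.subtype) : Set G))) :
    ThompsonHyp q H := by
  intro T b
  refine IsPNilpotent.of_map_le H.subtype_injective ?_ (h T b)
  rw [← map_charPart_of_injective H.subtype_injective]
  exact Subgroup.le_normalizer_map H.subtype

theorem Sylow.exists_eq_map_subtype [Finite G] (hq : q.Prime) {H : Subgroup G} {P : Sylow q G}
    (hP : (P : Subgroup G) ≤ H) (T : Sylow q H) :
    ∃ Q : Sylow q G, (Q : Subgroup G) = (T : Subgroup H).map H.subtype := by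
  have := Fact.mk hq
  have h1 : Nat.card ((T : Subgroup H).map H.subtype) = Nat.card T :=
    Subgroup.card_map_of_injective H.subtype_injective
  have h2 : Nat.card T = Nat.card (P.subtype hP) :=
    Nat.card_congr (Sylow.equiv T (P.subtype hP)).toEquiv
  have h3 : Nat.card (P.subtype hP) = Nat.card P :=
    Nat.card_congr (Subgroup.subgroupOfEquivOfLe hP).toEquiv
  exact ⟨Sylow.ofCard _ (by rw [h1, h2, h3, P.card_eq_multiplicity]), Sylow.coe_ofCard _ _⟩

theorem ThompsonHyp.of_sylow_le [Finite G] (hq : q.Prime) (hG : ThompsonHyp q G) {H : Subgroup G}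
    {P : Sylow q G} (hP : (P : Subgroup G) ≤ H) : ThompsonHyp q H := by
  refine ThompsonHyp.of_subgroup fun T b => ?_
  obtain ⟨Q, hQ⟩ := Sylow.exists_eq_map_subtype hq hP T
  rw [← hQ]
  exact hG Q b

theorem ThompsonHyp.exists_normal [Finite G] (hq : q.Prime) (hG : ThompsonHyp q G)
    (ih : ∀ H : Subgroup G, H ≠ ⊤ → ThompsonHyp q H → IsPNilpotent q H)
    (hn : ¬ IsPNilpotent q G) : ∃ U : Subgroup G, U.Normal ∧ U ≠ ⊥ ∧ IsPGroup q U := by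
  have := Fact.mk hq
  let X := {U : Subgroup G // U ≠ ⊥ ∧ IsPGroup q U ∧
    ¬ IsPNilpotent q (Subgroup.normalizer (U : Set G))}
  have : Nonempty X := by
    by_contra hX
    refine hn (IsPNilpotent.of_normalizer hq fun U hU hUq => ?_)
    by_contra h
    exact hX ⟨U, hU, hUq, h⟩
  obtain ⟨⟨U, hU, hUq, hUn⟩, hmax⟩ := Finite.exists_max
    (fun U : X => (Nat.card (Subgroup.normalizer (U.1 : Set G))).factorization q)
  by_cases htop : Subgroup.normalizer (U : Set G) = ⊤
  · exact ⟨U, Subgroup.normalizer_eq_top_iff.1 htop, hU, hUq⟩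
  refine absurd (ih _ htop (ThompsonHyp.of_subgroup fun T b => ?_)) hUn
  by_contra hW
  set S := (T : Subgroup (Subgroup.normalizer (U : Set G))).map (Subgroup.subtype _) with hS
  have hSc : Nat.card S = q ^ (Nat.card (Subgroup.normalizer (U : Set G))).factorization q := by
    rw [← T.card_eq_multiplicity]
    exact Subgroup.card_map_of_injective (Subgroup.subtype_injective _)
  have hSq : IsPGroup q S := T.2.map _
  have hS1 : S ≠ ⊥ := by
    intro h
    have h1 : q ∣ Nat.card U := by
      obtain ⟨n, hn, hc⟩ := hUq.nontrivial_iff_card.1 ((Subgroup.nontrivial_iff_ne_bot U).2 hU)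
      exact hc ▸ dvd_pow_self q hn.ne'
    have h2 : q ∣ Nat.card (Subgroup.normalizer (U : Set G)) :=
      h1.trans (Subgroup.card_dvd_of_le Subgroup.le_normalizer)
    rw [h, Subgroup.card_bot] at hSc
    have h3 := hq.factorization_pos_of_dvd Nat.card_pos.ne' h2
    exact (Nat.one_lt_pow h3.ne' hq.one_lt).ne hSc
  have hm := hmax ⟨charPart q b S, charPart_ne_bot hq b hS1 hSq,
    hSq.to_le (charPart_le q b S), hW⟩
  obtain ⟨P, hP⟩ := hSq.exists_le_sylow
  rcases hP.eq_or_lt with h | h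
  · rw [h] at hW
    exact hW (hG P b)
  · have h1 := IsPGroup.lt_inf_normalizer hq P.2 h
    set D := (P : Subgroup G) ⊓ Subgroup.normalizer (S : Set G) with hD
    obtain ⟨k, hk⟩ := IsPGroup.iff_card.1 (P.2.to_le (inf_le_left : D ≤ P))
    have h2 : Nat.card D ∣ Nat.card (Subgroup.normalizer (charPart q b S : Set G)) :=
      Subgroup.card_dvd_of_le (inf_le_right.trans (normalizer_le_normalizer_charPart q b S))
    rw [hk, hq.pow_dvd_iff_le_factorization Nat.card_pos.ne'] at h2
    have h3 := Subgroup.card_lt_card_of_lt' h1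
    rw [hk, hSc] at h3
    exact absurd (Nat.pow_le_pow_right hq.pos (h2.trans hm)) (not_le_of_gt h3)

end Thompson

section Quotient
variable {q : ℕ} {G : Type*} [Group G]

theorem Sylow.exists_eq_subgroupOf_comap_mk [Finite G] {L : Subgroup G} [L.Normal]
    (hL : (Nat.card L).Coprime q) {W : Subgroup G} (hW : IsPGroup q W) {B : Subgroup (G ⧸ L)}
    (hB : W.map (QuotientGroup.mk' L) = B) :
    ∃ T : Sylow q (B.comap (QuotientGroup.mk' L)),
      (T : Subgroup _) = W.subgroupOf (B.comap (QuotientGroup.mk' L)) := by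
  have hWB : W ≤ B.comap (QuotientGroup.mk' L) := Subgroup.map_le_iff_le_comap.1 hB.le
  refine ⟨⟨W.subgroupOf _, hW.comap_of_injective _ (Subgroup.subtype_injective _), ?_⟩, rfl⟩
  intro Q hQ hQW
  refine le_antisymm (fun x hx => ?_) hQW
  obtain ⟨w, hw, hwx⟩ : QuotientGroup.mk' L x ∈ W.map (QuotientGroup.mk' L) := hB ▸ x.2
  have hl : w⁻¹ * x ∈ L := QuotientGroup.eq.1 hwx
  have hQ' : (⟨w, hWB hw⟩ : B.comap (QuotientGroup.mk' L))⁻¹ * x ∈ Q :=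
    Q.mul_mem (Q.inv_mem (hQW hw)) hx
  have h1 : w⁻¹ * (x : G) = 1 := by
    refine IsPNilpotent.eq_one_of_mem_of_mem (q := q) (K := L)
      (U := Q.map (Subgroup.subtype _)) (fun g hg => ?_) (hQ.map _) hl ⟨_, hQ', rfl⟩
    exact Nat.Coprime.coprime_dvd_left (Subgroup.orderOf_dvd_natCard L hg) hL
  have h2 : (x : G) = w := by rw [inv_mul_eq_one] at h1; exact h1.symm
  change (x : G) ∈ W
  rwa [h2]

theorem normalizer_map_mk_le [Finite G] (hq : q.Prime) {L : Subgroup G} [L.Normal]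
    (hL : (Nat.card L).Coprime q) {W : Subgroup G} (hW : IsPGroup q W) :
    Subgroup.normalizer (W.map (QuotientGroup.mk' L) : Set (G ⧸ L)) ≤
      (Subgroup.normalizer (W : Set G)).map (QuotientGroup.mk' L) := by
  have := Fact.mk hq
  intro y hy
  obtain ⟨g, rfl⟩ := QuotientGroup.mk'_surjective L y
  have hWg : (W.map (MulAut.conj g : G →* G)).map (QuotientGroup.mk' L) =
      W.map (QuotientGroup.mk' L) := by
    rw [Subgroup.mem_normalizer_iff_map_conj_eq] at hy
    refine Eq.trans ?_ hy
    rw [Subgroup.map_map, Subgroup.map_map]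
    congr 1
  obtain ⟨T, hT⟩ := Sylow.exists_eq_subgroupOf_comap_mk hL hW rfl
  obtain ⟨T', hT'⟩ := Sylow.exists_eq_subgroupOf_comap_mk hL (hW.map (MulAut.conj g : G →* G)) hWg
  obtain ⟨h, hh⟩ := MulAction.exists_smul_eq (Subgroup.comap (QuotientGroup.mk' L)
    (W.map (QuotientGroup.mk' L))) T T'
  obtain ⟨w, hw, hwh⟩ : QuotientGroup.mk' L h ∈ W.map (QuotientGroup.mk' L) := h.2
  have key : (h : G)⁻¹ * g ∈ Subgroup.normalizer (W : Set G) := by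
    rw [Subgroup.mem_normalizer_iff_map_conj_eq]
    refine Subgroup.eq_of_le_of_card_ge ?_ ?_
    · rintro _ ⟨x, hx, rfl⟩
      have h1 : g * x * g⁻¹ ∈ Subgroup.comap (QuotientGroup.mk' L)
          (W.map (QuotientGroup.mk' L)) := by
        rw [Subgroup.mem_comap, ← hWg]
        exact ⟨_, ⟨x, hx, rfl⟩, by simp⟩
      have h2 : (⟨_, h1⟩ : Subgroup.comap (QuotientGroup.mk' L)
          (W.map (QuotientGroup.mk' L))) ∈ (T' : Subgroup _) := by
        rw [hT', Subgroup.mem_subgroupOf]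
        exact ⟨x, hx, by simp⟩
      have h3 := (Sylow.mem_smul_iff (P := T)).1 (by rw [hh]; exact h2)
      have h4 := hT.le h3
      rw [Subgroup.mem_subgroupOf] at h4
      simpa [mul_assoc] using h4
    · rw [Subgroup.card_map_of_injective (MulAut.conj ((h : G)⁻¹ * g)).injective]
  refine ⟨w * ((h : G)⁻¹ * g), Subgroup.mul_mem _ (Subgroup.le_normalizer hw) key, ?_⟩
  rw [map_mul, hwh, map_mul, map_inv, mul_inv_cancel_left]

theorem IsPNilpotent.map [Finite G] {H : Type*} [Group H] (hq : q.Prime) {L : Subgroup G}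
    (h : IsPNilpotent q L) (f : G →* H) : IsPNilpotent q (L.map f) :=
  IsPNilpotent.of_surjective hq (f.subgroupMap L) (f.subgroupMap_surjective L) h

theorem Sylow.exists_map_mk_eq [Finite G] (hq : q.Prime) (L : Subgroup G) [L.Normal]
    (P : Sylow q (G ⧸ L)) : ∃ Q : Sylow q G, (Q : Subgroup G).map (QuotientGroup.mk' L) = P := by
  have := Fact.mk hq
  obtain ⟨Q, hQ⟩ := Sylow.mapSurjective_surjective (QuotientGroup.mk'_surjective L) q P
  exact ⟨Q, by rw [← hQ]; rfl⟩

theorem ThompsonHyp.quotient_of_coprime [Finite G] (hq : q.Prime) (hG : ThompsonHyp q G)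
    (L : Subgroup G) [L.Normal] (hL : (Nat.card L).Coprime q) : ThompsonHyp q (G ⧸ L) := by
  intro P b
  obtain ⟨Q, hQ⟩ := Sylow.exists_map_mk_eq hq L P
  rw [← hQ, ← map_charPart (fun x hx h => ?_)]
  · exact ((hG Q b).map hq _).mono
      (normalizer_map_mk_le hq hL (Q.2.to_le (charPart_le q b _)))
  · refine IsPNilpotent.eq_one_of_mem_of_mem (q := q) (K := L) (U := Q) (fun g hg => ?_) Q.2
      ((QuotientGroup.eq_one_iff x).1 h) hx
    exact Nat.Coprime.coprime_dvd_left (Subgroup.orderOf_dvd_natCard L hg) hL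

end Quotient

section MinimalCounterexample
variable {q : ℕ} {G : Type*} [Group G]

/-- The situation reached in a minimal counterexample to Thompson's criterion; `U` is the
largest normal `q`-subgroup. -/
structure ThompsonMin (q : ℕ) (G : Type*) [Group G] (U : Subgroup G) : Prop where
  prime : q.Prime
  hyp : ThompsonHyp q G
  proper : ∀ H : Subgroup G, H ≠ ⊤ → ∀ P : Sylow q G, (P : Subgroup G) ≤ H → IsPNilpotent q H
  core : ∀ L : Subgroup G, L.Normal → (Nat.card L).Coprime q → L = ⊥
  not_nilpotent : ¬ IsPNilpotent q G
  normal : U.Normal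
  isPGroup : IsPGroup q U
  le : ∀ N : Subgroup G, N.Normal → IsPGroup q N → N ≤ U

theorem IsPGroup.isPNilpotent (h : IsPGroup q G) : IsPNilpotent q G :=
  IsPNilpotent.of_compl (K := ⊥) (by simp) fun g => by simpa using h g

theorem IsPNilpotent.of_top (h : IsPNilpotent q (⊤ : Subgroup G)) : IsPNilpotent q G :=
  IsPNilpotent.of_injective (Subgroup.topEquiv (G := G)).symm.toMonoidHom
    (Subgroup.topEquiv (G := G)).symm.injective h

theorem isPGroup_of_pow_mem {U H : Subgroup G} (hU : IsPGroup q U)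
    (h : ∀ g ∈ H, ∃ k, g ^ q ^ k ∈ U) : IsPGroup q H := by
  rintro ⟨g, hg⟩
  obtain ⟨k, hk⟩ := h g hg
  obtain ⟨j, hj⟩ := hU ⟨_, hk⟩
  refine ⟨k + j, Subtype.ext ?_⟩
  have : (g ^ q ^ k) ^ q ^ j = 1 := congrArg Subtype.val hj
  rw [← pow_mul, ← pow_add] at this
  exact this

namespace ThompsonMin
variable {U : Subgroup G}

theorem le_sylow (h : ThompsonMin q G U) (P : Sylow q G) : U ≤ P := by
  have := h.normal
  have h1 : IsPGroup q ((U ⊔ P : Subgroup G)) := h.isPGroup.to_sup_of_normal_left P.2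
  exact (P.3 h1 le_sup_right) ▸ le_sup_left

theorem normalizer_charPart_ne_top (h : ThompsonMin q G U) (P : Sylow q G) (b : Bool) :
    Subgroup.normalizer (charPart q b (P : Subgroup G) : Set G) ≠ ⊤ := by
  intro ht
  have := h.hyp P b
  rw [ht] at this
  exact h.not_nilpotent this.of_top

theorem le_of_isPNilpotent [Finite G] (h : ThompsonMin q G U) {T : Subgroup G} (hT : T.Normal)
    (hn : IsPNilpotent q T) : T ≤ U := by
  obtain ⟨K, hK, hc, hp, -⟩ := hn.exists_compl h.prime
  have h1 : K.map T.subtype = ⊥ := by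
    refine h.core _ inferInstance ?_
    rwa [Subgroup.card_map_of_injective T.subtype_injective]
  rw [Subgroup.map_eq_bot_iff_of_injective _ T.subtype_injective] at h1
  refine h.le T hT fun g => ?_
  obtain ⟨k, hk⟩ := hp g
  rw [h1, Subgroup.mem_bot] at hk
  exact ⟨k, hk⟩

theorem quotient_hyp [Finite G] (h : ThompsonMin q G U) [U.Normal] : ThompsonHyp q (G ⧸ U) := by
  have := Fact.mk h.prime
  intro P' b
  obtain ⟨P, hP⟩ := Sylow.exists_map_mk_eq h.prime U P'
  set W := charPart q b (P' : Subgroup (G ⧸ U)) with hW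
  have hbot : (P' : Subgroup (G ⧸ U)) ≠ ⊥ := by
    intro hb
    rw [hb, Subgroup.map_eq_bot_iff, QuotientGroup.ker_mk'] at hP
    have hPU : U = P := le_antisymm (h.le_sylow P) hP
    refine h.normalizer_charPart_ne_top P b (top_le_iff.1 ?_)
    rw [← hPU]
    exact (Subgroup.normalizer_eq_top_iff.2 h.normal).ge.trans
      (normalizer_le_normalizer_charPart q b U)
  have hWb : W ≠ ⊥ := charPart_ne_bot h.prime b hbot P'.2
  have hWq : IsPGroup q W := P'.2.to_le (charPart_le q b _)
  set X := W.comap (QuotientGroup.mk' U) with hX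
  have hmapX : X.map (QuotientGroup.mk' U) = W :=
    Subgroup.map_comap_eq_self_of_surjective (QuotientGroup.mk'_surjective U) W
  have hXq : IsPGroup q X := by
    refine isPGroup_of_pow_mem h.isPGroup fun g hg => ?_
    obtain ⟨k, hk⟩ := hWq ⟨_, hg⟩
    refine ⟨k, ?_⟩
    have : (QuotientGroup.mk' U g) ^ q ^ k = 1 := congrArg Subtype.val hk
    rw [← map_pow] at this
    exact (QuotientGroup.eq_one_iff _).1 this
  have hNX : Subgroup.comap (QuotientGroup.mk' U) (Subgroup.normalizer (W : Set (G ⧸ U))) =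
      Subgroup.normalizer (X : Set G) :=
    Subgroup.comap_normalizer_eq_of_surjective W (QuotientGroup.mk'_surjective U)
  have hne : Subgroup.normalizer (X : Set G) ≠ ⊤ := by
    intro ht
    have hle := h.le X (Subgroup.normalizer_eq_top_iff.1 ht) hXq
    apply hWb
    rw [← hmapX, Subgroup.map_eq_bot_iff, QuotientGroup.ker_mk']
    exact hle
  have hPX : (P : Subgroup G) ≤ Subgroup.normalizer (X : Set G) := by
    rw [← hNX, ← Subgroup.map_le_iff_le_comap, hP]
    exact Subgroup.le_normalizer.trans (normalizer_le_normalizer_charPart q b _)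
  have := (h.proper _ hne P hPX).map h.prime (QuotientGroup.mk' U)
  rwa [← hNX, Subgroup.map_comap_eq_self_of_surjective (QuotientGroup.mk'_surjective U)] at this

theorem centralizer_le [Finite G] (h : ThompsonMin q G U) [U.Normal] (hn : IsPNilpotent q (G ⧸ U)) :
    Subgroup.centralizer (U : Set G) ≤ U := by
  have := Fact.mk h.prime
  obtain ⟨K, hK, hc, hp, -⟩ := hn.exists_compl h.prime
  have hKn : K.Normal := inferInstance
  set D := Subgroup.centralizer (U : Set G) ⊓ K.comap (QuotientGroup.mk' U) with hD
  have hDn : D.Normal := inferInstance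
  have hDU : D ≤ U := by
    refine h.le_of_isPNilpotent hDn ?_
    set Z := U.subgroupOf D with hZ
    have hZn : Z.Normal := inferInstance
    have hZq : IsPGroup q Z := h.isPGroup.comap_of_injective _ D.subtype_injective
    have hidx : Z.index.Coprime q := by
      let f : D →* K := ((QuotientGroup.mk' U).comp D.subtype).codRestrict K (fun x => x.2.2)
      have hker : f.ker = Z := by
        ext x
        rw [MonoidHom.mem_ker, hZ, Subgroup.mem_subgroupOf, ← QuotientGroup.eq_one_iff,
          Subtype.ext_iff]
        rfl
      rw [← hker, Subgroup.index_ker]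
      exact Nat.Coprime.coprime_dvd_left (Subgroup.card_subgroup_dvd_card _) hc
    obtain ⟨n, hcard⟩ := IsPGroup.iff_card.1 hZq
    obtain ⟨E, hE⟩ := Subgroup.exists_right_complement'_of_coprime (N := Z)
      (by rw [hcard]; exact (hidx.pow_right n).symm)
    refine IsPNilpotent.of_compl (K := E) ?_ fun g => ?_
    · have h1 := hE.symm.index_eq_card
      rwa [← h1]
    · obtain ⟨⟨z, e⟩, rfl⟩ := hE.2 g
      obtain ⟨k, hk⟩ := hZq z
      refine ⟨k, ?_⟩
      have hcomm : Commute (z : D) (e : D) :=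
        Subtype.ext ((Subgroup.mem_centralizer_iff.1 (e : D).2.1) _ z.2)
      have hk' : (z : D) ^ q ^ k = 1 := congrArg Subtype.val hk
      change ((z : D) * e) ^ q ^ k ∈ E
      rw [hcomm.mul_pow, hk', one_mul]
      exact E.pow_mem e.2 _
  refine h.le _ inferInstance (isPGroup_of_pow_mem h.isPGroup fun g hg => ?_)
  obtain ⟨k, hk⟩ := hp (QuotientGroup.mk' U g)
  exact ⟨k, hDU ⟨Subgroup.pow_mem _ hg _, by
    change QuotientGroup.mk' U (g ^ q ^ k) ∈ K
    rwa [map_pow]⟩⟩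

theorem omegaCenter_normal (h : ThompsonMin q G U) : (omegaCenter q U).Normal := by
  have := normalizer_le_normalizer_charPart q false U
  rw [Subgroup.normalizer_eq_top_iff.2 h.normal, top_le_iff, Subgroup.normalizer_eq_top_iff] at this
  exact this

theorem centralizer_omegaCenter [Finite G] (h : ThompsonMin q G U) [U.Normal]
    (hn : IsPNilpotent q (G ⧸ U)) : Subgroup.centralizer (omegaCenter q U : Set G) = U := by
  refine le_antisymm ?_ fun u hu => ?_
  · obtain ⟨P⟩ : Nonempty (Sylow q G) := inferInstance
    have hV := h.omegaCenter_normal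
    refine h.le_of_isPNilpotent inferInstance ((h.hyp P false).mono ?_)
    have hPV : omegaCenter q (P : Subgroup G) ≤ omegaCenter q U := by
      rintro z ⟨hz, hzq, hzc⟩
      have hzC : z ∈ Subgroup.centralizer (U : Set G) :=
        Subgroup.mem_centralizer_iff.2 fun u hu => (hzc u (h.le_sylow P hu)).symm
      exact ⟨h.centralizer_le hn hzC, hzq, fun s hs => hzc s (h.le_sylow P hs)⟩
    exact (Subgroup.centralizer_le hPV).trans (Subgroup.centralizer_le_normalizer _)
  · exact Subgroup.mem_centralizer_iff.2 fun v hv => hv.2.2 u hu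

end ThompsonMin
end MinimalCounterexample

section
variable {q : ℕ} {G : Type*} [Group G]

open scoped Pointwise in
/-- A `q`-subgroup normalizing a subgroup `K` of order prime to `q` normalizes some Sylow
`r`-subgroup of `K`. -/
theorem exists_sylow_le_normalizer [Finite G] (hq : q.Prime) {r : ℕ} (hr : r.Prime)
    {K P : Subgroup G} (hKn : K.Normal) (hK : (Nat.card K).Coprime q) (hP : IsPGroup q P) :
    ∃ S : Sylow r K, P ≤ Subgroup.normalizer ((S : Subgroup K).map K.subtype : Set G) := by
  have := Fact.mk hq
  have := Fact.mk hr
  let act : MulDistribMulAction P K :=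
    MulDistribMulAction.compHom K ((MulAut.conjNormal (H := K)).comp P.subtype)
  have hdvd : ¬ q ∣ Nat.card (Sylow r K) := by
    intro hd
    obtain ⟨S⟩ : Nonempty (Sylow r K) := inferInstance
    have h1 : q ∣ Nat.card K := hd.trans (S.card_dvd_index.trans (Subgroup.index_dvd_card _))
    exact hq.ne_one (Nat.Coprime.eq_one_of_dvd hK.symm h1)
  obtain ⟨S, hS⟩ := hP.nonempty_fixed_point_of_prime_not_dvd_card (Sylow r K) hdvd
  refine ⟨S, fun g hg => ?_⟩
  rw [Subgroup.mem_normalizer_iff_map_conj_eq]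
  refine Subgroup.eq_of_le_of_card_ge ?_ ?_
  · rintro _ ⟨_, ⟨s, hs, rfl⟩, rfl⟩
    have h1 : (⟨g, hg⟩ : P) • s ∈ (⟨g, hg⟩ : P) • (S : Subgroup K) :=
      Subgroup.smul_mem_pointwise_smul s _ _ hs
    rw [← Sylow.pointwise_smul_def, hS ⟨g, hg⟩] at h1
    exact ⟨_, h1, rfl⟩
  · exact (Subgroup.card_map_of_injective (f := (MulAut.conj g : G →* G))
      (MulAut.conj g).injective).ge
end
namespace ThompsonMin
variable {q : ℕ} {G : Type*} [Group G] {U : Subgroup G}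

theorem eq_bot_or_eq_of_le [Finite G] (h : ThompsonMin q G U) [U.Normal]
    (hn : IsPNilpotent q (G ⧸ U)) (P : Sylow q G) {K X : Subgroup (G ⧸ U)}
    (hK : ∀ g ∈ K, (orderOf g).Coprime q) (hX : X ≤ K)
    (hXP : (P : Subgroup G).map (QuotientGroup.mk' U) ≤ Subgroup.normalizer (X : Set (G ⧸ U))) :
    X = ⊥ ∨ X = K := by
  have := Fact.mk h.prime
  set P' := (P : Subgroup G).map (QuotientGroup.mk' U) with hP'
  have hP'q : IsPGroup q P' := P.2.map _
  by_cases ht : P' ⊔ X = ⊤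
  · refine Or.inr (le_antisymm hX fun k hk => ?_)
    have h1 : k ∈ ((P' ⊔ X : Subgroup (G ⧸ U)) : Set (G ⧸ U)) := by rw [ht]; trivial
    rw [Subgroup.coe_mul_of_left_le_normalizer_right _ _ hXP] at h1
    obtain ⟨p, hp, x, hx, rfl⟩ := h1
    have h2 : p ∈ K := by simpa using K.mul_mem hk (K.inv_mem (hX hx))
    have h3 : p = 1 := IsPNilpotent.eq_one_of_mem_of_mem hK hP'q h2 hp
    simpa [h3] using hx
  · left
    set H := (P' ⊔ X).comap (QuotientGroup.mk' U) with hH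
    have hHt : H ≠ ⊤ := by
      intro h1
      apply ht
      rw [← Subgroup.map_comap_eq_self_of_surjective (QuotientGroup.mk'_surjective U) (P' ⊔ X),
        ← hH, h1, ← MonoidHom.range_eq_map, MonoidHom.range_eq_top]
      exact QuotientGroup.mk'_surjective U
    have hPH : (P : Subgroup G) ≤ H := Subgroup.map_le_iff_le_comap.1 le_sup_left
    have hUH : U ≤ H := (h.le_sylow P).trans hPH
    have hHn := h.proper H hHt P hPH
    obtain ⟨L, -, -, hp, hL⟩ := hHn.exists_compl h.prime
    have hUq : IsPGroup q (U.subgroupOf H) := h.isPGroup.comap_of_injective _ H.subtype_injective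
    have hLb : ∀ l ∈ L, l = 1 := by
      intro l hl
      have h1 : (l : G) ∈ Subgroup.centralizer (U : Set G) := by
        refine Subgroup.mem_centralizer_iff.2 fun u hu => ?_
        exact congrArg Subtype.val (hHn.commute_of_normal h.prime (U := U.subgroupOf H) hUq
          ((hL l).1 hl) (u := ⟨u, hUH hu⟩) hu).symm
      exact IsPNilpotent.eq_one_of_mem_of_mem (fun g hg => (hL g).1 hg) hUq hl
        (h.centralizer_le hn h1)
    refine (Subgroup.eq_bot_iff_forall X).2 fun x hx => ?_
    obtain ⟨g, rfl⟩ := QuotientGroup.mk'_surjective U x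
    obtain ⟨k, hk⟩ := hp ⟨g, (le_sup_right : X ≤ P' ⊔ X) hx⟩
    have h1 : g ^ q ^ k = 1 := congrArg Subtype.val (hLb _ hk)
    have h2 : (QuotientGroup.mk' U g) ^ q ^ k = 1 := by rw [← map_pow, h1, map_one]
    exact orderOf_eq_one_iff.1 (Nat.Coprime.eq_one_of_dvd ((hK _ (hX hx)).pow_right k)
      (orderOf_dvd_of_pow_eq_one h2))

theorem compl_comm [Finite G] (h : ThompsonMin q G U) [U.Normal]
    (hn : IsPNilpotent q (G ⧸ U)) {K : Subgroup (G ⧸ U)} (hKn : K.Normal)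
    (hKc : (Nat.card K).Coprime q) (hp : ∀ g, ∃ k, g ^ q ^ k ∈ K) :
    IsMulCommutative K := by
  have hK : ∀ g ∈ K, (orderOf g).Coprime q := fun g hg =>
    Nat.Coprime.coprime_dvd_left (Subgroup.orderOf_dvd_natCard K hg) hKc
  have hq := h.prime
  have := Fact.mk hq
  obtain ⟨P⟩ : Nonempty (Sylow q G) := inferInstance
  by_cases hKb : K = ⊥
  · refine ⟨⟨fun a b => Subtype.ext ?_⟩⟩
    subst hKb
    rw [Subgroup.coe_mul, Subgroup.coe_mul, Subgroup.mem_bot.1 a.2, Subgroup.mem_bot.1 b.2]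
  have h1 : Nat.card K ≠ 1 := fun h1 => hKb (Subgroup.card_eq_one.1 h1)
  set r := (Nat.card K).minFac with hr
  have hrp : r.Prime := Nat.minFac_prime h1
  have := Fact.mk hrp
  obtain ⟨S, hS⟩ := exists_sylow_le_normalizer hq hrp hKn hKc (P.2.map (QuotientGroup.mk' U))
  have hSb : (S : Subgroup K) ≠ ⊥ := S.ne_bot_of_dvd_card (Nat.minFac_dvd _)
  have hKr : IsPGroup r K := by
    rcases h.eq_bot_or_eq_of_le hn P hK (Subgroup.map_subtype_le _) hS with h2 | h2
    · exact absurd ((Subgroup.map_eq_bot_iff_of_injective _ K.subtype_injective).1 h2) hSb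
    · rw [← h2]
      exact S.2.map _
  have hnt : Nontrivial K := (Subgroup.nontrivial_iff_ne_bot K).2 hKb
  have hcn : ((Subgroup.center K).map K.subtype).Normal := inferInstance
  have hc : (Subgroup.center K).map K.subtype = K := by
    refine (h.eq_bot_or_eq_of_le hn P hK (Subgroup.map_subtype_le _) ?_).resolve_left fun h2 => ?_
    · rw [Subgroup.normalizer_eq_top_iff.2 hcn]
      exact le_top
    · have := (Subgroup.map_eq_bot_iff_of_injective _ K.subtype_injective).1 h2
      exact (Subgroup.nontrivial_iff_ne_bot _).1 hKr.center_nontrivial this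
  refine ⟨⟨fun a b => ?_⟩⟩
  obtain ⟨c, hc1, hc2⟩ : (b : G ⧸ U) ∈ (Subgroup.center K).map K.subtype :=
    hc.ge b.2
  have : c = b := Subtype.ext hc2
  subst this
  exact Subgroup.mem_center_iff.1 hc1 a
end ThompsonMin

theorem Subgroup.card_inf_mul_relIndex {G : Type*} [Group G] (H K : Subgroup G) :
    Nat.card (H ⊓ K : Subgroup G) * H.relIndex K = Nat.card K := by
  have := Subgroup.relIndex_mul_relIndex ⊥ (H ⊓ K) K bot_le inf_le_right
  rwa [relIndex_bot_left, relIndex_bot_left, inf_relIndex_right] at this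

namespace ThompsonMin
variable {q : ℕ} {G : Type*} [Group G] {U : Subgroup G}

theorem exists_isMaxAbelian_not_le [Finite G] (h : ThompsonMin q G U) (P : Sylow q G) :
    ∃ A, IsMaxAbelian (P : Subgroup G) A ∧ ¬ A ≤ U := by
  by_contra! hc
  obtain ⟨A₀, hA₀⟩ := exists_isMaxAbelian (P : Subgroup G)
  have hJ : thompsonSubgroup (P : Subgroup G) = thompsonSubgroup U := by
    refine congrArg sSup (Set.ext fun A => ⟨fun hA => ⟨hc A hA, hA.2.1, fun B hB hBc => ?_⟩,
      fun hA => ⟨hA.1.trans (h.le_sylow P), hA.2.1, fun B hB hBc => ?_⟩⟩)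
    · exact hA.2.2 B (hB.trans (h.le_sylow P)) hBc
    · exact (hA₀.2.2 B hB hBc).trans (hA.2.2 A₀ (hc A₀ hA₀) hA₀.2.1)
  refine h.normalizer_charPart_ne_top P true (top_le_iff.1 ?_)
  change ⊤ ≤ Subgroup.normalizer (thompsonSubgroup (P : Subgroup G) : Set G)
  rw [hJ, ← Subgroup.normalizer_eq_top_iff.2 h.normal]
  exact normalizer_le_normalizer_charPart q true U

theorem card_omegaCenter_le [Finite G] (h : ThompsonMin q G U) [U.Normal] {P : Sylow q G}
    {A : Subgroup G} (hA : IsMaxAbelian (P : Subgroup G) A) :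
    Nat.card (omegaCenter q U) ≤
      Nat.card (A.map (QuotientGroup.mk' U)) * Nat.card (omegaCenter q U ⊓ A : Subgroup G) := by
  have hV := h.omegaCenter_normal
  set V := omegaCenter q U with hVdef
  have hVU : V ≤ U := omegaCenter_le q U
  have hle : Nat.card (U ⊓ A ⊔ V : Subgroup G) ≤ Nat.card A := by
    refine hA.2.2 _ ((sup_le inf_le_left hVU).trans (h.le_sylow P)) ?_
    intro x hx y hy
    obtain ⟨a, ha, v, hv, rfl⟩ := Subgroup.mem_sup_of_normal_right.1 hx
    obtain ⟨b, hb, w, hw, rfl⟩ := Subgroup.mem_sup_of_normal_right.1 hy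
    have h1 : a * b = b * a := hA.2.1 a ha.2 b hb.2
    have h2 : v * b = b * v := hv.2.2 b hb.1
    have h3 : w * a = a * w := hw.2.2 a ha.1
    have h4 : v * w = w * v := hv.2.2 w (hVU hw)
    calc a * v * (b * w) = a * (v * b) * w := by group
      _ = a * b * (v * w) := by rw [h2]; group
      _ = b * (a * w) * v := by rw [h1, h4]; group
      _ = b * w * (a * v) := by rw [← h3]; group
  have e1 := Subgroup.card_inf_mul_relIndex V (U ⊓ A ⊔ V)
  rw [Subgroup.relIndex_sup_right, inf_eq_left.2 le_sup_right] at e1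
  have e2 := Subgroup.card_inf_mul_relIndex V (U ⊓ A)
  rw [← inf_assoc, inf_eq_left.2 hVU] at e2
  have e3 := Subgroup.card_inf_mul_relIndex U A
  have e4 := Subgroup.relIndex_ker A (QuotientGroup.mk' U)
  rw [QuotientGroup.ker_mk'] at e4
  rw [e4, ← e2] at e3
  rw [← e1, ← e3] at hle
  have hpos : 0 < V.relIndex (U ⊓ A) :=
    Nat.pos_of_ne_zero Subgroup.index_ne_zero_of_finite
  refine Nat.le_of_mul_le_mul_right (hle.trans (le_of_eq ?_)) hpos
  ring

open scoped IsMulCommutative in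
theorem contradiction [Finite G] (h : ThompsonMin q G U) [U.Normal] (hq3 : 3 ≤ q)
    (hn : IsPNilpotent q (G ⧸ U)) : False := by
  have hq := h.prime
  have := Fact.mk hq
  obtain ⟨K, hKch, hKc, hp, hK⟩ := hn.exists_compl hq
  have hKn : K.Normal := inferInstance
  have hKcomm := h.compl_comm hn hKn hKc hp
  obtain ⟨P⟩ : Nonempty (Sylow q G) := inferInstance
  obtain ⟨A, hA, hAU⟩ := h.exists_isMaxAbelian_not_le P
  have hV := h.omegaCenter_normal
  have hcard := h.card_omegaCenter_le hA
  have hCV := h.centralizer_omegaCenter hn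
  set V := omegaCenter q U with hVdef
  set A' := A.map (QuotientGroup.mk' U) with hA'
  have hVcomm : IsMulCommutative V :=
    ⟨⟨fun a b => Subtype.ext (a.2.2.2 b (omegaCenter_le q U b.2))⟩⟩
  have hAcomm : IsMulCommutative A' := by
    refine ⟨⟨?_⟩⟩
    rintro ⟨_, a, ha, rfl⟩ ⟨_, b, hb, rfl⟩
    refine Subtype.ext ?_
    change QuotientGroup.mk' U a * QuotientGroup.mk' U b = _
    rw [← map_mul, hA.2.1 a ha b hb, map_mul]
    rfl
  have hker : ∀ g : G, (∀ v ∈ V, g * v * g⁻¹ = v) → g ∈ U := by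
    intro g hg
    rw [← hCV]
    exact Subgroup.mem_centralizer_iff.2 fun v hv => by
      conv_lhs => rw [← hg v hv]
      group
  let Θ : G ⧸ U →* MulAut V := QuotientGroup.lift U (MulAut.conjNormal (H := V)) (by
    intro u hu
    refine MulEquiv.ext fun v => Subtype.ext ?_
    rw [MulAut.conjNormal_apply]
    change u * v * u⁻¹ = v
    rw [← v.2.2.2 u hu, mul_inv_cancel_right])
  have hΘ : ∀ (g : G) (v : V), (Θ (QuotientGroup.mk' U g) v : G) = g * v * g⁻¹ := fun g v => rfl
  have hΘinj : Function.Injective Θ := by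
    rw [injective_iff_map_eq_one]
    intro x hx
    obtain ⟨g, rfl⟩ := QuotientGroup.mk'_surjective U x
    refine (QuotientGroup.eq_one_iff g).2 (hker g fun v hv => ?_)
    rw [← hΘ g ⟨v, hv⟩, hx]
    rfl
  have hφ : ∀ a ∈ A', (∀ k ∈ K, a * k * a⁻¹ = k) → a = 1 := by
    intro a ha hak
    let P' := P.mapSurjective (QuotientGroup.mk'_surjective U)
    let T := Subgroup.centralizer (K : Set (G ⧸ U)) ⊓ P'
    have hTn : T.Normal := by
      refine ⟨fun t ht g => ?_⟩
      obtain ⟨k, s, hk, hs, rfl⟩ := hn.exists_mul_of_sylow hq P' g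
      have hs1 : s * t * s⁻¹ ∈ Subgroup.centralizer (K : Set (G ⧸ U)) :=
        Subgroup.Normal.conj_mem inferInstance t ht.1 s
      have hs2 := Subgroup.mem_centralizer_iff.1 hs1 k ((hK k).2 hk)
      have e : k * s * t * (k * s)⁻¹ = s * t * s⁻¹ := by
        rw [mul_inv_rev, ← mul_assoc, mul_inv_eq_iff_eq_mul, ← hs2]
        group
      rw [e]
      exact ⟨hs1, P'.mul_mem (P'.mul_mem hs ht.2) (P'.inv_mem hs)⟩
    have hTq : IsPGroup q (T.comap (QuotientGroup.mk' U)) :=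
      (P'.2.to_le inf_le_right).comap_of_ker_isPGroup _ (by
        rw [QuotientGroup.ker_mk']
        exact h.isPGroup)
    have hTU := h.le _ inferInstance hTq
    obtain ⟨x, hx, rfl⟩ := ha
    refine (QuotientGroup.eq_one_iff x).2 (hTU ⟨?_, x, hA.1 hx, rfl⟩)
    refine Subgroup.mem_centralizer_iff.2 fun k hk => ?_
    exact (mul_inv_eq_iff_eq_mul.1 (hak k hk)).symm
  have hnt : Nontrivial A' := by
    rw [Subgroup.nontrivial_iff_ne_bot, Ne, Subgroup.map_eq_bot_iff, QuotientGroup.ker_mk']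
    exact hAU
  have key := MulAut.card_mul_card_fixed_lt (V := V) (R := K) (A := A') hq hq3
    (fun v => Subtype.ext v.2.2.1) hKc (Θ.comp K.subtype)
    (hΘinj.comp K.subtype_injective) (Θ.comp A'.subtype)
    ((MulAut.conjNormal (H := K)).comp A'.subtype)
    (by
      rw [injective_iff_map_eq_one]
      intro a ha
      refine Subtype.ext (hφ a a.2 fun k hk => ?_)
      exact congrArg Subtype.val (DFunLike.congr_fun ha ⟨k, hk⟩))
    (by
      intro a r
      simp only [MonoidHom.comp_apply, Subgroup.subtype_apply, MulAut.conjNormal_apply]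
      rw [← map_mul, ← map_mul, inv_mul_cancel_right])
    hnt
  refine absurd (hcard.trans (Nat.mul_le_mul_left _ ?_)) (not_le_of_gt key)
  refine Nat.card_le_card_of_injective (fun v : (V ⊓ A : Subgroup G) => ⟨⟨v, v.2.1⟩, ?_⟩) ?_
  · rintro ⟨_, a, ha, rfl⟩
    refine Subtype.ext ?_
    change (Θ (QuotientGroup.mk' U a) _ : G) = v
    rw [hΘ, hA.2.1 a ha v v.2.2, mul_inv_cancel_right]
  · intro v w hvw
    exact Subtype.ext (congrArg (fun x => ((x.1 : V) : G)) hvw)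

end ThompsonMin

/-- **Thompson's normal `q`-complement theorem** (for odd `q`). -/
theorem ThompsonHyp.isPNilpotent {q : ℕ} {G : Type*} [Group G] [Finite G] (hq : q.Prime)
    (hq3 : 3 ≤ q) (hG : ThompsonHyp q G) : IsPNilpotent q G := by
  have := Fact.mk hq
  induction hm : Nat.card G using Nat.strong_induction_on generalizing G with
  | _ m ih =>
  subst hm
  by_contra hn
  have ihs : ∀ H : Subgroup G, H ≠ ⊤ → ThompsonHyp q H → IsPNilpotent q H := fun H hH hHyp =>
    ih _ (lt_of_le_of_ne (Subgroup.card_le_card_group H)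
      fun hc => hH (Subgroup.card_eq_iff_eq_top H |>.1 hc)) hHyp rfl
  have ihq : ∀ L : Subgroup G, [L.Normal] → L ≠ ⊥ → ThompsonHyp q (G ⧸ L) →
      IsPNilpotent q (G ⧸ L) := by
    intro L _ hL hHyp
    refine ih _ ?_ hHyp rfl
    rw [L.card_eq_card_quotient_mul_card_subgroup]
    exact lt_mul_of_one_lt_right Nat.card_pos (L.one_lt_card_iff_ne_bot.2 hL)
  obtain ⟨N, hNn, hNb, hNq⟩ := hG.exists_normal hq ihs hn
  let X := {U : Subgroup G // U.Normal ∧ IsPGroup q U}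
  have : Nonempty X := ⟨N, hNn, hNq⟩
  obtain ⟨⟨U, hUn, hUq⟩, hmax⟩ := Finite.exists_max (fun U : X => Nat.card U.1)
  have hle : ∀ N : Subgroup G, N.Normal → IsPGroup q N → N ≤ U := by
    intro N hN hNq
    have h1 := hmax ⟨U ⊔ N, inferInstance, hUq.to_sup_of_normal_left hNq⟩
    have h2 : U = U ⊔ N := Subgroup.eq_of_le_of_card_ge le_sup_left h1
    rw [h2]
    exact le_sup_right
  have hmin : ThompsonMin q G U :=
    { prime := hq
      hyp := hG
      proper := fun H hH P hP => ihs H hH (hG.of_sylow_le hq hP)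
      core := by
        intro L hL hLc
        by_contra hLb
        exact hn (IsPNilpotent.of_quotient hLc (ihq L hLb (hG.quotient_of_coprime hq L hLc)))
      not_nilpotent := hn
      normal := hUn
      isPGroup := hUq
      le := hle }
  refine hmin.contradiction hq3 (ihq U (fun hU => hNb ?_) hmin.quotient_hyp)
  exact le_bot_iff.1 (hU ▸ hle N hNn hNq)

/-- `f` is a fixed-point-free endomorphism whose `p`-th iterate is the identity. -/
structure IsFPF {M : Type*} [Group M] (p : ℕ) (f : M →* M) : Prop where
  iterate : ∀ x, f^[p] x = x
  fixed : ∀ x, f x = x → x = 1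

theorem card_fixed_modEq {X : Type*} [Finite X] {p : ℕ} (hp : p.Prime) {g : X → X}
    (hg : ∀ x, g^[p] x = x) : Nat.card X ≡ Nat.card {x // g x = x} [MOD p] := by
  classical
  have := Fact.mk hp
  have := Fintype.ofFinite X
  have h := Equiv.Perm.card_fixedPoints_modEq (f := (g : Function.End X)) (p := p) (n := 1) (by
    rw [pow_one]
    let e : Function.End X := g
    have hpow : ∀ n, e ^ n = (show Function.End X from g^[n]) := fun n => by
      induction n with
      | zero => rfl
      | succ n ih => rw [pow_succ, ih]; rfl
    exact (hpow p).trans (funext hg))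
  rw [Nat.card_eq_fintype_card, Nat.card_eq_fintype_card]
  exact h

theorem exists_fixed_of_not_dvd {X : Type*} [Finite X] {p : ℕ} (hp : p.Prime) {g : X → X}
    (hg : ∀ x, g^[p] x = x) (hX : ¬ p ∣ Nat.card X) : ∃ x, g x = x := by
  by_contra! hc
  have : IsEmpty {x // g x = x} := ⟨fun x => hc x.1 x.2⟩
  have h := card_fixed_modEq hp hg
  rw [Nat.card_of_isEmpty (α := {x // g x = x})] at h
  exact hX ((Nat.modEq_zero_iff_dvd).1 h)

namespace IsFPF
variable {M : Type*} [Group M] {p : ℕ} {f : M →* M}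

theorem injective (hp : p.Prime) (h : IsFPF p f) : Function.Injective f := by
  rw [injective_iff_map_eq_one]
  intro x hx
  refine h.fixed x ?_
  have h1 : ∀ n, f^[n] 1 = 1 := fun n => by
    induction n with
    | zero => rfl
    | succ n ih => rw [Function.iterate_succ_apply, map_one, ih]
  have h2 := h.iterate x
  obtain ⟨n, rfl⟩ : ∃ n, p = n + 1 := ⟨p - 1, by have := hp.pos; omega⟩
  rw [Function.iterate_succ_apply, hx, h1] at h2
  rw [← h2, map_one]

theorem card_coprime [Finite M] (hp : p.Prime) (h : IsFPF p f) : (Nat.card M).Coprime p := by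
  have h1 := card_fixed_modEq hp h.iterate
  have : Unique {x // f x = x} :=
    ⟨⟨⟨1, map_one f⟩⟩, fun x => Subtype.ext (h.fixed x.1 x.2)⟩
  rw [Nat.card_unique (α := {x // f x = x})] at h1
  rw [Nat.coprime_comm, hp.coprime_iff_not_dvd]
  intro hd
  have h2 := ((Nat.modEq_zero_iff_dvd).2 hd).symm.trans h1
  exact hp.one_lt.ne' (Nat.dvd_one.1 ((Nat.modEq_zero_iff_dvd).1 h2.symm))

theorem restrict (h : IsFPF p f) {H : Subgroup M} (hH : ∀ x ∈ H, f x ∈ H) :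
    IsFPF p ((f.comp H.subtype).codRestrict H fun x => hH x x.2) := by
  set g := (f.comp H.subtype).codRestrict H fun x => hH x x.2 with hg
  have h1 : ∀ n (x : H), ((g^[n] x : H) : M) = f^[n] x := fun n => by
    induction n with
    | zero => exact fun x => rfl
    | succ n ih =>
      intro x
      rw [Function.iterate_succ_apply, Function.iterate_succ_apply, ih]
      rfl
  exact ⟨fun x => Subtype.ext ((h1 p x).trans (h.iterate x)),
    fun x hx => Subtype.ext (h.fixed x (congrArg Subtype.val hx))⟩

theorem quotient [Finite M] (hp : p.Prime) (h : IsFPF p f) {N : Subgroup M} [N.Normal]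
    (hN : N ≤ N.comap f) : IsFPF p (QuotientGroup.map N N f hN) := by
  set g := QuotientGroup.map N N f hN with hg
  have hmk : ∀ x : M, g (x : M ⧸ N) = (f x : M ⧸ N) := fun x => rfl
  have h1 : ∀ n (x : M), g^[n] (x : M ⧸ N) = (f^[n] x : M) := fun n => by
    induction n with
    | zero => exact fun x => rfl
    | succ n ih =>
      intro x
      rw [Function.iterate_succ_apply, Function.iterate_succ_apply, hmk, ih]
  refine ⟨fun x => ?_, fun x hx => ?_⟩
  · obtain ⟨x, rfl⟩ := QuotientGroup.mk_surjective x
    rw [h1, h.iterate]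
  · let Y := {y : M // (y : M ⧸ N) = x}
    let k : Y → Y := fun y => ⟨f y, by rw [← hmk, y.2, hx]⟩
    have hk : ∀ n (y : Y), ((k^[n] y : Y) : M) = f^[n] y := fun n => by
      induction n with
      | zero => exact fun x => rfl
      | succ n ih =>
        intro x
        rw [Function.iterate_succ_apply, Function.iterate_succ_apply, ih]
    have hY : Nat.card Y = Nat.card N := by
      have := QuotientGroup.card_preimage_mk N {x}
      rw [Nat.card_unique (α := ({x} : Set (M ⧸ N))), mul_one] at this
      exact this
    obtain ⟨y, hy⟩ := exists_fixed_of_not_dvd hp (g := k)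
      (fun y => Subtype.ext ((hk p y).trans (h.iterate y))) (by
        rw [hY, ← hp.coprime_iff_not_dvd, Nat.coprime_comm]
        exact Nat.Coprime.coprime_dvd_left (Subgroup.card_subgroup_dvd_card N) (h.card_coprime hp))
    have := h.fixed y (congrArg Subtype.val hy)
    rw [← y.2, this]
    rfl

theorem exists_sylow [Finite M] (hp : p.Prime) (h : IsFPF p f) {q : ℕ} (hq : q.Prime) :
    ∃ S : Sylow q M, (S : Subgroup M).map f = S := by
  have := Fact.mk hq
  have hs : Function.Surjective f := Finite.surjective_of_injective (h.injective hp)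
  have h1 : ∀ n (S : Sylow q M), ((Sylow.mapSurjective hs)^[n] S : Set M) =
      f^[n] '' (S : Set M) := fun n => by
    induction n with
    | zero => intro S; simp
    | succ n ih =>
      intro S
      rw [Function.iterate_succ_apply, ih, Function.iterate_succ, Set.image_comp]
      rfl
  obtain ⟨S, hS⟩ := exists_fixed_of_not_dvd hp (g := Sylow.mapSurjective (p := q) hs)
    (fun S => by
      refine SetLike.coe_injective ?_
      rw [h1, show f^[p] = id from funext h.iterate, Set.image_id]) (by
      obtain ⟨S⟩ : Nonempty (Sylow q M) := inferInstance
      rw [← hp.coprime_iff_not_dvd, Nat.coprime_comm]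
      exact Nat.Coprime.coprime_dvd_left (S.card_dvd_index.trans (Subgroup.index_dvd_card _))
        (h.card_coprime hp))
  exact ⟨S, congrArg (fun T : Sylow q M => (T : Subgroup M)) hS⟩

theorem iterate_fixed (hp : p.Prime) (h : IsFPF p f) {i : ℕ} (hi : 0 < i) (hip : i < p) {x : M}
    (hx : f^[i] x = x) : x = 1 := by
  have h1 : Function.IsPeriodicPt f (i.gcd p) x :=
    Function.IsPeriodicPt.gcd hx (h.iterate x)
  rw [(Nat.coprime_of_lt_prime hi.ne' hip hp).symm.gcd_eq_one] at h1
  exact h.fixed x h1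

/-- If compatible fixed-point-free maps of the same prime order act on `S` and on the abelian
group `V` of coprime order, then `S` acts trivially on `V`. -/
theorem action_trivial {S V : Type*} [Group S] [Finite S] [CommGroup V] (hp : p.Prime)
    {f : S →* S} {k : V →* V} (hf : IsFPF p f) (hk : IsFPF p k) (α : S →* MulAut V)
    (hα : ∀ s v, k (α s v) = α (f s) (k v)) (hc : (Nat.card V).Coprime (Nat.card S)) (s : S)
    (v : V) : α s v = v := by
  have := Fintype.ofFinite S
  have hkp : ∀ v, ∏ i ∈ Finset.range p, k^[i] v = 1 := by
    intro v
    refine hk.fixed _ ?_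
    rw [map_prod]
    have h1 := Finset.prod_range_succ (fun i => k^[i] v) p
    rw [Finset.prod_range_succ', hk.iterate] at h1
    simp only [Function.iterate_zero, id] at h1
    have h2 := mul_right_cancel h1
    rw [← h2]
    simp only [Function.iterate_succ_apply']
  have hαi : ∀ i s v, k^[i] (α s v) = α (f^[i] s) (k^[i] v) := fun i => by
    induction i with
    | zero => exact fun _ _ => rfl
    | succ i ih => intro s v; rw [Function.iterate_succ_apply, hα, ih]; rfl
  have hu : ∀ u : S, ∏ i ∈ Finset.range p, α (u * f^[i] u⁻¹) (k^[i] v) = 1 := by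
    intro u
    have := congrArg (α u) (hkp (α u⁻¹ v))
    rw [map_one, map_prod] at this
    rw [← this]
    refine Finset.prod_congr rfl fun i _ => ?_
    rw [hαi, map_mul, MulAut.mul_apply]
  have hprod : ∏ i ∈ Finset.range p, ∏ u : S, α (u * f^[i] u⁻¹) (k^[i] v) = 1 := by
    rw [Finset.prod_comm]
    exact Finset.prod_eq_one fun u _ => hu u
  obtain ⟨m, rfl⟩ : ∃ m, p = m + 1 := ⟨p - 1, by have := hp.pos; omega⟩
  rw [Finset.prod_range_succ'] at hprod
  have hbij : ∀ i ∈ Finset.range m, ∏ u : S, α (u * f^[i + 1] u⁻¹) (k^[i + 1] v) =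
      ∏ u : S, α u (k^[i + 1] v) := by
    intro i hi
    refine Fintype.prod_bijective (fun u => u * f^[i + 1] u⁻¹)
      (Finite.injective_iff_bijective.1 fun a b hab => ?_) _ _ fun u => rfl
    have h1 : f^[i + 1] (b⁻¹ * a) = b⁻¹ * a := by
      simp only [iterate_map_inv, iterate_map_mul] at hab ⊢
      have h2 : b⁻¹ * a = b⁻¹ * (a * (f^[i + 1] a)⁻¹) * f^[i + 1] a := by group
      rw [h2, hab]
      group
    exact (inv_mul_eq_one.1 (hf.iterate_fixed hp (Nat.succ_pos i)
      (Nat.succ_lt_succ (Finset.mem_range.1 hi)) h1)).symm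
  rw [Finset.prod_congr rfl hbij] at hprod
  simp only [Function.iterate_zero, id, mul_inv_cancel, map_one, MulAut.one_apply,
    Finset.prod_const, Finset.card_univ] at hprod
  have hfix : α s (v ^ Fintype.card S) = v ^ Fintype.card S := by
    rw [eq_inv_of_mul_eq_one_right hprod, map_inv, map_prod]
    congr 1
    refine Finset.prod_congr rfl fun i _ => ?_
    rw [map_prod]
    refine Fintype.prod_bijective (fun u => s * u) (Group.mulLeft_bijective s) _ _ fun u => ?_
    rw [map_mul, MulAut.mul_apply]
  rw [map_pow, ← Nat.card_eq_fintype_card] at hfix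
  exact (powCoprime hc).injective hfix

end IsFPF

theorem IsPNilpotent.of_isNilpotent {M : Type*} [Group M] [Finite M] {q : ℕ} (hq : q.Prime)
    (h : Group.IsNilpotent M) : IsPNilpotent q M := by
  have := Fact.mk hq
  obtain ⟨e⟩ := ((Group.isNilpotent_of_finite_tfae (G := M)).out 0 4).mp h
  have : Finite (∀ p : (Nat.card M).primeFactors, ∀ P : Sylow p M, P) :=
      Finite.of_equiv _ e.symm.toEquiv
  refine IsPNilpotent.of_surjective hq e.toMonoidHom e.surjective ?_
  let K : Subgroup (∀ p : (Nat.card M).primeFactors, ∀ P : Sylow p M, P) :=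
    { carrier := {x | ∀ (p : (Nat.card M).primeFactors) (P : Sylow p M), (p : ℕ) = q → x p P = 1}
      one_mem' := fun _ _ _ => rfl
      mul_mem' := fun {a b} ha hb p P hp => by
        rw [Pi.mul_apply, Pi.mul_apply, ha p P hp, hb p P hp, mul_one]
      inv_mem' := fun {a} ha p P hp => by
        rw [Pi.inv_apply, Pi.inv_apply, ha p P hp, inv_one] }
  refine IsPNilpotent.of_compl (K := K) ?_ fun x => ?_
  · rw [Nat.coprime_comm, hq.coprime_iff_not_dvd]
    intro hd
    obtain ⟨x, hx⟩ := exists_prime_orderOf_dvd_card' q hd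
    have hxq : (x : ∀ p : (Nat.card M).primeFactors, ∀ P : Sylow p M, P) ^ q = 1 := by
      rw [← hx, ← SubgroupClass.coe_pow, pow_orderOf_eq_one]; rfl
    have : x = 1 := by
      refine Subtype.ext (funext fun p => funext fun P => ?_)
      by_cases hp : (p : ℕ) = q
      · exact x.2 p P hp
      · have hpp := Nat.prime_of_mem_primeFactors p.2
        obtain ⟨k, hk⟩ := P.2 (x.1 p P)
        have h1 : (x.1 p P) ^ q = 1 := congrFun (congrFun hxq p) P
        exact orderOf_eq_one_iff.1 (Nat.eq_one_of_dvd_coprimes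
          (((Nat.coprime_primes hpp hq).2 hp).pow_left k)
          (orderOf_dvd_of_pow_eq_one hk) (orderOf_dvd_of_pow_eq_one h1))
    rw [this, orderOf_one] at hx
    exact hq.one_lt.ne hx
  · refine ⟨(Nat.card M).factorization q, ?_⟩
    rintro ⟨p, hp'⟩ P hp
    obtain rfl : p = q := hp
    rw [Pi.pow_apply, Pi.pow_apply, ← P.card_eq_multiplicity]
    exact pow_card_eq_one'

namespace IsFPF
variable {M : Type*} [Group M] {p : ℕ} {f : M →* M}

theorem map_eq_of_le [Finite M] (hp : p.Prime) (h : IsFPF p f) {H : Subgroup M}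
    (hH : ∀ x ∈ H, f x ∈ H) : H.map f = H := by
  refine Subgroup.eq_of_le_of_card_ge (Subgroup.map_le_iff_le_comap.2 hH) ?_
  rw [Subgroup.card_map_of_injective (h.injective hp)]

/-- Nilpotent invariant normal subgroup under induction assumptions. -/
theorem exists_normal_nilpotent [Finite M] (hp : p.Prime) (h : IsFPF p f) (hM : Nontrivial M)
    (ih : ∀ H : Subgroup M, H ≠ ⊤ → (∀ x ∈ H, f x ∈ H) → Group.IsNilpotent H) :
    Group.IsNilpotent M ∨ ∃ N : Subgroup M, N.Normal ∧ N ≠ ⊥ ∧ (∀ x ∈ N, f x ∈ N) ∧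
      Group.IsNilpotent N := by
  by_cases h2 : ∃ q, q.Prime ∧ 3 ≤ q ∧ q ∣ Nat.card M
  · obtain ⟨q, hq, hq3, hqM⟩ := h2
    have := Fact.mk hq
    obtain ⟨Q, hQ⟩ := h.exists_sylow hp hq
    have hQb : (Q : Subgroup M) ≠ ⊥ := Q.ne_bot_of_dvd_card hqM
    have hinv : ∀ b, (charPart q b (Q : Subgroup M)).map f = charPart q b Q := fun b => by
      rw [map_charPart_of_injective (h.injective hp), hQ]
    by_cases hb : ∃ b, (charPart q b (Q : Subgroup M)).Normal
    · obtain ⟨b, hb⟩ := hb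
      have hpg : IsPGroup q (charPart q b (Q : Subgroup M)) := Q.2.to_le (charPart_le q b _)
      refine Or.inr ⟨_, hb, charPart_ne_bot hq b hQb Q.2, fun x hx => ?_,
        hpg.isNilpotent⟩
      have hx' := Subgroup.mem_map_of_mem f hx
      rwa [hinv b] at hx'
    · push Not at hb
      have hT : ThompsonHyp q M := by
        intro P b
        obtain ⟨g, rfl⟩ := MulAction.exists_smul_eq M Q P
        have h1 : IsPNilpotent q (Subgroup.normalizer (charPart q b (Q : Subgroup M) : Set M)) := by
          refine IsPNilpotent.of_isNilpotent hq (ih _ (fun ht => hb b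
            (Subgroup.normalizer_eq_top_iff.1 ht)) fun x hx => ?_)
          have := Subgroup.le_normalizer_map f (H := charPart q b (Q : Subgroup M)) ⟨x, hx, rfl⟩
          rwa [hinv b] at this
        refine IsPNilpotent.of_map_le (f := (MulAut.conj g⁻¹).toMonoidHom)
          (MulAut.conj g⁻¹).injective ?_ h1
        refine (Subgroup.le_normalizer_map _).trans ?_
        rw [map_charPart_of_injective (MulAut.conj g⁻¹).injective]
        have : ((g • Q : Sylow q M) : Subgroup M).map (MulAut.conj g⁻¹).toMonoidHom = Q := by
          ext x
          constructor
          · rintro ⟨y, hy, rfl⟩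
            have := Sylow.mem_smul_iff.1 hy
            change g⁻¹ * y * g⁻¹⁻¹ ∈ Q
            rwa [inv_inv]
          · intro hx
            refine ⟨g * x * g⁻¹,
                Sylow.mem_smul_iff.2 (by simpa [mul_assoc] using (show x ∈ Q from hx)), ?_⟩
            simp [mul_assoc]
        rw [this]
      have hn := hT.isPNilpotent hq hq3
      obtain ⟨K, hKc, hK, hKp, hKm⟩ := hn.exists_compl hq
      by_cases hKb : K = ⊥
      · left
        have : IsPGroup q M := fun g => by
          obtain ⟨k, hk⟩ := hKp g
          rw [hKb, Subgroup.mem_bot] at hk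
          exact ⟨k, hk⟩
        exact this.isNilpotent
      · have hf : ∀ x ∈ K, f x ∈ K := fun x hx =>
          (hKm _).2 (by rw [orderOf_injective f (h.injective hp)]; exact (hKm x).1 hx)
        refine Or.inr ⟨K, inferInstance, hKb, hf, ih K (fun ht => ?_) hf⟩
        rw [ht, Subgroup.card_top] at hK
        exact hq.one_lt.ne' (Nat.eq_one_of_dvd_coprimes hK hqM dvd_rfl)
  · left
    push Not at h2
    have := Fact.mk Nat.prime_two
    have : IsPGroup 2 M := by
      refine IsPGroup.iff_card.2 ⟨(Nat.card M).primeFactorsList.length, ?_⟩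
      refine Nat.eq_prime_pow_of_unique_prime_dvd Nat.card_pos.ne' fun {d} hd hdM => ?_
      by_contra hne
      have := hd.two_le
      exact h2 d hd (by omega) hdM
    exact this.isNilpotent

theorem exists_mem_center [Finite M] (hp : p.Prime) (h : IsFPF p f) {N : Subgroup M} [N.Normal]
    (hN : N ≠ ⊥) (hf : ∀ x ∈ N, f x ∈ N) (hnil : Group.IsNilpotent N) :
    Subgroup.center M ≠ ⊥ := by
  have hNn : Nontrivial N := (Subgroup.nontrivial_iff_ne_bot N).2 hN
  have hZ : Nontrivial (Subgroup.center N) :=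
    (Subgroup.nontrivial_iff_ne_bot _).2 (Group.IsNilpotent.center_ne_bot N)
  obtain ⟨q, hq, hqd⟩ := Nat.exists_prime_and_dvd
    (Finite.one_lt_card_iff_nontrivial.2 hZ).ne'
  have := Fact.mk hq
  obtain ⟨z, hz⟩ := exists_prime_orderOf_dvd_card' q hqd
  set V := omegaCenter q N with hV
  have hzV : ((z : N) : M) ∈ V := by
    refine ⟨z.1.2, ?_, fun s hs => ?_⟩
    · have h1 := pow_orderOf_eq_one z
      rw [hz] at h1
      exact congrArg (fun y : Subgroup.center N => ((y : N) : M)) h1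
    · exact congrArg Subtype.val (Subgroup.mem_center_iff.1 z.2 ⟨s, hs⟩).symm
  have hz1 : ((z : N) : M) ≠ 1 := fun h1 => by
    have : z = 1 := Subtype.ext (Subtype.ext h1)
    rw [this, orderOf_one] at hz
    exact hq.one_lt.ne hz
  have hmap : ∀ g : M →* M, Function.Injective g → N.map g = N → V.map g = V := fun g hg hgN => by
    rw [hV, map_omegaCenter (fun x _ hx => hg (hx.trans (map_one g).symm)), hgN]
  have hVf : ∀ x ∈ V, f x ∈ V := fun x hx => by
    have := hmap f (h.injective hp) (h.map_eq_of_le hp hf)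
    rw [← this]
    exact ⟨x, hx, rfl⟩
  have hVn : V.Normal := ⟨fun x hx g => by
    have := hmap (MulAut.conj g).toMonoidHom (MulAut.conj g).injective
      (Subgroup.Normal.map_conj_eq N g)
    rw [← this]
    exact ⟨x, hx, rfl⟩⟩
  have hVq : IsPGroup q V := fun x => ⟨1, Subtype.ext (by rw [pow_one]; exact x.2.2.1)⟩
  let _ : CommGroup V := { (inferInstance : Group V) with
    mul_comm := fun a b => Subtype.ext (a.2.2.2 b b.2.1) }
  have hcent : ∀ r, r.Prime → r ≠ q → ∃ R : Sylow r M, ∀ s ∈ R, ∀ v ∈ V, s * v * s⁻¹ = v := by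
    intro r hr hrq
    have := Fact.mk hr
    obtain ⟨R, hR⟩ := h.exists_sylow hp hr
    have hRf : ∀ x ∈ (R : Subgroup M), f x ∈ (R : Subgroup M) := fun x hx => by
      rw [← hR]; exact ⟨x, hx, rfl⟩
    refine ⟨R, fun s hs v hv => ?_⟩
    have hc : (Nat.card V).Coprime (Nat.card (R : Subgroup M)) := by
      obtain ⟨a, ha⟩ := IsPGroup.iff_card.1 hVq
      obtain ⟨b, hb⟩ := IsPGroup.iff_card.1 R.2
      rw [ha, hb]
      exact Nat.Coprime.pow _ _ ((Nat.coprime_primes hq hr).2 hrq.symm)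
    have := action_trivial hp (h.restrict hRf) (h.restrict hVf)
      ((MulAut.conjNormal (H := V)).comp (R : Subgroup M).subtype) (fun s v => by
        refine Subtype.ext ?_
        change f ((s : M) * v * (s : M)⁻¹) = f s * f v * (f s)⁻¹
        rw [map_mul, map_mul, map_inv]) hc ⟨s, hs⟩ ⟨v, hv⟩
    exact congrArg Subtype.val this
  obtain ⟨Q⟩ : Nonempty (Sylow q M) := inferInstance
  let _ : MulAction (Q : Subgroup M) V :=
    MulAction.compHom V ((MulAut.conjNormal (H := V)).comp (Q : Subgroup M).subtype)
  have hqV : q ∣ Nat.card V := by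
    have := (hVq.card_eq_or_dvd).resolve_left fun h1 => hz1 (by
      have := (Nat.card_eq_one_iff_unique.1 h1).1
      exact congrArg Subtype.val (Subsingleton.elim (⟨z, hzV⟩ : V) 1))
    exact this
  obtain ⟨v, hv, hv1⟩ := Q.2.exists_fixed_point_of_prime_dvd_card_of_fixed_point V hqV
    (a := 1) (fun g => map_one (MulAut.conjNormal (g : M)))
  have hvQ : ∀ s ∈ Q, s * v * s⁻¹ = v := fun s hs => congrArg Subtype.val (hv ⟨s, hs⟩)
  have htop : Subgroup.centralizer {(v : M)} = ⊤ := by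
    rw [← Subgroup.index_eq_one]
    by_contra hne
    obtain ⟨r, hr, hrd⟩ := Nat.exists_prime_and_dvd hne
    have := Fact.mk hr
    obtain ⟨R, hR⟩ : ∃ R : Sylow r M, ∀ s ∈ R, s * v * s⁻¹ = v := by
      by_cases hrq : r = q
      · subst hrq; exact ⟨Q, hvQ⟩
      · obtain ⟨R, hR⟩ := hcent r hr hrq
        exact ⟨R, fun s hs => hR s hs v v.2⟩
    refine R.not_dvd_index (hrd.trans (Subgroup.index_dvd_of_le fun s hs => ?_))
    rw [Subgroup.mem_centralizer_singleton_iff]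
    exact mul_inv_eq_iff_eq_mul.1 (hR s hs)
  intro hbot
  refine hv1 (Subtype.ext ?_)
  have : (v : M) ∈ Subgroup.center M := Subgroup.mem_center_iff.2 fun g =>
    Subgroup.mem_centralizer_singleton_iff.1 (htop ▸ Subgroup.mem_top g)
  rw [hbot, Subgroup.mem_bot] at this
  exact this.symm

/-- **Thompson**: a finite group with a fixed-point-free automorphism of prime order is
nilpotent. -/
theorem isNilpotent [Finite M] (hp : p.Prime) (h : IsFPF p f) : Group.IsNilpotent M := by
  induction hn : Nat.card M using Nat.strong_induction_on generalizing M with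
  | _ n ih =>
  subst hn
  rcases subsingleton_or_nontrivial M with hM | hM
  · infer_instance
  rcases h.exists_normal_nilpotent hp hM (fun H hH hf =>
    ih _ (lt_of_le_of_ne (Subgroup.card_le_card_group H)
      fun hc => hH (Subgroup.eq_top_of_card_eq H hc)) (h.restrict hf) rfl) with h1 | ⟨N, hN, hNb,
          hNf, hNn⟩
  · exact h1
  · have hZ := h.exists_mem_center hp hNb hNf hNn
    have hs : Function.Surjective f := Finite.surjective_of_injective (h.injective hp)
    have hle : Subgroup.center M ≤ (Subgroup.center M).comap f := fun z hz => by
      rw [Subgroup.mem_comap, Subgroup.mem_center_iff]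
      intro g
      obtain ⟨g, rfl⟩ := hs g
      rw [← map_mul, ← map_mul, Subgroup.mem_center_iff.1 hz]
    refine Group.of_quotient_center_nilpotent (ih _ ?_ (h.quotient hp hle) rfl)
    rw [← Subgroup.index_eq_card]
    have h1 := (Subgroup.center M).card_mul_index
    have h2 := Subgroup.one_lt_card_iff_ne_bot (H := Subgroup.center M) |>.2 hZ
    have h3 : 0 < (Subgroup.center M).index := Nat.pos_of_ne_zero Subgroup.index_ne_zero_of_finite
    nlinarith

end IsFPF

section Characters

open Representation

section Irreducible
variable {G V : Type*} [Group G] [AddCommGroup V] [Module ℂ V]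

theorem isIrreducible_iff_submodule (ρ : Representation ℂ G V) :
    ρ.IsIrreducible ↔ Nontrivial V ∧
      ∀ U : Submodule ℂ V, (∀ g, ∀ u ∈ U, ρ g u ∈ U) → U = ⊥ ∨ U = ⊤ := by
  constructor
  · intro h
    refine ⟨?_, fun U hU => ?_⟩
    · by_contra hV
      rw [not_nontrivial_iff_subsingleton] at hV
      obtain ⟨a, b, hab⟩ := h.exists_pair_ne
      exact hab (Subrepresentation.toSubmodule_injective (Subsingleton.elim _ _))
    · rcases h.eq_bot_or_eq_top ⟨U, fun g v hv => hU g v hv⟩ with h1 | h1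
      · exact Or.inl (congrArg Subrepresentation.toSubmodule h1)
      · exact Or.inr (congrArg Subrepresentation.toSubmodule h1)
  · rintro ⟨hV, h⟩
    refine { exists_pair_ne := ⟨⊥, ⊤, fun h1 => ?_⟩, eq_bot_or_eq_top := fun W => ?_ }
    · have : (⊥ : Submodule ℂ V) = ⊤ := congrArg Subrepresentation.toSubmodule h1
      exact bot_ne_top this
    · rcases h W.toSubmodule fun g u hu => W.apply_mem_toSubmodule g hu with h1 | h1
      · exact Or.inl (Subrepresentation.toSubmodule_injective h1)
      · exact Or.inr (Subrepresentation.toSubmodule_injective h1)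

theorem IsIrrChar.exists_rep {χ : G → ℂ} (h : IsIrrChar χ) :
    ∃ (n : ℕ) (ρ : Representation ℂ G (Fin n → ℂ)), ρ.IsIrreducible ∧ χ = ρ.character := by
  obtain ⟨n, ρ, hn, hU, hχ⟩ := h
  refine ⟨n, ρ, (isIrreducible_iff_submodule ρ).2 ⟨?_, fun U h => ?_⟩, funext hχ⟩
  · have : Nonempty (Fin n) := ⟨⟨0, hn⟩⟩
    infer_instance
  · exact hU U fun g => Submodule.map_le_iff_le_comap.2 (h g)

theorem Representation.IsIrreducible.transport {W : Type*} [AddCommGroup W] [Module ℂ W]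
    {ρ : Representation ℂ G V} (h : ρ.IsIrreducible) {σ : Representation ℂ G W} (e : V ≃ₗ[ℂ] W)
    (he : ∀ g v, e (ρ g v) = σ g (e v)) : σ.IsIrreducible := by
  rw [isIrreducible_iff_submodule] at h ⊢
  refine ⟨have := h.1; e.symm.toEquiv.nontrivial, fun U hU => ?_⟩
  rcases h.2 (U.comap e.toLinearMap) (fun g u hu => by
    change e (ρ g u) ∈ U
    rw [he]
    exact hU g _ hu) with h1 | h1
  · left
    rw [eq_bot_iff] at h1 ⊢
    intro u hu
    have h2 : e.symm u ∈ U.comap e.toLinearMap := by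
      change e (e.symm u) ∈ U
      rwa [e.apply_symm_apply]
    have := h1 h2
    rwa [Submodule.mem_bot, LinearEquiv.map_eq_zero_iff] at this
  · right
    rw [eq_top_iff] at h1 ⊢
    intro u _
    have : e (e.symm u) ∈ U := h1 (Submodule.mem_top (x := e.symm u))
    rwa [e.apply_symm_apply] at this

theorem Representation.IsIrreducible.isIrrChar [FiniteDimensional ℂ V] {ρ : Representation ℂ G V}
    (h : ρ.IsIrreducible) : IsIrrChar ρ.character := by
  let e : V ≃ₗ[ℂ] (Fin (Module.finrank ℂ V) → ℂ) := (Module.finBasis ℂ V).equivFun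
  let σ : Representation ℂ G (Fin (Module.finrank ℂ V) → ℂ) :=
    { toFun := fun g => e.conj (ρ g)
      map_one' := by rw [map_one]; exact e.conj_id
      map_mul' := fun a b => by rw [map_mul]; exact e.conj_comp _ _ }
  have he : ∀ g v, e (ρ g v) = σ g (e v) := fun g v => by
    change _ = e.conj (ρ g) (e v)
    rw [LinearEquiv.conj_apply_apply, e.symm_apply_apply]
  have hσ := h.transport e he
  have hV := ((isIrreducible_iff_submodule ρ).1 h).1
  refine ⟨_, σ, Module.finrank_pos, fun U hU => ((isIrreducible_iff_submodule σ).1 hσ).2 U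
    fun g u hu => hU g ⟨u, hu, rfl⟩, fun g => ?_⟩
  exact (LinearMap.trace_conj' (ρ g) e).symm

theorem Representation.IsIrreducible.eq_smul_one [FiniteDimensional ℂ V]
    {ρ : Representation ℂ G V} (h : ρ.IsIrreducible) {A : Module.End ℂ V}
    (hA : ∀ g, A * ρ g = ρ g * A) : ∃ c : ℂ, A = c • 1 := by
  rw [isIrreducible_iff_submodule] at h
  have := h.1
  obtain ⟨c, hc⟩ := Module.End.exists_eigenvalue A
  refine ⟨c, ?_⟩
  rcases h.2 (Module.End.eigenspace A c) fun g u hu => by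
    rw [Module.End.mem_eigenspace_iff] at hu ⊢
    have := LinearMap.congr_fun (hA g) u
    rw [Module.End.mul_apply, Module.End.mul_apply, hu, map_smul] at this
    exact this with h1 | h1
  · exact absurd h1 hc
  · ext v
    exact Module.End.mem_eigenspace_iff.1 (h1 ▸ Submodule.mem_top)

theorem IsIrrChar.apply_one_ne_zero {χ : G → ℂ} (hχ : IsIrrChar χ) : χ 1 ≠ 0 := by
  obtain ⟨n, ρ, hρ, rfl⟩ := hχ.exists_rep
  rw [char_one]
  have := ((isIrreducible_iff_submodule ρ).1 hρ).1
  exact Nat.cast_ne_zero.2 Module.finrank_pos.ne'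

theorem IsIrrChar.conj {χ : G → ℂ} (hχ : IsIrrChar χ) (g h : G) : χ (h * g * h⁻¹) = χ g := by
  obtain ⟨n, ρ, hρ, rfl⟩ := hχ.exists_rep
  exact char_conj ρ g h

end Irreducible

section Orthogonality
variable {G : Type*} [Group G] [Fintype G] {χ ψ : G → ℂ}

theorem exists_equiv_of_character_eq {V W : Type*} [AddCommGroup V] [Module ℂ V]
    [AddCommGroup W] [Module ℂ W] [FiniteDimensional ℂ V] [FiniteDimensional ℂ W]
    {ρ : Representation ℂ G V} {σ : Representation ℂ G W} (hρ : ρ.IsIrreducible)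
    (hσ : σ.IsIrreducible) (h : ρ.character = σ.character) :
    ∃ e : V ≃ₗ[ℂ] W, ∀ g v, e (ρ g v) = σ g (e v) := by
  have : Invertible (Nat.card G : ℂ) := invertibleOfNonzero (Nat.cast_ne_zero.2 Nat.card_pos.ne')
  have h1 := char_orthonormal σ ρ
  have h2 := char_orthonormal ρ ρ
  rw [if_pos ⟨Representation.Equiv.refl ρ⟩, h, ← h] at h2
  rw [← h, h2] at h1
  by_cases hne : Nonempty (ρ.Equiv σ)
  · obtain ⟨e⟩ := hne
    exact ⟨e.toLinearEquiv, fun g v => LinearMap.congr_fun (e.isIntertwining' g) v⟩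
  · rw [if_neg hne] at h1
    exact absurd h1 one_ne_zero

open Classical in
theorem IsIrrChar.sum_mul_inv (hχ : IsIrrChar χ) (hψ : IsIrrChar ψ) :
    ∑ g, χ g * ψ g⁻¹ = if χ = ψ then (Fintype.card G : ℂ) else 0 := by
  have hc : (Nat.card G : ℂ) ≠ 0 := Nat.cast_ne_zero.2 Nat.card_pos.ne'
  have : Invertible (Nat.card G : ℂ) := invertibleOfNonzero hc
  obtain ⟨n, ρ, hρ, rfl⟩ := hχ.exists_rep
  obtain ⟨m, σ, hσ, rfl⟩ := hψ.exists_rep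
  have h1 := char_orthonormal ρ σ
  rw [inv_mul_eq_iff_eq_mul₀ hc] at h1
  rw [h1, ← Nat.card_eq_fintype_card]
  by_cases h : ρ.character = σ.character
  · obtain ⟨e, he⟩ := exists_equiv_of_character_eq hσ hρ h.symm
    have : Nonempty (σ.Equiv ρ) :=
      ⟨Representation.Equiv.mk e fun g => LinearMap.ext (he g)⟩
    rw [if_pos this, if_pos h]; simp
  · have : ¬ Nonempty (σ.Equiv ρ) := fun ⟨e⟩ => h (char_iso e).symm
    rw [if_neg this, if_neg h]; simp

end Orthogonality

section Induction
variable {G V : Type*} [Group G] [Finite G] [AddCommGroup V] [Module ℂ V] [FiniteDimensional ℂ V]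

/-- Induction over the subrepresentations of a complex representation of a finite group. -/
theorem Subrepresentation.induction {ρ : Representation ℂ G V} {Q : Subrepresentation ρ → Prop}
    (bot : Q ⊥) (irr : ∀ U : Subrepresentation ρ, U.toRepresentation.IsIrreducible → Q U)
    (sup : ∀ U W : Subrepresentation ρ, Disjoint U.toSubmodule W.toSubmodule →
      Q U → Q W → Q (U ⊔ W)) (U : Subrepresentation ρ) : Q U := by
  have : NeZero (Nat.card G : ℂ) := ⟨Nat.cast_ne_zero.2 Nat.card_pos.ne'⟩
  induction hn : Module.finrank ℂ U.toSubmodule using Nat.strong_induction_on generalizing U with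
  | _ n ih =>
  subst hn
  by_cases hb : U.toSubmodule = ⊥
  · have : U = ⊥ := Subrepresentation.toSubmodule_injective hb
    rw [this]
    exact bot
  by_cases hU : U.toRepresentation.IsIrreducible
  · exact irr U hU
  rw [isIrreducible_iff_submodule] at hU
  push Not at hU
  obtain ⟨S, hS, hS0, hS1⟩ := hU ((Submodule.nontrivial_iff_ne_bot).2 hb)
  let S' : Subrepresentation ρ := ⟨S.map U.toSubmodule.subtype, by
    rintro g _ ⟨v, hv, rfl⟩
    exact ⟨_, hS g v hv, rfl⟩⟩
  have hSU : S' ≤ U := by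
    rintro _ ⟨v, hv, rfl⟩
    exact v.2
  have hSU' : S'.toSubmodule ≤ U.toSubmodule := hSU
  have hS'0 : S'.toSubmodule ≠ ⊥ := fun h => hS0 (Submodule.map_injective_of_injective
    U.toSubmodule.injective_subtype (h.trans (Submodule.map_bot _).symm))
  have hS'1 : S'.toSubmodule ≠ U.toSubmodule := fun h => hS1 (by
    rw [eq_top_iff]
    intro u _
    have : (u : V) ∈ S'.toSubmodule := by rw [h]; exact u.2
    obtain ⟨v, hv, hvu⟩ := this
    rwa [← Subtype.ext hvu])
  obtain ⟨T, hT⟩ := exists_isCompl S'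
  have hd : S'.toSubmodule ⊓ T.toSubmodule = ⊥ :=
    congrArg Subrepresentation.toSubmodule hT.inf_eq_bot
  have hc : S'.toSubmodule ⊔ T.toSubmodule = ⊤ :=
    congrArg Subrepresentation.toSubmodule hT.sup_eq_top
  have hsum : S'.toSubmodule ⊔ (T.toSubmodule ⊓ U.toSubmodule) = U.toSubmodule := by
    rw [← sup_inf_assoc_of_le _ hSU', hc, top_inf_eq]
  have hUeq : U = S' ⊔ (T ⊓ U) := Subrepresentation.toSubmodule_injective hsum.symm
  rw [hUeq]
  refine sup _ _ ?_ (ih _ (Submodule.finrank_lt_finrank_of_lt (lt_of_le_of_ne hSU' hS'1)) S' rfl)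
    (ih _ (Submodule.finrank_lt_finrank_of_lt (lt_of_le_of_ne inf_le_right fun h => hS'0 ?_))
      (T ⊓ U) rfl)
  · rw [disjoint_iff]
    change S'.toSubmodule ⊓ (T.toSubmodule ⊓ U.toSubmodule) = ⊥
    rw [← inf_assoc, hd, bot_inf_eq]
  · rw [eq_bot_iff, ← hd]
    exact le_inf le_rfl (hSU'.trans (h ▸ inf_le_left))

end Induction

section Projection
variable {G V : Type*} [Group G] [Fintype G] [AddCommGroup V] [Module ℂ V]

/-- The projection onto the `θ`-isotypic part of a representation. -/
def irrProj (θ : G → ℂ) (ρ : Representation ℂ G V) : Module.End ℂ V :=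
  (θ 1 / Fintype.card G) • ∑ g, θ g⁻¹ • ρ g

/-- The irreducible complex characters of `G`. -/
abbrev Irr (G : Type*) [Group G] := {χ : G → ℂ // IsIrrChar χ}

instance : Finite (Irr G) := by
  classical
  have h : LinearIndependent ℂ (fun χ : Irr G => (χ : G → ℂ)) := by
    rw [linearIndependent_iff']
    intro s c hc ψ hψ
    have h1 : ∑ g, (∑ χ ∈ s, c χ • (χ : G → ℂ)) g * ψ.1 g⁻¹ = 0 := by
      rw [hc]; simp
    simp only [Finset.sum_apply, Pi.smul_apply, smul_eq_mul, Finset.sum_mul, mul_assoc] at h1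
    rw [Finset.sum_comm] at h1
    simp only [← Finset.mul_sum, IsIrrChar.sum_mul_inv (Subtype.prop _) ψ.2] at h1
    simp only [mul_ite, mul_zero, ← Subtype.ext_iff] at h1
    rw [Finset.sum_ite_eq' s ψ, if_pos hψ] at h1
    exact (mul_eq_zero.1 h1).resolve_right (Nat.cast_ne_zero.2 Fintype.card_ne_zero)
  exact h.finite

noncomputable instance : Fintype (Irr G) := Fintype.ofFinite _

theorem irrProj_comm {θ : G → ℂ} (hθ : IsIrrChar θ) (ρ : Representation ℂ G V) (g : G) :
    irrProj θ ρ * ρ g = ρ g * irrProj θ ρ := by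
  rw [irrProj, smul_mul_assoc, mul_smul_comm, Finset.sum_mul, Finset.mul_sum]
  congr 1
  refine Fintype.sum_equiv (MulAut.conj g⁻¹).toEquiv _ _ fun h => ?_
  change _ = ρ g * (θ (g⁻¹ * h * g⁻¹⁻¹)⁻¹ • ρ (g⁻¹ * h * g⁻¹⁻¹))
  rw [smul_mul_assoc, mul_smul_comm, ← map_mul, ← map_mul,
    show (g⁻¹ * h * g⁻¹⁻¹)⁻¹ = g⁻¹ * h⁻¹ * g⁻¹⁻¹ by group, hθ.conj]
  congr 2
  group

theorem trace_irrProj (θ : G → ℂ) (ρ : Representation ℂ G V) :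
    LinearMap.trace ℂ V (irrProj θ ρ) =
      θ 1 / Fintype.card G * ∑ g, θ g⁻¹ * ρ.character g := by
  rw [irrProj, map_smul, map_sum]
  simp only [map_smul, smul_eq_mul, Representation.character]

open Classical in
theorem irrProj_of_isIrreducible [FiniteDimensional ℂ V] {θ : G → ℂ} (hθ : IsIrrChar θ)
    {ρ : Representation ℂ G V} (hρ : ρ.IsIrreducible) :
    irrProj θ ρ = if θ = ρ.character then 1 else 0 := by
  obtain ⟨c, hc⟩ := hρ.eq_smul_one (irrProj_comm hθ ρ)
  have h1 := trace_irrProj θ ρ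
  have h2 : ∑ g, θ g⁻¹ * ρ.character g = ∑ g, ρ.character g * θ g⁻¹ :=
    Finset.sum_congr rfl fun _ _ => mul_comm _ _
  have h3 : (Module.finrank ℂ V : ℂ) ≠ 0 := by
    have := hρ.isIrrChar.apply_one_ne_zero
    rwa [char_one] at this
  have h4 : (Fintype.card G : ℂ) ≠ 0 := Nat.cast_ne_zero.2 Fintype.card_ne_zero
  rw [hc, map_smul, LinearMap.trace_one, h2, hρ.isIrrChar.sum_mul_inv hθ, smul_eq_mul] at h1
  rw [hc]
  by_cases h : ρ.character = θ
  · rw [if_pos h, div_mul_cancel₀ _ h4, ← h, char_one] at h1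
    rw [if_pos h.symm, mul_right_cancel₀ h3 (h1.trans (one_mul _).symm), one_smul]
  · rw [if_neg h, mul_zero] at h1
    rw [if_neg (Ne.symm h), (mul_eq_zero.1 h1).resolve_right h3, zero_smul]

theorem irrProj_toRepresentation {ρ : Representation ℂ G V} (θ : G → ℂ) (U : Subrepresentation ρ)
    (u : U.toSubmodule) : (irrProj θ U.toRepresentation u : V) = irrProj θ ρ u := by
  simp only [irrProj, LinearMap.smul_apply, LinearMap.sum_apply, Submodule.coe_smul,
    Submodule.coe_sum]
  rfl

theorem irrProj_mem {ρ : Representation ℂ G V} (θ : G → ℂ) {U : Submodule ℂ V}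
    (hU : ∀ g, ∀ u ∈ U, ρ g u ∈ U) {u : V} (hu : u ∈ U) : irrProj θ ρ u ∈ U := by
  simp only [irrProj, LinearMap.smul_apply, LinearMap.sum_apply]
  exact U.smul_mem _ (U.sum_mem fun g _ => U.smul_mem _ (hU g u hu))

variable [FiniteDimensional ℂ V]

theorem Representation.ext_of_irreducible (ρ : Representation ℂ G V) {A B : Module.End ℂ V}
    (h : ∀ U : Subrepresentation ρ, U.toRepresentation.IsIrreducible →
      ∀ u : U.toSubmodule, A u = B u) : A = B := by
  have := Subrepresentation.induction (ρ := ρ) (Q := fun U => ∀ u ∈ U.toSubmodule, A u = B u)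
    (fun u hu => by
      obtain rfl : u = 0 := hu
      rw [map_zero, map_zero]) (fun U hU u hu => h U hU ⟨u, hu⟩) (fun U W _ hU hW u hu => by
      obtain ⟨a, ha, b, hb, rfl⟩ :=
          Submodule.mem_sup.1 (show u ∈ U.toSubmodule ⊔ W.toSubmodule from hu)
      rw [map_add, map_add, hU a ha, hW b hb]) ⊤
  exact LinearMap.ext fun u => this u (Submodule.mem_top (x := u))

open Classical in
theorem irrProj_apply_of_mem {ρ : Representation ℂ G V} {U : Subrepresentation ρ}
    (hU : U.toRepresentation.IsIrreducible) (θ : Irr G) (u : U.toSubmodule) :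
    irrProj θ.1 ρ u =
      if θ = ⟨U.toRepresentation.character, hU.isIrrChar⟩ then (u : V) else 0 := by
  rw [← irrProj_toRepresentation, irrProj_of_isIrreducible θ.2 hU]
  by_cases h : θ.1 = U.toRepresentation.character
  · rw [if_pos h, if_pos (Subtype.ext h)]; rfl
  · rw [if_neg h, if_neg fun h1 => h (congrArg Subtype.val h1)]; rfl

theorem sum_irrProj (ρ : Representation ℂ G V) : ∑ θ : Irr G, irrProj θ.1 ρ = 1 := by
  classical
  refine ρ.ext_of_irreducible fun U hU u => ?_
  rw [LinearMap.sum_apply]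
  have : ∀ θ : Irr G, irrProj θ.1 ρ u =
      if θ = ⟨U.toRepresentation.character, hU.isIrrChar⟩ then (u : V) else 0 := fun θ =>
          irrProj_apply_of_mem hU θ u
  simp [this]

open Classical in
theorem irrProj_mul_irrProj (ρ : Representation ℂ G V) (θ ψ : Irr G) :
    irrProj θ.1 ρ * irrProj ψ.1 ρ = if θ = ψ then irrProj θ.1 ρ else 0 := by
  refine ρ.ext_of_irreducible fun U hU u => ?_
  have : ∀ θ : Irr G, ∀ u : U.toSubmodule, irrProj θ.1 ρ u =
      if θ = ⟨U.toRepresentation.character, hU.isIrrChar⟩ then (u : V) else 0 := fun θ u =>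
          irrProj_apply_of_mem hU θ u
  rw [Module.End.mul_apply, this ψ]
  by_cases h : θ = ψ
  · subst h
    rw [if_pos rfl, this]
    split_ifs with h1
    · rw [this, if_pos h1]
    · rw [map_zero]
  · rw [if_neg h, LinearMap.zero_apply]
    split_ifs with h1
    · rw [this, if_neg fun h2 => h (h2.trans h1.symm)]
    · rw [map_zero]

theorem irrProj_isIdempotent (ρ : Representation ℂ G V) (θ : Irr G) :
    IsIdempotentElem (irrProj θ.1 ρ) := by
  classical
  rw [IsIdempotentElem, irrProj_mul_irrProj, if_pos rfl]

theorem finrank_range_irrProj (ρ : Representation ℂ G V) (θ : Irr G) :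
    (Module.finrank ℂ (LinearMap.range (irrProj θ.1 ρ)) : ℂ) =
      θ.1 1 / Fintype.card G * ∑ g, θ.1 g⁻¹ * ρ.character g := by
  rw [← trace_irrProj]
  exact ((LinearMap.IsIdempotentElem.isProj_range _ (irrProj_isIdempotent ρ θ)).trace).symm

end Projection

section Transport
variable {G H : Type*} [Group G] [Group H]

theorem IsIrrChar.comp_mulEquiv {χ : H → ℂ} (h : IsIrrChar χ) (e : G ≃* H) :
    IsIrrChar fun g => χ (e g) := by
  obtain ⟨n, ρ, hn, hU, hχ⟩ := h
  refine ⟨n, ρ.comp e.toMonoidHom, hn, fun U h => hU U fun g => ?_, fun g => hχ (e g)⟩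
  have := h (e.symm g)
  change U.map (ρ (e (e.symm g))) ≤ U at this
  rwa [e.apply_symm_apply] at this

/-- The degree of an irreducible character. -/
def Irr.degree (θ : Irr G) : ℕ := θ.2.choose

theorem Irr.apply_one (θ : Irr G) : θ.1 1 = θ.degree := by
  obtain ⟨ρ, hn, hU, hχ⟩ := θ.2.choose_spec
  change _ = ((θ.2.choose : ℕ) : ℂ)
  rw [hχ 1, map_one, LinearMap.trace_one, Module.finrank_fin_fun]

theorem Irr.exists_rep (θ : Irr G) : ∃ ρ : Representation ℂ G (Fin θ.degree → ℂ),
    ρ.IsIrreducible ∧ θ.1 = ρ.character := by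
  obtain ⟨n, ρ, hρ, h⟩ := θ.2.exists_rep
  have : θ.degree = n := by
    have := θ.apply_one
    rw [h, char_one, Module.finrank_fin_fun] at this
    exact_mod_cast this.symm
  rw [this]
  exact ⟨ρ, hρ, h⟩

end Transport

section Normal
variable {G : Type*} [Group G] {N : Subgroup G} [hN : N.Normal]

instance Irr.mulAction : MulAction G (Irr N) where
  smul g θ := ⟨fun n => θ.1 (MulAut.conjNormal g⁻¹ n), θ.2.comp_mulEquiv _⟩
  one_smul θ := Subtype.ext (funext fun n => by
    change θ.1 (MulAut.conjNormal (1 : G)⁻¹ n) = _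
    rw [inv_one, map_one]; rfl)
  mul_smul g h θ := Subtype.ext (funext fun n => by
    change θ.1 (MulAut.conjNormal (g * h)⁻¹ n) =
      θ.1 (MulAut.conjNormal h⁻¹ (MulAut.conjNormal g⁻¹ n))
    rw [mul_inv_rev, map_mul]; rfl)

theorem Irr.smul_apply (g : G) (θ : Irr N) (n : N) :
    (g • θ).1 n = θ.1 (MulAut.conjNormal g⁻¹ n) := rfl

theorem Irr.smul_apply_one (g : G) (θ : Irr N) : (g • θ).1 1 = θ.1 1 := by
  rw [Irr.smul_apply, map_one]

theorem Irr.degree_smul (g : G) (θ : Irr N) : (g • θ).degree = θ.degree := by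
  have := Irr.smul_apply_one g θ
  rw [Irr.apply_one, Irr.apply_one] at this
  exact_mod_cast this

theorem Irr.smul_of_mem {g : G} (hg : g ∈ N) (θ : Irr N) : g • θ = θ := by
  refine Subtype.ext (funext fun n => ?_)
  rw [Irr.smul_apply]
  have : MulAut.conjNormal g⁻¹ n = (⟨g, hg⟩ : N)⁻¹ * n * (⟨g, hg⟩ : N)⁻¹⁻¹ := Subtype.ext rfl
  rw [this, θ.2.conj]

variable {V : Type*} [AddCommGroup V] [Module ℂ V]

/-- Restriction of a representation to a subgroup. -/
abbrev Representation.res (ρ : Representation ℂ G V) (N : Subgroup G) : Representation ℂ N V :=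
  ρ.comp N.subtype

theorem map_mul_irrProj [Fintype N] (ρ : Representation ℂ G V) (g : G) (θ : Irr N) :
    ρ g * irrProj θ.1 (ρ.res N) = irrProj (g • θ).1 (ρ.res N) * ρ g := by
  rw [irrProj, irrProj, mul_smul_comm, smul_mul_assoc, Finset.mul_sum, Finset.sum_mul,
    Irr.smul_apply_one]
  congr 1
  refine Fintype.sum_equiv (MulAut.conjNormal g).toEquiv _ _ fun n => ?_
  change ρ g * (θ.1 n⁻¹ • ρ n) =
    ((g • θ).1 (MulAut.conjNormal g n)⁻¹ • ρ (MulAut.conjNormal g n : N)) * ρ g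
  rw [Irr.smul_apply, map_inv, ← MulAut.mul_apply, ← map_mul, inv_mul_cancel, map_one,
    mul_smul_comm, smul_mul_assoc, ← map_mul, ← map_mul, MulAut.conjNormal_apply]
  simp [mul_assoc]

end Normal

section Permutation
variable {G X : Type*} [Group G] [MulAction G X]

/-- The permutation representation on functions. -/
def permRep (G X : Type*) [Group G] [MulAction G X] : Representation ℂ G (X → ℂ) where
  toFun g := LinearMap.funLeft ℂ ℂ fun x => g⁻¹ • x
  map_one' := by ext; simp
  map_mul' g h := by ext; simp [LinearMap.funLeft, mul_smul]

theorem permRep_apply (g : G) (f : X → ℂ) (x : X) : permRep G X g f x = f (g⁻¹ • x) := rfl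

theorem character_permRep [Fintype X] (g : G) :
    (permRep G X).character g = Nat.card {x : X // g • x = x} := by
  classical
  rw [Representation.character, LinearMap.trace_eq_matrix_trace ℂ (Pi.basisFun ℂ X), Matrix.trace]
  simp only [Matrix.diag_apply, LinearMap.toMatrix_apply, Pi.basisFun_apply, Pi.basisFun_repr,
    permRep_apply, Pi.single_apply]
  rw [Nat.card_eq_fintype_card, Fintype.card_subtype, Finset.sum_boole]
  congr 2
  ext x
  simp only [Finset.mem_filter, Finset.mem_univ, true_and]
  exact inv_smul_eq_iff.trans eq_comm

end Permutation

section Degree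
variable {G : Type*} [Group G] [Fintype G]

theorem sum_degree_sq : ∑ θ : Irr G, θ.degree ^ 2 = Fintype.card G := by
  classical
  have h4 : (Fintype.card G : ℂ) ≠ 0 := Nat.cast_ne_zero.2 Fintype.card_ne_zero
  have h := congrArg (LinearMap.trace ℂ _) (sum_irrProj (permRep G G))
  rw [map_sum, LinearMap.trace_one, Module.finrank_fintype_fun_eq_card] at h
  have h1 : ∀ θ : Irr G, LinearMap.trace ℂ _ (irrProj θ.1 (permRep G G)) =
      (θ.degree : ℂ) ^ 2 := fun θ => by
    rw [trace_irrProj, Finset.sum_eq_single 1]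
    · rw [character_permRep, inv_one, θ.apply_one]
      simp only [one_smul, Nat.card_eq_fintype_card, Fintype.card_subtype_true]
      field_simp
    · intro g _ hg
      rw [character_permRep]
      have : IsEmpty {x : G // g • x = x} := ⟨fun x => hg (mul_eq_right.1 x.2)⟩
      rw [Nat.card_of_isEmpty, Nat.cast_zero, mul_zero]
    · simp
  simp only [h1] at h
  exact_mod_cast h

theorem isIntegral_character {V : Type*} [AddCommGroup V] [Module ℂ V] [FiniteDimensional ℂ V]
    (ρ : Representation ℂ G V) (g : G) : IsIntegral ℤ (ρ.character g) := by
  rw [Representation.character,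
    Module.End.trace_eq_sum_roots_charpoly_of_splits (IsAlgClosed.splits _)]
  refine IsIntegral.multiset_sum fun c hc => ?_
  have h1 : Module.End.HasEigenvalue (ρ g) c :=
    (Module.End.hasEigenvalue_iff_isRoot_charpoly (ρ g) c).2 (Polynomial.isRoot_of_mem_roots hc)
  obtain ⟨v, hv⟩ := h1.exists_hasEigenvector
  refine IsIntegral.of_pow (orderOf_pos g) ?_
  have h2 := hv.pow_apply (orderOf g)
  rw [← map_pow, pow_orderOf_eq_one, map_one, Module.End.one_apply] at h2
  have h3 : c ^ orderOf g = 1 := by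
    have : (c ^ orderOf g - 1) • v = 0 := by rw [sub_smul, ← h2, one_smul, sub_self]
    exact sub_eq_zero.1 ((smul_eq_zero.1 this).resolve_right hv.2)
  rw [h3]
  exact isIntegral_one

theorem Irr.degree_dvd_card (θ : Irr G) : θ.degree ∣ Fintype.card G := by
  classical
  obtain ⟨ρ, hρ, hθ⟩ := θ.exists_rep
  have h4 : (Fintype.card G : ℂ) ≠ 0 := Nat.cast_ne_zero.2 Fintype.card_ne_zero
  have hd : (θ.degree : ℂ) ≠ 0 := by rw [← θ.apply_one]; exact θ.2.apply_one_ne_zero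
  let O := integralClosure ℤ ℂ
  let a : G → O := fun g => ⟨θ.1 g⁻¹, by
    rw [hθ]; exact isIntegral_character ρ g⁻¹⟩
  let z : MonoidAlgebra O G := ∑ g, MonoidAlgebra.single g (a g)
  have hz : IsIntegral O z := IsIntegral.of_finite O z
  let φ := MonoidAlgebra.lift O (Module.End ℂ (Fin θ.degree → ℂ)) G ρ
  have h1 : φ z = (Fintype.card G / θ.degree : ℂ) • (1 : Module.End ℂ (Fin θ.degree → ℂ)) := by
    have h2 := irrProj_of_isIrreducible θ.2 hρ
    rw [if_pos hθ, irrProj, θ.apply_one] at h2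
    rw [← h2, smul_smul, div_mul_div_cancel₀ hd, div_self h4, one_smul, map_sum]
    refine Finset.sum_congr rfl fun g _ => ?_
    rw [MonoidAlgebra.lift_single]
    rfl
  have h2 : IsIntegral O (φ z) := hz.map φ
  rw [h1, ← Algebra.algebraMap_eq_smul_one] at h2
  have : Nontrivial (Fin θ.degree → ℂ) := ((isIrreducible_iff_submodule ρ).1 hρ).1
  have h3 : IsIntegral O (Fintype.card G / θ.degree : ℂ) :=
    (isIntegral_algHom_iff (IsScalarTower.toAlgHom O ℂ (Module.End ℂ (Fin θ.degree → ℂ)))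
      (FaithfulSMul.algebraMap_injective ℂ _)).1 h2
  have h5 : IsIntegral ℤ (Fintype.card G / θ.degree : ℂ) := isIntegral_trans _ h3
  have h6 : IsIntegral ℤ (Fintype.card G / θ.degree : ℚ) := by
    refine (isIntegral_algebraMap_iff (B := ℂ) (algebraMap ℚ ℂ).injective).1 ?_
    simpa using h5
  obtain ⟨k, hk⟩ := IsIntegrallyClosed.isIntegral_iff.1 h6
  have hd' : (θ.degree : ℚ) ≠ 0 := by exact_mod_cast hd
  rw [eq_div_iff hd'] at hk
  have hk' : k * (θ.degree : ℤ) = Fintype.card G := by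
    have : ((k * (θ.degree : ℤ) : ℤ) : ℚ) = ((Fintype.card G : ℤ) : ℚ) := by
      push_cast; exact hk
    exact_mod_cast this
  exact Int.natCast_dvd_natCast.1 ⟨k, by rw [← hk', mul_comm]⟩

end Degree

section Galois
variable {n : ℕ}

/-- Entrywise application of a field automorphism to an endomorphism. -/
def galConj (σ : ℂ ≃+* ℂ) : Module.End ℂ (Fin n → ℂ) ≃+* Module.End ℂ (Fin n → ℂ) :=
  (LinearMap.toMatrixAlgEquiv'.toRingEquiv.trans σ.mapMatrix).trans
    Matrix.toLinAlgEquiv'.toRingEquiv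

theorem galConj_eq (σ : ℂ ≃+* ℂ) (A : Module.End ℂ (Fin n → ℂ)) :
    galConj σ A = Matrix.toLin' ((LinearMap.toMatrix' A).map σ) := rfl

theorem galConj_smul (σ : ℂ ≃+* ℂ) (c : ℂ) (A : Module.End ℂ (Fin n → ℂ)) :
    galConj σ (c • A) = σ c • galConj σ A := by
  rw [galConj_eq, galConj_eq, map_smul, ← map_smul]
  ext i j
  simp

theorem galConj_apply (σ : ℂ ≃+* ℂ) (A : Module.End ℂ (Fin n → ℂ)) (v : Fin n → ℂ) :
    galConj σ A (fun i => σ (v i)) = fun i => σ (A v i) := by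
  funext i
  rw [galConj_eq, Matrix.toLin'_apply]
  have h := RingHom.map_mulVec (σ : ℂ →+* ℂ) (LinearMap.toMatrix' A) v i
  rw [LinearMap.toMatrix'_mulVec] at h
  exact h.symm

theorem trace_galConj (σ : ℂ ≃+* ℂ) (A : Module.End ℂ (Fin n → ℂ)) :
    LinearMap.trace ℂ _ (galConj σ A) = σ (LinearMap.trace ℂ _ A) := by
  rw [LinearMap.trace_eq_matrix_trace ℂ (Pi.basisFun ℂ (Fin n)) A,
    LinearMap.trace_eq_matrix_trace ℂ (Pi.basisFun ℂ (Fin n)) (galConj σ A), galConj_eq]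
  change (LinearMap.toMatrix' (Matrix.toLin' _)).trace = σ (LinearMap.toMatrix' A).trace
  rw [LinearMap.toMatrix'_toLin', Matrix.trace, Matrix.trace, map_sum]
  rfl

theorem det_galConj (σ : ℂ ≃+* ℂ) (A : Module.End ℂ (Fin n → ℂ)) :
    LinearMap.det (galConj σ A) = σ (LinearMap.det A) := by
  rw [galConj_eq, LinearMap.det_toLin', ← LinearMap.det_toMatrix' (f := A)]
  exact ((σ : ℂ →+* ℂ).map_det _).symm

variable {G : Type*} [Group G]

/-- The Galois conjugate of a matrix representation. -/
def Representation.galConj (ρ : Representation ℂ G (Fin n → ℂ)) (σ : ℂ ≃+* ℂ) :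
    Representation ℂ G (Fin n → ℂ) :=
  (RingEquiv.toMonoidHom (_root_.galConj σ)).comp ρ

theorem Representation.galConj_def (ρ : Representation ℂ G (Fin n → ℂ)) (σ : ℂ ≃+* ℂ) (g : G) :
    ρ.galConj σ g = _root_.galConj σ (ρ g) := rfl

theorem Representation.character_galConj (ρ : Representation ℂ G (Fin n → ℂ)) (σ : ℂ ≃+* ℂ)
    (g : G) : (ρ.galConj σ).character g = σ (ρ.character g) := trace_galConj _ _

theorem Representation.IsIrreducible.galConj {ρ : Representation ℂ G (Fin n → ℂ)}
    (h : ρ.IsIrreducible) (σ : ℂ ≃+* ℂ) : (ρ.galConj σ).IsIrreducible := by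
  rw [isIrreducible_iff_submodule] at h ⊢
  refine ⟨h.1, fun U hU => ?_⟩
  let W : Submodule ℂ (Fin n → ℂ) :=
    { carrier := {v | (fun i => σ (v i)) ∈ U}
      add_mem' := fun {a b} ha hb => by
        have := U.add_mem ha hb
        simpa [Pi.add_def] using this
      zero_mem' := by
        have := U.zero_mem
        simpa [Pi.zero_def] using this
      smul_mem' := fun c v hv => by
        have := U.smul_mem (σ c) hv
        simpa [Pi.smul_def] using this }
  have hW : ∀ v, v ∈ W ↔ (fun i => σ (v i)) ∈ U := fun v => Iff.rfl
  have hs : ∀ v : Fin n → ℂ, (fun i => σ ((fun j => σ.symm (v j)) i)) = v := fun v => by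
    funext i; simp
  rcases h.2 W (fun g v hv => by
    rw [hW, ← galConj_apply]
    exact hU g _ hv) with h0 | h0
  · refine Or.inl ((Submodule.eq_bot_iff _).2 fun v hv => ?_)
    have : (fun j => σ.symm (v j)) ∈ W := by rw [hW, hs]; exact hv
    rw [h0, Submodule.mem_bot] at this
    funext i
    have := congrFun this i
    simpa using this
  · refine Or.inr (eq_top_iff.2 fun v _ => ?_)
    have : (fun j => σ.symm (v j)) ∈ W := by rw [h0]; trivial
    rwa [hW, hs] at this

theorem IsIrrChar.galConj {χ : G → ℂ} (h : IsIrrChar χ) (σ : ℂ ≃+* ℂ) :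
    IsIrrChar fun g => σ (χ g) := by
  obtain ⟨n, ρ, hρ, rfl⟩ := h.exists_rep
  have := (hρ.galConj σ).isIrrChar
  rwa [show (ρ.galConj σ).character = fun g => σ (ρ.character g) from
    funext (ρ.character_galConj σ)] at this

/-- The Galois conjugate of an irreducible character. -/
def Irr.galConj (θ : Irr G) (σ : ℂ ≃+* ℂ) : Irr G := ⟨fun g => σ (θ.1 g), θ.2.galConj σ⟩

theorem irrProj_galConj [Fintype G] (θ : G → ℂ) (ρ : Representation ℂ G (Fin n → ℂ))
    (σ : ℂ ≃+* ℂ) :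
    irrProj (fun g => σ (θ g)) (ρ.galConj σ) = galConj σ (irrProj θ ρ) := by
  simp only [irrProj, galConj_smul, map_sum, map_div₀, map_natCast]
  rfl

theorem Irr.galConj_stab {N : Subgroup G} [N.Normal] {g : G} {θ : Irr N} {σ : ℂ ≃+* ℂ}
    (h : g • θ.galConj σ = θ.galConj σ) : g • θ = θ := by
  refine Subtype.ext (funext fun x => σ.injective ?_)
  exact congrFun (congrArg Subtype.val h) x

end Galois

section DetTrivial
variable {G : Type*} [Group G] (N : Subgroup G) [N.Normal] [Fintype N]
variable {V : Type*} [AddCommGroup V] [Module ℂ V]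

/-- The determinant of `g` on the `θ`-isotypic component. -/
def isoDet (ρ : Representation ℂ G V) {N : Subgroup G} [Fintype N] (θ : Irr N) (g : G) : ℂ :=
  LinearMap.det (ρ g * irrProj θ.1 (ρ.res N) + (1 - irrProj θ.1 (ρ.res N)))

/-- Some isotypic component of the restriction to `N` occurs whose determinant has
order dividing `l` on its stabilizer. -/
def DetTrivial (l : ℕ) (ρ : Representation ℂ G V) : Prop :=
  ∃ θ : Irr N, irrProj θ.1 (ρ.res N) ≠ 0 ∧ ∀ t : G, t • θ = θ → isoDet ρ θ t ^ l = 1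

variable {N} {l : ℕ}

theorem DetTrivial.galConj {n : ℕ} {ρ : Representation ℂ G (Fin n → ℂ)} (h : DetTrivial N l ρ)
    (σ : ℂ ≃+* ℂ) : DetTrivial N l (ρ.galConj σ) := by
  obtain ⟨θ, h0, h1⟩ := h
  have he : irrProj (θ.galConj σ).1 ((ρ.galConj σ).res N) =
    _root_.galConj σ (irrProj θ.1 (ρ.res N)) := irrProj_galConj θ.1 (ρ.res N) σ
  refine ⟨θ.galConj σ, ?_, fun t ht => ?_⟩
  · rwa [he, ne_eq, map_eq_zero_iff _ (RingEquiv.injective _)]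
  · rw [isoDet, he, Representation.galConj_def, ← map_one (_root_.galConj σ), ← map_sub, ← map_mul,
      ← map_add, det_galConj, ← map_pow]
    have := h1 t (Irr.galConj_stab ht)
    rw [isoDet] at this
    rw [this, map_one]

theorem irrProj_equiv {G V W : Type*} [Group G] [Fintype G] [AddCommGroup V] [Module ℂ V]
    [AddCommGroup W] [Module ℂ W] {ρ : Representation ℂ G V} {τ : Representation ℂ G W}
    (e : V ≃ₗ[ℂ] W) (he : ∀ g v, e (ρ g v) = τ g (e v)) (θ : G → ℂ) :
    irrProj θ τ = e.conj (irrProj θ ρ) := by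
  ext w
  rw [LinearEquiv.conj_apply_apply, irrProj, irrProj]
  simp [he]

theorem DetTrivial.equiv {W : Type*} [AddCommGroup W] [Module ℂ W] {ρ : Representation ℂ G V}
    {τ : Representation ℂ G W} (h : DetTrivial N l ρ)
    (e : V ≃ₗ[ℂ] W) (he : ∀ g v, e (ρ g v) = τ g (e v)) : DetTrivial N l τ := by
  obtain ⟨θ, h0, h1⟩ := h
  have hp : irrProj θ.1 (τ.res N) = e.conj (irrProj θ.1 (ρ.res N)) :=
    irrProj_equiv (ρ := ρ.res N) (τ := τ.res N) e (fun g v => he g v) θ.1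
  have hg : ∀ g, τ g = e.conj (ρ g) := fun g => by
    ext w
    rw [LinearEquiv.conj_apply_apply, he, e.apply_symm_apply]
  refine ⟨θ, ?_, fun t ht => ?_⟩
  · rwa [hp, ne_eq, map_eq_zero_iff _ (LinearEquiv.injective _)]
  · have h2 : τ t * irrProj θ.1 (τ.res N) + (1 - irrProj θ.1 (τ.res N)) =
        e.conj (ρ t * irrProj θ.1 (ρ.res N) + (1 - irrProj θ.1 (ρ.res N))) := by
      rw [map_add, map_sub, hp, hg]
      ext w
      simp
    rw [isoDet, h2, LinearEquiv.conj_apply, LinearMap.comp_assoc, LinearMap.det_conj]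
    exact h1 t ht

theorem DetTrivial.of_character_eq [Fintype G] {n : ℕ} {ρ τ : Representation ℂ G (Fin n → ℂ)}
    (hρ : ρ.IsIrreducible) (hτ : τ.IsIrreducible) (h : GaloisConj ρ.character τ.character)
    (hd : DetTrivial N l ρ) : DetTrivial N l τ := by
  obtain ⟨σ, hσ⟩ := h
  obtain ⟨e, he⟩ := exists_equiv_of_character_eq (hρ.galConj σ) hτ
    (funext fun g => by rw [character_galConj, hσ])
  exact (hd.galConj σ).equiv e he

end DetTrivial

section Cocycle
variable {G : Type*} [Group G] {N : Subgroup G} [N.Normal] [Fintype N]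
variable {V : Type*} [AddCommGroup V] [Module ℂ V]

/-- The weighted sum of the isotypic projections. -/
def weightedProj (ρ : Representation ℂ G V) (k : Irr N → ℂ) : Module.End ℂ V :=
  ∑ ψ : Irr N, k ψ • irrProj ψ.1 (ρ.res N)

theorem weightedProj_mul_map (ρ : Representation ℂ G V) (k : Irr N → ℂ) (g : G) :
    weightedProj ρ k * ρ g = ρ g * weightedProj ρ fun ψ => k (g • ψ) := by
  rw [weightedProj, weightedProj, Finset.sum_mul, Finset.mul_sum]
  refine (Fintype.sum_equiv (MulAction.toPerm g) _ _ fun ψ => ?_).symm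
  rw [MulAction.toPerm_apply, mul_smul_comm, smul_mul_assoc, map_mul_irrProj]

variable [FiniteDimensional ℂ V]

theorem weightedProj_mul_irrProj {N : Subgroup G} [Fintype N] (ρ : Representation ℂ G V)
    (k : Irr N → ℂ) (θ : Irr N) :
    weightedProj ρ k * irrProj θ.1 (ρ.res N) = k θ • irrProj θ.1 (ρ.res N) := by
  classical
  rw [weightedProj, Finset.sum_mul, Finset.sum_eq_single θ]
  · rw [smul_mul_assoc, irrProj_mul_irrProj, if_pos rfl]
  · intro ψ _ h
    rw [smul_mul_assoc, irrProj_mul_irrProj, if_neg h, smul_zero]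
  · simp

theorem weightedProj_mul {N : Subgroup G} [Fintype N] (ρ : Representation ℂ G V)
    (k k' : Irr N → ℂ) :
    weightedProj ρ k * weightedProj ρ k' = weightedProj ρ fun ψ => k ψ * k' ψ := by
  conv_lhs => rw [weightedProj.eq_1 ρ k', Finset.mul_sum]
  refine Finset.sum_congr rfl fun ψ _ => ?_
  rw [mul_smul_comm, weightedProj_mul_irrProj, smul_smul, mul_comm]

theorem weightedProj_one {N : Subgroup G} [Fintype N] (ρ : Representation ℂ G V) :
    weightedProj ρ (fun _ : Irr N => (1 : ℂ)) = 1 := by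
  simp only [weightedProj, one_smul]
  exact sum_irrProj (ρ.res N)

/-- A multiplicative cocycle for the action of `G` on `Irr N`, trivial on `N`. -/
structure IsIrrCocycle (κ : G → Irr N → ℂ) : Prop where
  mul : ∀ g h ψ, κ (g * h) ψ = κ g (h • ψ) * κ h ψ
  of_mem : ∀ n ∈ N, ∀ ψ, κ n ψ = 1

variable {κ : G → Irr N → ℂ}

/-- The twist of a representation by a cocycle. -/
def Representation.twist (ρ : Representation ℂ G V) (hκ : IsIrrCocycle κ) :
    Representation ℂ G V where
  toFun g := ρ g * weightedProj ρ (κ g)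
  map_one' := by
    rw [show κ 1 = fun _ => 1 from funext (hκ.of_mem 1 N.one_mem), weightedProj_one, map_one,
      mul_one]
  map_mul' g h := by
    rw [mul_assoc, ← mul_assoc (weightedProj ρ (κ g)), weightedProj_mul_map, mul_assoc,
      weightedProj_mul, map_mul, mul_assoc]
    congr 4
    exact funext (hκ.mul g h)

theorem Representation.twist_apply (ρ : Representation ℂ G V) (hκ : IsIrrCocycle κ) (g : G) :
    ρ.twist hκ g = ρ g * weightedProj ρ (κ g) := rfl

theorem Representation.res_twist (ρ : Representation ℂ G V) (hκ : IsIrrCocycle κ) :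
    (ρ.twist hκ).res N = ρ.res N := by
  ext1 n
  change ρ.twist hκ n = ρ n
  rw [twist_apply, show κ n = fun _ => 1 from funext (hκ.of_mem n n.2), weightedProj_one, mul_one]

theorem Representation.IsIrreducible.twist {ρ : Representation ℂ G V} (hρ : ρ.IsIrreducible)
    (hκ : IsIrrCocycle κ) : (ρ.twist hκ).IsIrreducible := by
  have h0 : ∀ g ψ, κ g ψ ≠ 0 := fun g ψ h => by
    have := hκ.mul g⁻¹ g ψ
    rw [h, mul_zero, inv_mul_cancel, hκ.of_mem 1 N.one_mem] at this
    exact one_ne_zero this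
  rw [isIrreducible_iff_submodule] at hρ ⊢
  refine ⟨hρ.1, fun U hU => hρ.2 U fun g u hu => ?_⟩
  have h1 : u = ∑ ψ : Irr N, irrProj ψ.1 (ρ.res N) u := by
    rw [← LinearMap.sum_apply, sum_irrProj]; rfl
  rw [h1, map_sum]
  refine U.sum_mem fun ψ _ => ?_
  have h2 : irrProj ψ.1 (ρ.res N) u ∈ U := by
    rw [← res_twist ρ hκ]
    exact irrProj_mem ψ.1 (fun n v hv => hU n v hv) hu
  have h3 := U.smul_mem (κ g ψ)⁻¹ (hU g _ h2)
  rw [twist_apply, ← Module.End.mul_apply, mul_assoc, weightedProj_mul_irrProj, mul_smul_comm,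
    LinearMap.smul_apply, smul_smul, inv_mul_cancel₀ (h0 g ψ), one_smul] at h3
  exact h3

theorem det_one_add_smul_of_isIdempotentElem {e : Module.End ℂ V} (he : IsIdempotentElem e)
    (c : ℂ) : LinearMap.det (1 - e + c • e) = c ^ Module.finrank ℂ (LinearMap.range e) := by
  have hP := LinearMap.IsIdempotentElem.isProj_range e he
  let E := Submodule.prodEquivOfIsCompl _ _ hP.isCompl
  have h : 1 - e + c • e = E.conj (LinearMap.prodMap (c • LinearMap.id) LinearMap.id) := by
    have h1 : e = E.conj (LinearMap.prodMap LinearMap.id 0) := hP.eq_conj_prodMap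
    have h2 : (1 : Module.End ℂ V) = E.conj LinearMap.id := E.conj_id.symm
    have h3 : 1 - e + c • e = E.conj LinearMap.id - E.conj (LinearMap.prodMap LinearMap.id 0) +
        c • E.conj (LinearMap.prodMap LinearMap.id 0) := by rw [← h1, ← h2]
    rw [h3, ← map_sub, ← map_smul, ← map_add]
    congr 1
    ext x <;> simp
  rw [h, LinearEquiv.conj_apply, LinearMap.comp_assoc, LinearMap.det_conj, LinearMap.det_prodMap,
    LinearMap.det_smul, LinearMap.det_id, LinearMap.det_id, mul_one, mul_one]

theorem isoDet_mul (ρ : Representation ℂ G V) {θ : Irr N} (s t : G) (ht : t • θ = θ) :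
    isoDet ρ θ (s * t) = isoDet ρ θ s * isoDet ρ θ t := by
  have h1 := map_mul_irrProj ρ t θ
  rw [ht] at h1
  have h2 := irrProj_isIdempotent (ρ.res N) θ
  rw [isoDet, isoDet, isoDet, ← map_mul]
  congr 1
  rw [map_mul]
  generalize irrProj θ.1 (ρ.res N) = e at *
  have h2 : e * e = e := h2
  have h3 : e * (ρ t * e) = ρ t * e := by rw [h1, ← mul_assoc, h2]
  have h4 : e * (1 - e) = 0 := by rw [mul_sub, mul_one, h2, sub_self]
  rw [add_mul, mul_add, mul_add, mul_assoc (ρ s) e, h3, mul_assoc _ e (1 - e), h4,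
    sub_mul 1 e (ρ t * e), one_mul, h3, sub_self, mul_zero, add_zero, zero_add,
    sub_mul 1 e (1 - e), one_mul, h4, sub_zero, mul_assoc]

theorem isoDet_one {N : Subgroup G} [Fintype N] {V : Type*} [AddCommGroup V] [Module ℂ V]
    (ρ : Representation ℂ G V) {θ : Irr N} : isoDet ρ θ 1 = 1 := by
  rw [isoDet, map_one, one_mul, add_sub_cancel, map_one]

theorem isoDet_twist (ρ : Representation ℂ G V) (hκ : IsIrrCocycle κ) (θ : Irr N) (t : G) :
    isoDet (ρ.twist hκ) θ t =
      isoDet ρ θ t * κ t θ ^ Module.finrank ℂ (LinearMap.range (irrProj θ.1 (ρ.res N))) := by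
  have h2 := irrProj_isIdempotent (ρ.res N) θ
  rw [isoDet, isoDet, res_twist, twist_apply, ← det_one_add_smul_of_isIdempotentElem h2,
    ← map_mul, mul_assoc, weightedProj_mul_irrProj]
  congr 1
  generalize irrProj θ.1 (ρ.res N) = e at *
  have h2 : e * e = e := h2
  have h4 : e * (1 - e) = 0 := by rw [mul_sub, mul_one, h2, sub_self]
  rw [mul_add, mul_smul_comm, mul_smul_comm, add_mul, add_mul, mul_assoc _ e e, mul_assoc _ e, h4,
    h2, sub_mul, sub_mul, h4, h2, one_mul, one_mul, sub_self]
  simp [add_comm]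

theorem Representation.IsIrreducible.exists_smul_eq {ρ : Representation ℂ G V}
    (hρ : ρ.IsIrreducible) {θ ψ : Irr N} (hθ : irrProj θ.1 (ρ.res N) ≠ 0)
    (hψ : irrProj ψ.1 (ρ.res N) ≠ 0) : ∃ g : G, g • θ = ψ := by
  classical
  by_contra hne
  let k : Irr N → ℂ := fun φ => if φ ∈ MulAction.orbit G θ then 1 else 0
  obtain ⟨c, hc⟩ := hρ.eq_smul_one (A := weightedProj ρ k) fun g => by
    rw [weightedProj_mul_map]
    congr 3
    funext φ
    have : g • φ ∈ MulAction.orbit G θ ↔ φ ∈ MulAction.orbit G θ := by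
      rw [← MulAction.orbitRel_apply, ← MulAction.orbitRel_apply]
      constructor
      · intro h
        exact (MulAction.orbitRel G _).trans ((MulAction.orbitRel G _).symm ⟨g, rfl⟩) h
      · intro h
        exact (MulAction.orbitRel G _).trans ⟨g, rfl⟩ h
    simp only [k, this]
  have h1 := weightedProj_mul_irrProj ρ k θ
  have h2 := weightedProj_mul_irrProj ρ k ψ
  rw [hc, smul_mul_assoc, one_mul] at h1 h2
  have h3 : c = 1 := by
    have := smul_left_injective ℂ hθ h1
    rw [this]
    exact if_pos (MulAction.mem_orbit_self θ)
  have h4 : c = 0 := by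
    have := smul_left_injective ℂ hψ h2
    rw [this]
    exact if_neg hne
  exact one_ne_zero (h3.symm.trans h4)

theorem isoDet_smul {V : Type*} [AddCommGroup V] [Module ℂ V] (ρ : Representation ℂ G V) (g t : G)
    (θ : Irr N) :
    isoDet ρ (g • θ) (g * t * g⁻¹) = isoDet ρ θ t := by
  have h := map_mul_irrProj ρ g θ
  have hu : ρ g * ρ g⁻¹ = 1 := by rw [← map_mul, mul_inv_cancel, map_one]
  have hu' : ρ g⁻¹ * ρ g = 1 := by rw [← map_mul, inv_mul_cancel, map_one]
  have h1 : irrProj (g • θ).1 (ρ.res N) = ρ g * irrProj θ.1 (ρ.res N) * ρ g⁻¹ := by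
    rw [h, mul_assoc, hu, mul_one]
  rw [isoDet, isoDet, h1]
  generalize irrProj θ.1 (ρ.res N) = e at *
  have h2 : ρ (g * t * g⁻¹) * (ρ g * e * ρ g⁻¹) + (1 - ρ g * e * ρ g⁻¹) =
      ρ g * ((ρ t * e + (1 - e)) * ρ g⁻¹) := by
    simp only [map_mul, add_mul, mul_add, sub_mul, mul_sub, one_mul, hu, mul_assoc]
    rw [← mul_assoc (ρ g⁻¹) (ρ g), hu', one_mul]
  rw [h2, map_mul, map_mul, mul_comm, mul_assoc, ← map_mul, hu', map_one, mul_one]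

end Cocycle

section Twist
variable {G : Type*} [Group G] {N : Subgroup G} [N.Normal]

theorem exists_isIrrCocycle {θ : Irr N} (β : MulAction.stabilizer G θ →* ℂˣ)
    (hβ : ∀ t : MulAction.stabilizer G θ, (t : G) ∈ N → β t = 1) :
    ∃ κ : G → Irr N → ℂ, IsIrrCocycle κ ∧ ∀ t : MulAction.stabilizer G θ, κ (t : G) θ = β t := by
  classical
  let b : G → ℂ := fun g => if h : g ∈ MulAction.stabilizer G θ then (β ⟨g, h⟩ : ℂ) else 1
  have hb : ∀ t : MulAction.stabilizer G θ, b t = β t := fun t => dif_pos t.2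
  have hmul : ∀ s t : MulAction.stabilizer G θ, b ((s : G) * t) = b s * b t := fun s t => by
    rw [hb, hb, ← Units.val_mul, ← map_mul, ← hb, Subgroup.coe_mul]
  have hsec : ∀ ψ : Irr N, ∃ s : G, ψ ∈ MulAction.orbit G θ → s • θ = ψ := fun ψ => by
    by_cases h : ψ ∈ MulAction.orbit G θ
    · exact ⟨h.choose, fun _ => h.choose_spec⟩
    · exact ⟨1, fun h1 => absurd h1 h⟩
  choose s hs using hsec
  have horb : ∀ (g : G) (ψ : Irr N), g • ψ ∈ MulAction.orbit G θ ↔ ψ ∈ MulAction.orbit G θ :=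
    fun g ψ => by
      constructor
      · rintro ⟨x, hx⟩
        exact ⟨g⁻¹ * x, by
          change (g⁻¹ * x) • θ = ψ
          rw [mul_smul, show x • θ = g • ψ from hx, inv_smul_smul]⟩
      · rintro ⟨x, hx⟩
        exact ⟨g * x, by
          change (g * x) • θ = g • ψ
          rw [mul_smul, show x • θ = ψ from hx]⟩
  have hst : ∀ (g : G) (ψ : Irr N), ψ ∈ MulAction.orbit G θ →
      (s (g • ψ))⁻¹ * g * s ψ ∈ MulAction.stabilizer G θ := fun g ψ h => by
    rw [MulAction.mem_stabilizer_iff, mul_smul, mul_smul, hs ψ h, inv_smul_eq_iff,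
      hs _ ((horb g ψ).2 h)]
  let κ : G → Irr N → ℂ := fun g ψ =>
    if ψ ∈ MulAction.orbit G θ then b ((s (g • ψ))⁻¹ * g * s ψ) else 1
  refine ⟨κ, ⟨fun g h ψ => ?_, fun n hn ψ => ?_⟩, fun t => ?_⟩
  · by_cases hψ : ψ ∈ MulAction.orbit G θ
    · have hψ' := (horb h ψ).2 hψ
      simp only [κ]
      rw [if_pos hψ, if_pos hψ', if_pos hψ, ← hmul ⟨_, hst g _ hψ'⟩ ⟨_, hst h _ hψ⟩, mul_smul]
      congr 1
      group
    · have hψ' := mt (horb h ψ).1 hψ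
      simp only [κ]
      rw [if_neg hψ, if_neg hψ', if_neg hψ, mul_one]
  · simp only [κ]
    split_ifs with h
    · have h1 := hst n ψ h
      refine (hb ⟨_, h1⟩).trans ?_
      rw [hβ, Units.val_one]
      change (s (n • ψ))⁻¹ * n * s ψ ∈ N
      rw [Irr.smul_of_mem hn]
      have : N.Normal := inferInstance
      simpa using this.conj_mem n hn (s ψ)⁻¹
    · rfl
  · have h0 : θ ∈ MulAction.orbit G θ := MulAction.mem_orbit_self θ
    have h1 : s θ ∈ MulAction.stabilizer G θ := hs θ h0
    have h2 : (t : G) • θ = θ := t.2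
    simp only [κ]
    rw [if_pos h0, h2]
    have : ((s θ)⁻¹ * t * s θ : G) =
        ((⟨s θ, h1⟩⁻¹ * t * ⟨s θ, h1⟩ : MulAction.stabilizer G θ) : G) :=
      rfl
    rw [this, hb, map_mul, map_mul, map_inv, mul_comm, mul_inv_cancel_left]

/-- `N` behaves like the `p`-residual: `G ⧸ N` is a `p`-group and `N` has no nontrivial linear
characters of `p`-power order. -/
structure IsPResidual (p : ℕ) (N : Subgroup G) : Prop where
  pow_mem : ∀ g, ∃ k, g ^ p ^ k ∈ N
  hom_eq_one : ∀ (f : N →* ℂˣ) (k : ℕ), (∀ n, f n ^ p ^ k = 1) → ∀ n, f n = 1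

/-- A nontrivial finite `p`-group has a nontrivial linear character. -/
theorem IsPGroup.exists_hom_ne_one {p : ℕ} (hp : p.Prime) {Q : Type*} [Group Q] [Finite Q]
    [Nontrivial Q] (hQ : IsPGroup p Q) : ∃ f : Q →* ℂˣ, ∃ q, f q ≠ 1 := by
  have := Fact.mk hp
  have := hQ.isNilpotent
  have hne : commutator Q ≠ ⊤ := (Group.IsSolvable.commutator_lt_top_of_nontrivial Q).ne
  obtain ⟨q, hq⟩ : ∃ q, q ∉ commutator Q := by
    by_contra! h
    exact hne (eq_top_iff.2 fun q _ => h q)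
  have hq' : Abelianization.of q ≠ 1 := fun h => hq ((QuotientGroup.eq_one_iff q).1 h)
  obtain ⟨f, hf⟩ := CommGroup.exists_apply_ne_one_of_hasEnoughRootsOfUnity (Abelianization Q) ℂ hq'
  exact ⟨f.comp Abelianization.of, q, hf⟩

theorem IsPResidual.exists_hom_ne_one [Finite G] {p : ℕ} (hp : p.Prime) (hN : IsPResidual p N)
    {T : Subgroup G} (hT : ¬ T ≤ N) :
    ∃ f : T →* ℂˣ, (∀ t : T, (t : G) ∈ N → f t = 1) ∧ ∃ t, f t ≠ 1 := by
  let Q := T ⧸ N.subgroupOf T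
  obtain ⟨t, ht, htN⟩ := SetLike.not_le_iff_exists.1 hT
  have : Nontrivial Q := ⟨(⟨t, ht⟩ : T), 1, fun h =>
    htN (Subgroup.mem_subgroupOf.1 ((QuotientGroup.eq_one_iff _).1 h))⟩
  have hQ : IsPGroup p Q := fun q => by
    induction q using QuotientGroup.induction_on with
    | H t =>
      obtain ⟨k, hk⟩ := hN.pow_mem (t : G)
      refine ⟨k, ?_⟩
      rw [← QuotientGroup.mk_pow, QuotientGroup.eq_one_iff, Subgroup.mem_subgroupOf]
      exact hk
  obtain ⟨f, q, hq⟩ := hQ.exists_hom_ne_one hp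
  refine ⟨f.comp (QuotientGroup.mk' _), fun t ht => ?_, ?_⟩
  · rw [MonoidHom.comp_apply, QuotientGroup.mk'_apply,
      (QuotientGroup.eq_one_iff t).2 (Subgroup.mem_subgroupOf.2 ht), map_one]
  · obtain ⟨t, rfl⟩ := QuotientGroup.mk'_surjective _ q
    exact ⟨t, hq⟩

theorem eq_one_of_pow_eq_one_of_coprime {M : Type*} [Monoid M] {x : M} {a b : ℕ}
    (h : a.Coprime b) (ha : x ^ a = 1) (hb : x ^ b = 1) : x = 1 := by
  have := Nat.dvd_gcd (orderOf_dvd_of_pow_eq_one ha) (orderOf_dvd_of_pow_eq_one hb)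
  rwa [h, Nat.dvd_one, orderOf_eq_one_iff] at this

theorem Nat.Coprime.exists_mul_modEq_one {a n : ℕ} (h : a.Coprime n) :
    ∃ u, a * u ≡ 1 [MOD n] := by
  rcases Nat.lt_trichotomy n 1 with h1 | rfl | h1
  · obtain rfl : n = 0 := by lia
    exact ⟨1, by rw [(Nat.coprime_zero_right a).1 h]⟩
  · exact ⟨1, Nat.modEq_one⟩
  · obtain ⟨m, -, hm⟩ := Nat.exists_mul_mod_eq_one_of_coprime h h1
    exact ⟨m, by rw [Nat.ModEq, hm, Nat.mod_eq_of_lt h1]⟩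

theorem IsGCStar.finrank_eq_one [Fintype G] [Fintype N] {p : ℕ} (hp : p.Prime)
    (hG : IsGCStar G) (hN : IsPResidual p N) {n : ℕ} {ρ : Representation ℂ G (Fin n → ℂ)}
    (hρ : ρ.IsIrreducible) {θ : Irr N}
    (hm : ¬ p ∣ Module.finrank ℂ (LinearMap.range (irrProj θ.1 (ρ.res N))))
    (hT : ¬ MulAction.stabilizer G θ ≤ N) : n = 1 := by
  by_contra hn
  set m := Module.finrank ℂ (LinearMap.range (irrProj θ.1 (ρ.res N))) with hmdef
  have he : irrProj θ.1 (ρ.res N) ≠ 0 := fun h => hm (by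
    rw [hmdef, h, LinearMap.range_zero, finrank_bot]; exact dvd_zero p)
  set T := MulAction.stabilizer G θ with hTdef
  have hNT : N ≤ T := fun n hn => Irr.smul_of_mem hn θ
  obtain ⟨k, l, hl, hcard⟩ := Nat.exists_eq_pow_mul_and_not_dvd (Nat.card_pos (α := T)).ne' p
    hp.ne_one
  have hcop : (m * l).Coprime (p ^ k) :=
    (Nat.Coprime.pow_left k ((Nat.Prime.coprime_iff_not_dvd hp).2 fun h =>
      (hp.dvd_mul.1 h).elim hm hl)).symm
  let δ : T →* ℂˣ := MonoidHom.toHomUnits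
    { toFun := fun t => isoDet ρ θ (t : G)
      map_one' := isoDet_one ρ
      map_mul' := fun s t => isoDet_mul ρ s t t.2 }
  have hδ : ∀ t, (δ t : ℂ) = isoDet ρ θ (t : G) := fun t => rfl
  have hδk : ∀ t, (δ t ^ l) ^ p ^ k = 1 := fun t => by
    rw [← pow_mul, mul_comm, ← hcard, ← map_pow, pow_card_eq_one', map_one]
  have hδN : ∀ t : T, (t : G) ∈ N → δ t ^ l = 1 := fun t ht =>
    hN.hom_eq_one ((δ ^ l).comp (Subgroup.inclusion hNT)) k
      (fun n => hδk (Subgroup.inclusion hNT n)) ⟨t, ht⟩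
  obtain ⟨u, hu⟩ : ∃ u : ℕ, m * l * u ≡ 1 [MOD p ^ k] :=
    Nat.Coprime.exists_mul_modEq_one hcop
  have hpow : ∀ t, (δ t ^ l) ^ (m * l * u) = δ t ^ l := fun t => by
    rw [pow_eq_pow_of_modEq hu (hδk t), pow_one]
  let β₁ : T →* ℂˣ := (δ ^ (l * u))⁻¹
  have hβ₁ : ∀ t, δ t ^ l * (β₁ t ^ m) ^ l = 1 := fun t => by
    rw [show β₁ t = (δ t ^ (l * u))⁻¹ from rfl, inv_pow, inv_pow, mul_inv_eq_one, ← hpow t,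
      ← pow_mul, ← pow_mul, ← pow_mul]
    congr 1
    ring
  have hβ₁N : ∀ t : T, (t : G) ∈ N → β₁ t = 1 := fun t ht => by
    rw [show β₁ t = (δ t ^ (l * u))⁻¹ from rfl, pow_mul, hδN t ht, one_pow, inv_one]
  obtain ⟨β₀, hβ₀N, t₀, ht₀⟩ := hN.exists_hom_ne_one hp hT
  have hβ₂N : ∀ t : T, (t : G) ∈ N → (β₁ * β₀) t = 1 := fun t ht => by
    rw [MonoidHom.mul_apply, hβ₁N t ht, hβ₀N t ht, one_mul]
  obtain ⟨κ₁, hκ₁, hκ₁θ⟩ := exists_isIrrCocycle β₁ hβ₁N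
  obtain ⟨κ₂, hκ₂, hκ₂θ⟩ := exists_isIrrCocycle (β₁ * β₀) hβ₂N
  have h1 : DetTrivial N l (ρ.twist hκ₁) := by
    refine ⟨θ, by rwa [res_twist], fun t ht => ?_⟩
    have := hβ₁ ⟨t, ht⟩
    rw [isoDet_twist, show isoDet ρ θ t = δ ⟨t, ht⟩ from rfl, hκ₁θ ⟨t, ht⟩, mul_pow]
    exact congrArg Units.val this
  have hdeg : ∀ {κ : G → Irr N → ℂ} (hκ : IsIrrCocycle κ), (ρ.twist hκ).character 1 = n :=
    fun hκ => by rw [char_one, Module.finrank_fin_fun]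
  have hn1 : (n : ℂ) ≠ 1 := by exact_mod_cast hn
  have h2 : DetTrivial N l (ρ.twist hκ₂) :=
    h1.of_character_eq (hρ.twist hκ₁) (hρ.twist hκ₂)
      (hG _ _ (hρ.twist hκ₁).isIrrChar (hρ.twist hκ₂).isIrrChar (by rwa [hdeg]) (by rwa [hdeg])
        (by rw [hdeg, hdeg]))
  obtain ⟨ψ, hψ, hψd⟩ := h2
  obtain ⟨g, rfl⟩ := (hρ.twist hκ₂).exists_smul_eq (by rwa [res_twist]) hψ
  have h3 := hψd (g * t₀ * g⁻¹) (by
    rw [mul_smul, inv_smul_smul, mul_smul, show (t₀ : G) • θ = θ from t₀.2])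
  rw [isoDet_smul, isoDet_twist, ← hδ, hκ₂θ, ← hmdef, MonoidHom.mul_apply] at h3
  have h4 : (δ t₀ * (β₁ t₀ * β₀ t₀) ^ m) ^ l = 1 := Units.ext h3
  rw [mul_pow, mul_pow, mul_pow, ← mul_assoc, hβ₁, one_mul, ← pow_mul] at h4
  obtain ⟨j, hj⟩ := hN.pow_mem (t₀ : G)
  have h5 : β₀ t₀ ^ p ^ j = 1 := by rw [← map_pow]; exact hβ₀N _ hj
  have hcop' : (m * l).Coprime (p ^ j) :=
    (Nat.Coprime.pow_left j ((Nat.Prime.coprime_iff_not_dvd hp).2 fun h =>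
      (hp.dvd_mul.1 h).elim hm hl)).symm
  exact ht₀ (eq_one_of_pow_eq_one_of_coprime hcop' h4 h5)

end Twist

section Extension
variable {G : Type*} [Group G] {N : Subgroup G} [N.Normal]
/-- A splitting over a normal subgroup extends when the kernel has order prime to `p`
and the quotient is a `p`-group. -/
theorem exists_section_extending {N : Subgroup G} {Γ : Type*} [Group Γ] [Finite Γ] {p : ℕ}
    (hp : p.Prime)
    (hG : ∀ g : G, ∃ k, g ^ p ^ k ∈ N) (f : Γ →* G) (hf : Function.Surjective f) (j : N →* Γ)
    [j.range.Normal] (hj : ∀ n, f (j n) = n) {m : ℕ} (hm : ¬ p ∣ m)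
    (hker : ∀ x, f x = 1 → x ^ m = 1) :
    ∃ s : G →* Γ, (∀ g, f (s g) = g) ∧ ∀ n : N, s n = j n := by
  have := Fact.mk hp
  let q := QuotientGroup.mk' j.range
  have hqj : ∀ n, q (j n) = 1 := fun n => (QuotientGroup.eq_one_iff _).2 ⟨_, rfl⟩
  let Z : Subgroup (Γ ⧸ j.range) := f.ker.map q
  have hZn : Z.Normal := Subgroup.Normal.map inferInstance q (QuotientGroup.mk'_surjective _)
  have hZp : ¬ p ∣ Nat.card Z := fun h => by
    obtain ⟨z, hz⟩ := exists_prime_orderOf_dvd_card' p h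
    obtain ⟨x, hx, hxz⟩ := z.2
    have hz1 : z ^ m = 1 := Subtype.ext (by
      rw [Subgroup.coe_pow, ← hxz, ← map_pow, hker x hx, map_one]; rfl)
    have := orderOf_dvd_of_pow_eq_one hz1
    rw [hz] at this
    exact hm this
  have hQ : IsPGroup p ((Γ ⧸ j.range) ⧸ Z) := fun y => by
    obtain ⟨y, rfl⟩ := QuotientGroup.mk'_surjective _ y
    obtain ⟨x, rfl⟩ := QuotientGroup.mk'_surjective _ y
    obtain ⟨a, ha⟩ := hG (f x)
    refine ⟨a, ?_⟩
    rw [← map_pow, ← map_pow]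
    refine (QuotientGroup.eq_one_iff _).2 ⟨(j ⟨_, ha⟩)⁻¹ * x ^ p ^ a, ?_, ?_⟩
    · change f _ = 1
      rw [map_mul, map_inv, hj, map_pow, inv_mul_cancel]
    · rw [map_mul, map_inv, hqj, inv_one, one_mul]
  obtain ⟨b, hb⟩ := IsPGroup.iff_card.1 hQ
  obtain ⟨H, hH⟩ := Subgroup.exists_left_complement'_of_coprime (N := Z) (by
    rw [Subgroup.index, hb]
    exact ((Nat.Prime.coprime_iff_not_dvd hp).2 hZp).symm.pow_right b)
  let K := H.comap q
  have hjK : ∀ n, j n ∈ K := fun n => by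
    change q (j n) ∈ H
    rw [hqj]
    exact H.one_mem
  have hF : Function.Bijective (f.comp K.subtype) := by
    constructor
    · rw [injective_iff_map_eq_one]
      intro x hx
      have h1 : q x.1 ∈ H ⊓ Z := ⟨x.2, x.1, hx, rfl⟩
      rw [hH.disjoint.eq_bot, Subgroup.mem_bot] at h1
      obtain ⟨n, hn⟩ := (QuotientGroup.eq_one_iff _).1 h1
      have h2 : (n : G) = 1 := by
        rw [← hj, hn]; exact hx
      obtain rfl : n = 1 := Subtype.ext h2
      rw [map_one] at hn
      exact Subtype.ext hn.symm
    · intro g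
      obtain ⟨y, rfl⟩ := hf g
      have : q y ∈ H ⊔ Z := by rw [hH.sup_eq_top]; exact Subgroup.mem_top _
      obtain ⟨h, hh, z, hz, hhz⟩ := Subgroup.mem_sup_of_normal_right.1 this
      obtain ⟨x, hx, rfl⟩ := Subgroup.mem_map.1 hz
      refine ⟨⟨y * x⁻¹, ?_⟩, ?_⟩
      · change q _ ∈ H
        rw [map_mul, ← hhz, map_inv, mul_inv_cancel_right]
        exact hh
      · change f (y * x⁻¹) = _
        rw [map_mul, map_inv, show f x = 1 from hx, inv_one, mul_one]
  let E := MulEquiv.ofBijective _ hF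
  have hE : ∀ x : K, E x = f x := fun x => rfl
  refine ⟨K.subtype.comp E.symm.toMonoidHom, fun g => ?_, fun n => ?_⟩
  · change f (E.symm g) = g
    rw [← hE, E.apply_symm_apply]
  · change (E.symm n : Γ) = j n
    have : E ⟨j n, hjK n⟩ = n := hj n
    rw [← this, E.symm_apply_apply]

variable {V : Type*} [AddCommGroup V] [Module ℂ V]

/-- Pairs `(g, X)` where `X` intertwines `ρ` with its conjugate by `g` and has determinant of
order dividing `l`. -/
def intertwinerGroup (ρ : Representation ℂ N V) (l : ℕ) : Subgroup (G × (Module.End ℂ V)ˣ) where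
  carrier := {x | (∀ n : N, (x.2 : Module.End ℂ V) * ρ n = ρ (MulAut.conjNormal x.1 n) * x.2) ∧
    LinearMap.det (x.2 : Module.End ℂ V) ^ l = 1}
  one_mem' := ⟨fun n => by simp, by simp⟩
  mul_mem' := by
    rintro ⟨g, X⟩ ⟨h, Y⟩ ⟨h1, h2⟩ ⟨h3, h4⟩
    refine ⟨fun n => ?_, ?_⟩
    · change (X * Y : Module.End ℂ V) * ρ n = ρ (MulAut.conjNormal (g * h) n) * (X * Y)
      rw [mul_assoc, h3, ← mul_assoc, h1, map_mul, mul_assoc]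
      rfl
    · change LinearMap.det (X * Y : Module.End ℂ V) ^ l = 1
      rw [map_mul, mul_pow, h2, h4, one_mul]
  inv_mem' := by
    rintro ⟨g, X⟩ ⟨h1, h2⟩
    refine ⟨fun n => ?_, ?_⟩
    · change (↑X⁻¹ : Module.End ℂ V) * ρ n = ρ (MulAut.conjNormal g⁻¹ n) * ↑X⁻¹
      have := h1 (MulAut.conjNormal g⁻¹ n)
      rw [← MulAut.mul_apply, ← map_mul, mul_inv_cancel, map_one, MulAut.one_apply] at this
      rw [Units.inv_mul_eq_iff_eq_mul, ← mul_assoc, this, mul_assoc, Units.mul_inv, mul_one]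
    · change LinearMap.det (↑X⁻¹ : Module.End ℂ V) ^ l = 1
      have h3 : LinearMap.det (↑X⁻¹ : Module.End ℂ V) * LinearMap.det (X : Module.End ℂ V) = 1 := by
        rw [← map_mul, Units.inv_mul, map_one]
      have h4 := congrArg (· ^ l) h3
      simp only [mul_pow, one_pow] at h4
      change LinearMap.det (X : Module.End ℂ V) ^ l = 1 at h2
      rwa [h2, mul_one] at h4

variable [FiniteDimensional ℂ V]

theorem exists_mem_intertwinerGroup [Fintype N] {ρ : Representation ℂ N V} (hρ : ρ.IsIrreducible)
    (g : G) (hg : ∀ n, ρ.character (MulAut.conjNormal g n) = ρ.character n) (l : ℕ) :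
    ∃ X, (g, X) ∈ intertwinerGroup ρ l := by
  let τ : Representation ℂ N V := ρ.comp (MulAut.conjNormal g : N ≃* N).toMonoidHom
  have hτ : τ.IsIrreducible := by
    rw [isIrreducible_iff_submodule] at hρ ⊢
    refine ⟨hρ.1, fun U hU => hρ.2 U fun n u hu => ?_⟩
    have := hU ((MulAut.conjNormal g : N ≃* N).symm n) u hu
    change ρ (MulAut.conjNormal g ((MulAut.conjNormal g : N ≃* N).symm n)) u ∈ U at this
    rwa [MulEquiv.apply_symm_apply] at this
  obtain ⟨e, he⟩ := exists_equiv_of_character_eq hρ hτ (funext fun n => (hg n).symm)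
  have hV := ((isIrreducible_iff_submodule ρ).1 hρ).1
  have hdet : LinearMap.det (e : V →ₗ[ℂ] V) ≠ 0 := e.isUnit_det'.ne_zero
  obtain ⟨c, hc⟩ := IsAlgClosed.exists_pow_nat_eq (LinearMap.det (e : V →ₗ[ℂ] V))⁻¹
    (Module.finrank_pos (R := ℂ) (M := V))
  have hc0 : c ≠ 0 := fun h => by
    rw [h, zero_pow Module.finrank_pos.ne'] at hc
    exact inv_ne_zero hdet hc.symm
  let X : (Module.End ℂ V)ˣ := ⟨c • (e : V →ₗ[ℂ] V), c⁻¹ • (e.symm : V →ₗ[ℂ] V), by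
    ext v; simp [hc0], by ext v; simp [hc0]⟩
  refine ⟨X, fun n => ?_, ?_⟩
  · ext v
    change c • e (ρ n v) = ρ (MulAut.conjNormal g n) (c • e v)
    rw [he, map_smul]
    rfl
  · change LinearMap.det (c • (e : V →ₗ[ℂ] V)) ^ l = 1
    rw [LinearMap.det_smul, hc, inv_mul_cancel₀ hdet, one_pow]

theorem pow_eq_one_of_mem_intertwinerGroup {ρ : Representation ℂ N V} (hρ : ρ.IsIrreducible)
    {l : ℕ} {X : (Module.End ℂ V)ˣ} (h : ((1 : G), X) ∈ intertwinerGroup ρ l) :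
    ∃ c : ℂ, (X : Module.End ℂ V) = c • 1 ∧ c ^ (Module.finrank ℂ V * l) = 1 := by
  obtain ⟨c, hc⟩ := hρ.eq_smul_one (A := (X : Module.End ℂ V)) fun n => by
    have := h.1 n
    change (X : Module.End ℂ V) * ρ n = ρ (MulAut.conjNormal (1 : G) n) * X at this
    rwa [map_one] at this
  refine ⟨c, hc, ?_⟩
  have := h.2
  change LinearMap.det (X : Module.End ℂ V) ^ l = 1 at this
  rwa [hc, LinearMap.det_smul, map_one, mul_one, ← pow_mul] at this

theorem finite_intertwinerGroup [Finite G] {ρ : Representation ℂ N V} (hρ : ρ.IsIrreducible)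
    {l : ℕ} (hl : l ≠ 0) : Finite (intertwinerGroup (G := G) ρ l) := by
  have hV := ((isIrreducible_iff_submodule ρ).1 hρ).1
  have hne : Module.finrank ℂ V * l ≠ 0 := mul_ne_zero Module.finrank_pos.ne' hl
  let f : intertwinerGroup (G := G) ρ l →* G := (MonoidHom.fst _ _).comp (Subgroup.subtype _)
  have hk : Finite f.ker := by
    have hfin : {c : ℂ | c ^ (Module.finrank ℂ V * l) = 1}.Finite := by
      have : NeZero (Module.finrank ℂ V * l) := ⟨hne⟩
      refine (Set.finite_range fun z : rootsOfUnity (Module.finrank ℂ V * l) ℂ =>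
        ((z : ℂˣ) : ℂ)).subset fun c hc => ?_
      exact ⟨rootsOfUnity.mkOfPowEq c hc, rfl⟩
    have hker : ∀ x : f.ker, ∃ c : ℂ, (x.1.1.2 : Module.End ℂ V) = c • 1 ∧
        c ^ (Module.finrank ℂ V * l) = 1 := fun x => by
      have h1 : x.1.1.1 = 1 := x.2
      refine pow_eq_one_of_mem_intertwinerGroup (G := G) hρ (l := l) ?_
      rw [← h1]
      exact x.1.2
    choose c hc hc1 using hker
    have := hfin.to_subtype
    refine Finite.of_injective (fun x : f.ker => (⟨c x, hc1 x⟩ :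
      {c : ℂ | c ^ (Module.finrank ℂ V * l) = 1})) fun x y h => ?_
    have h1 : c x = c y := congrArg Subtype.val h
    refine Subtype.ext (Subtype.ext (Prod.ext ?_ (Units.ext ?_)))
    · exact (show x.1.1.1 = 1 from x.2).trans (show y.1.1.1 = 1 from y.2).symm
    · rw [hc, hc, h1]
  have hq : Finite (intertwinerGroup (G := G) ρ l ⧸ f.ker) :=
    Finite.of_injective _ (QuotientGroup.kerLift_injective f)
  exact Finite.of_subgroup_quotient f.ker

theorem exists_extension [Fintype G] [Fintype N] {p : ℕ} (hp : p.Prime) (hN : IsPResidual p N)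
    {ρ : Representation ℂ N V} (hρ : ρ.IsIrreducible) (hdim : ¬ p ∣ Module.finrank ℂ V)
    (hinv : ∀ (g : G) n, ρ.character (MulAut.conjNormal g n) = ρ.character n) :
    ∃ τ : Representation ℂ G V, τ.res N = ρ := by
  have hV := ((isIrreducible_iff_submodule ρ).1 hρ).1
  obtain ⟨k, l, hl, hcard⟩ := Nat.exists_eq_pow_mul_and_not_dvd (Nat.card_pos (α := N)).ne' p
    hp.ne_one
  have hl0 : l ≠ 0 := fun h => hl (h ▸ dvd_zero p)
  have hdet : ∀ n, LinearMap.det (ρ n) ^ l = 1 := fun n => by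
    let δ : N →* ℂˣ := MonoidHom.toHomUnits ((LinearMap.det : Module.End ℂ V →* ℂ).comp ρ)
    have := hN.hom_eq_one (δ ^ l) k (fun n => by
      rw [MonoidHom.pow_apply, ← pow_mul, mul_comm, ← hcard, ← map_pow, pow_card_eq_one',
        map_one]) n
    exact congrArg Units.val this
  let Γ := intertwinerGroup (G := G) ρ l
  have hfin : Finite Γ := finite_intertwinerGroup hρ hl0
  let f : Γ →* G := (MonoidHom.fst _ _).comp Γ.subtype
  let u : N →* (Module.End ℂ V)ˣ := MonoidHom.toHomUnits ρ
  let j : N →* Γ := (N.subtype.prod u).codRestrict Γ fun n => ⟨fun m => by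
      change ρ n * ρ m = ρ (MulAut.conjNormal (n : G) m) * ρ n
      rw [← map_mul, ← map_mul]
      congr 1
      exact Subtype.ext (by simp), hdet n⟩
  have hj1 : ∀ n, (j n).1.1 = n := fun n => rfl
  have hj2 : ∀ n, ((j n).1.2 : Module.End ℂ V) = ρ n := fun n => rfl
  have hjn : j.range.Normal := ⟨by
    rintro _ ⟨n, rfl⟩ x
    refine ⟨MulAut.conjNormal x.1.1 n, Subtype.ext (Prod.ext ?_ (Units.ext ?_))⟩
    · rw [hj1]; rfl
    · rw [hj2]
      change _ = (x.1.2 : Module.End ℂ V) * ρ n * ↑x.1.2⁻¹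
      rw [x.2.1 n, mul_assoc, Units.mul_inv, mul_one]⟩
  obtain ⟨s, hs, hsj⟩ := exists_section_extending hp hN.pow_mem f (fun g => by
      obtain ⟨X, hX⟩ := exists_mem_intertwinerGroup hρ g (hinv g) l
      exact ⟨⟨(g, X), hX⟩, rfl⟩) j hj1 (m := Module.finrank ℂ V * l)
    (fun h => (hp.dvd_mul.1 h).elim hdim hl) (fun x hx => by
      obtain ⟨c, hc, hc1⟩ := pow_eq_one_of_mem_intertwinerGroup (G := G) hρ (l := l)
        (X := x.1.2) (by
          have : x.1.1 = 1 := hx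
          rw [← this]
          exact x.2)
      refine Subtype.ext (Prod.ext ?_ (Units.ext ?_))
      · change x.1.1 ^ _ = 1
        rw [show x.1.1 = 1 from hx, one_pow]
      · change (x.1.2 : Module.End ℂ V) ^ _ = 1
        rw [hc, smul_pow, hc1, one_pow, one_smul])
  let π : Γ →* Module.End ℂ V := (Units.coeHom _).comp ((MonoidHom.snd _ _).comp Γ.subtype)
  refine ⟨π.comp s, ?_⟩
  ext1 n
  change π (s (n : G)) = ρ n
  rw [hsj]
  rfl

end Extension

section Weighted
variable {p : ℕ} {Q X : Type*} [Group Q] [MulAction Q X] [Fintype X]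

theorem card_subtype_lt {X : Type*} [Fintype X] (w : X → ℕ) :
    Nat.card {y : X × ℕ // y.2 < w y.1} = ∑ x, w x := by
  rw [Nat.card_congr (Equiv.subtypeProdEquivSigmaSubtype fun x n => n < w x), Nat.card_sigma]
  refine Finset.sum_congr rfl fun x _ => ?_
  exact (Nat.card_congr Fin.equivSubtype.symm).trans (Nat.card_fin _)

open Classical in
theorem IsPGroup.sum_modEq (hp : p.Prime) (hQ : IsPGroup p Q) (w : X → ℕ)
    (hw : ∀ (g : Q) x, w (g • x) = w x) :
    ∑ x, w x ≡ ∑ x, (if ∀ g : Q, g • x = x then w x else 0) [MOD p] := by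
  have := Fact.mk hp
  rw [← card_subtype_lt, ← card_subtype_lt]
  let inst : MulAction Q {y : X × ℕ // y.2 < w y.1} :=
    { smul := fun g y => ⟨(g • y.1.1, y.1.2), by
        change y.1.2 < w (g • y.1.1)
        rw [hw]; exact y.2⟩
      one_smul := fun y => Subtype.ext (Prod.ext (one_smul Q y.1.1) rfl)
      mul_smul := fun g h y => Subtype.ext (Prod.ext (mul_smul g h y.1.1) rfl) }
  have hfin : ∀ w : X → ℕ, Finite {y : X × ℕ // y.2 < w y.1} := fun w =>
    Finite.of_equiv _ (Equiv.subtypeProdEquivSigmaSubtype fun x n => n < w x).symm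
  have := hfin w
  have h := hQ.card_modEq_card_fixedPoints {y : X × ℕ // y.2 < w y.1}
  have hc : Nat.card (MulAction.fixedPoints Q {y : X × ℕ // y.2 < w y.1}) =
      Nat.card {y : X × ℕ // y.2 < if ∀ g : Q, g • y.1 = y.1 then w y.1 else 0} := by
    refine Nat.card_congr
      { toFun := fun y => ⟨y.1.1, ?_⟩
        invFun := fun y => ⟨⟨y.1, ?_⟩, ?_⟩
        left_inv := fun _ => rfl
        right_inv := fun _ => rfl }
    · have hy : ∀ g : Q, g • y.1.1.1 = y.1.1.1 := fun g =>
        congrArg (fun z : {y : X × ℕ // y.2 < w y.1} => z.1.1) (y.2 g)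
      rw [if_pos hy]
      exact y.1.2
    · have := y.2
      split_ifs at this
      · exact this
      · exact absurd this (Nat.not_lt_zero _)
    · have := y.2
      split_ifs at this with hy
      · exact fun g => Subtype.ext (Prod.ext (hy g) rfl)
      · exact absurd this (Nat.not_lt_zero _)
  rwa [hc] at h

end Weighted

section Linear
variable {H : Type*} [Group H]

theorem isIrrChar_of_hom (f : H →* ℂˣ) : IsIrrChar fun h => (f h : ℂ) := by
  let ρ : Representation ℂ H ℂ :=
    ((algebraMap ℂ (Module.End ℂ ℂ) : ℂ →* Module.End ℂ ℂ).comp (Units.coeHom ℂ)).comp f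
  have hρ : ρ.IsIrreducible := by
    rw [isIrreducible_iff_submodule]
    exact ⟨inferInstance, fun U _ => eq_bot_or_eq_top U⟩
  have := hρ.isIrrChar
  convert this using 1
  funext h
  change _ = LinearMap.trace ℂ ℂ (algebraMap ℂ (Module.End ℂ ℂ) (f h))
  rw [Algebra.algebraMap_eq_smul_one, map_smul, LinearMap.trace_one]
  simp

theorem trace_eq_det_of_eq_one {d : ℕ} (hd : d = 1) (A : Module.End ℂ (Fin d → ℂ)) :
    LinearMap.trace ℂ _ A = LinearMap.det A := by
  subst hd
  rw [LinearMap.trace_eq_matrix_trace ℂ (Pi.basisFun ℂ (Fin 1)),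
    ← LinearMap.det_toMatrix (Pi.basisFun ℂ (Fin 1)), Matrix.trace_fin_one, Matrix.det_fin_one]

theorem Irr.exists_hom {θ : Irr H} (h : θ.degree = 1) : ∃ f : H →* ℂˣ, ∀ x, θ.1 x = f x := by
  obtain ⟨ρ, -, hθ⟩ := θ.exists_rep
  refine ⟨MonoidHom.toHomUnits (LinearMap.det.comp ρ), fun x => ?_⟩
  rw [hθ]
  exact trace_eq_det_of_eq_one h (ρ x)

end Linear

section Complement
variable {G : Type*} [Group G] {N : Subgroup G} [N.Normal]

/-- The `G`-invariant linear characters of a normal subgroup. -/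
def invHom (N : Subgroup G) [N.Normal] : Subgroup (N →* ℂˣ) where
  carrier := {f | ∀ (g : G) n, f (MulAut.conjNormal g n) = f n}
  one_mem' := fun _ _ => rfl
  mul_mem' := fun {a b} ha hb g n => by
    rw [MonoidHom.mul_apply, MonoidHom.mul_apply, ha, hb]
  inv_mem' := fun {a} ha g n => by
    rw [MonoidHom.inv_apply, MonoidHom.inv_apply, ha]

theorem IsPResidual.not_dvd_card_invHom [Finite N] {p : ℕ} (hp : p.Prime) (hN : IsPResidual p N) :
    ¬ p ∣ Nat.card (invHom N) := fun h => by
  have := Fact.mk hp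
  obtain ⟨f, hf⟩ := exists_prime_orderOf_dvd_card' p h
  have h1 : f ^ p = 1 := hf ▸ pow_orderOf_eq_one f
  have h2 : f = 1 := Subtype.ext (MonoidHom.ext fun n => hN.hom_eq_one f.1 1 (fun n => by
    rw [pow_one]
    exact DFunLike.congr_fun (congrArg Subtype.val h1) n) n)
  rw [h2, orderOf_one] at hf
  exact hp.ne_one hf.symm

theorem card_invariant_linear [Fintype N] :
    Nat.card {θ : Irr N // (∀ g : G, g • θ = θ) ∧ θ.degree = 1} = Nat.card (invHom N) := by
  symm
  refine Nat.card_congr (Equiv.ofBijective (fun f => ⟨⟨fun n => (f.1 n : ℂ), isIrrChar_of_hom f.1⟩,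
    fun g => Subtype.ext (funext fun n => ?_), ?_⟩) ⟨fun f f' h => ?_, fun θ => ?_⟩)
  · rw [Irr.smul_apply]
    change (f.1 (MulAut.conjNormal g⁻¹ n) : ℂ) = _
    rw [f.2]
  · have := Irr.apply_one (⟨fun n => (f.1 n : ℂ), isIrrChar_of_hom f.1⟩ : Irr N)
    simp only [map_one, Units.val_one] at this
    exact_mod_cast this.symm
  · refine Subtype.ext (MonoidHom.ext fun n => Units.ext ?_)
    exact congrFun (congrArg Subtype.val (congrArg Subtype.val h)) n
  · obtain ⟨θ, h1, h2⟩ := θ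
    obtain ⟨f, hf⟩ := Irr.exists_hom h2
    refine ⟨⟨f, fun g n => Units.ext ?_⟩, Subtype.ext (Subtype.ext (funext fun n => (hf n).symm))⟩
    have := congrFun (congrArg Subtype.val (h1 g⁻¹)) n
    rw [Irr.smul_apply, inv_inv, hf, hf] at this
    exact this

theorem IsGCStar.degree_eq_one [Fintype G] [Fintype N] {p : ℕ} (hp : p.Prime)
    (hG : IsGCStar G) (hN : IsPResidual p N) (hNG : N ≠ ⊤) {θ : Irr N} (hθ : ∀ g : G, g • θ = θ)
    (hd : ¬ p ∣ θ.degree) : θ.degree = 1 := by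
  obtain ⟨ρ, hρ, hχ⟩ := θ.exists_rep
  obtain ⟨τ, hτ⟩ := exists_extension (G := G) hp hN hρ (by rwa [Module.finrank_fin_fun])
    fun g n => by
      have := congrFun (congrArg Subtype.val (hθ g⁻¹)) n
      rwa [Irr.smul_apply, inv_inv, hχ] at this
  have hτi : τ.IsIrreducible := by
    rw [isIrreducible_iff_submodule] at hρ ⊢
    refine ⟨hρ.1, fun U hU => hρ.2 U fun n u hu => ?_⟩
    rw [← hτ]
    exact hU n u hu
  refine hG.finrank_eq_one hp hN hτi (θ := θ) ?_ fun h => hNG ?_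
  · rw [hτ, irrProj_of_isIrreducible θ.2 hρ, if_pos hχ,
      LinearMap.range_eq_top.2 (fun x => ⟨x, rfl⟩), finrank_top, Module.finrank_fin_fun]
    exact hd
  · exact eq_top_iff.2 fun g _ => h (hθ g)

open Classical in
theorem IsGCStar.not_dvd_card [Fintype G] [Fintype N] {p : ℕ} (hp : p.Prime)
    (hG : IsGCStar G) (hN : IsPResidual p N) (hNG : N ≠ ⊤) : ¬ p ∣ Fintype.card N := by
  let Q := (MulAction.toPermHom G (Irr N)).range
  have hQ : IsPGroup p Q := by
    rintro ⟨_, g, rfl⟩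
    obtain ⟨k, hk⟩ := hN.pow_mem g
    refine ⟨k, Subtype.ext ?_⟩
    change MulAction.toPermHom G (Irr N) g ^ p ^ k = 1
    rw [← map_pow]
    exact Equiv.ext fun θ => Irr.smul_of_mem hk θ
  have hfix : ∀ θ : Irr N, (∀ g : Q, g • θ = θ) ↔ ∀ g : G, g • θ = θ := fun θ =>
    ⟨fun h g => h ⟨_, g, rfl⟩, by rintro h ⟨_, g, rfl⟩; exact h g⟩
  have h1 := hQ.sum_modEq hp (fun θ : Irr N => θ.degree ^ 2) (by
    rintro ⟨_, g, rfl⟩ θ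
    exact congrArg (· ^ 2) (Irr.degree_smul g θ))
  replace h1 : Fintype.card N ≡
      ∑ θ : Irr N, (if ∀ g : Q, g • θ = θ then θ.degree ^ 2 else 0) [MOD p] := by
    rw [sum_degree_sq] at h1
    convert h1
  have h2 : ∑ θ : Irr N, (if ∀ g : Q, g • θ = θ then θ.degree ^ 2 else 0) ≡
      ∑ θ : Irr N, (if (∀ g : G, g • θ = θ) ∧ θ.degree = 1 then 1 else 0) [MOD p] := by
    refine Nat.ModEq.sum fun θ _ => ?_
    simp only [hfix]
    by_cases hθ : ∀ g : G, g • θ = θ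
    · by_cases hd : p ∣ θ.degree
      · rw [if_pos hθ, if_neg fun h : (∀ g : G, g • θ = θ) ∧ θ.degree = 1 =>
          hp.ne_one (Nat.dvd_one.1 (h.2 ▸ hd))]
        exact (Nat.modEq_zero_iff_dvd).2 (dvd_pow hd two_ne_zero)
      · have := hG.degree_eq_one hp hN hNG hθ hd
        rw [if_pos hθ, if_pos ⟨hθ, this⟩, this, one_pow]
    · rw [if_neg hθ, if_neg fun h => hθ h.1]
  rw [Finset.sum_boole, Nat.cast_id, ← Fintype.card_subtype, ← Nat.card_eq_fintype_card,
    card_invariant_linear] at h2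
  rw [(h1.trans h2).dvd_iff dvd_rfl]
  exact hN.not_dvd_card_invHom hp

end Complement

section Regular
variable {G : Type*} [Group G] {N : Subgroup G} [N.Normal]

/-- If the rank of the `θ`-projection is prime to `p` on a representation, then it is prime to `p`
on some irreducible constituent. -/
theorem exists_irreducible_not_dvd {N : Subgroup G} [Fintype G] [Fintype N] {V : Type*}
    [AddCommGroup V]
    [Module ℂ V] [FiniteDimensional ℂ V] (ρ : Representation ℂ G V) (θ : Irr N) {p : ℕ}
    (hm : ¬ p ∣ Module.finrank ℂ (LinearMap.range (irrProj θ.1 (ρ.res N)))) :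
    ∃ (n : ℕ) (τ : Representation ℂ G (Fin n → ℂ)), τ.IsIrreducible ∧
      ¬ p ∣ Module.finrank ℂ (LinearMap.range (irrProj θ.1 (τ.res N))) := by
  by_contra! hcon
  refine hm ?_
  rw [← Submodule.map_top]
  refine Subrepresentation.induction (ρ := ρ)
    (Q := fun U => p ∣ Module.finrank ℂ (U.toSubmodule.map (irrProj θ.1 (ρ.res N)))) ?_ ?_ ?_ ⊤
  · have : p ∣ Module.finrank ℂ ((⊥ : Submodule ℂ V).map (irrProj θ.1 (ρ.res N))) := by
      rw [Submodule.map_bot, finrank_bot]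
      exact dvd_zero p
    exact this
  · intro U hU
    let e := (Module.finBasis ℂ U.toSubmodule).equivFun
    let τ : Representation ℂ G (Fin (Module.finrank ℂ U.toSubmodule) → ℂ) :=
      (e.conjRingEquiv : Module.End ℂ U.toSubmodule →* _).comp U.toRepresentation
    have he : ∀ g v, e (U.toRepresentation g v) = τ g (e v) := fun g v => by
      change _ = e (U.toRepresentation g (e.symm (e v)))
      rw [e.symm_apply_apply]
    have h1 := hcon _ τ (hU.transport e he)
    rw [irrProj_equiv (ρ := U.toRepresentation.res N) (τ := τ.res N) e (fun g v =>
        he g v) θ.1] at h1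
    have h2 : LinearMap.range (e.conj (irrProj θ.1 (U.toRepresentation.res N))) =
        (LinearMap.range (irrProj θ.1 (U.toRepresentation.res N))).map e.toLinearMap := by
      rw [LinearEquiv.conj_apply, LinearMap.range_comp, LinearEquiv.range, Submodule.map_top,
        LinearMap.range_comp]
    rw [h2, LinearEquiv.finrank_map_eq] at h1
    have h3 : U.toSubmodule.map (irrProj θ.1 (ρ.res N)) =
        (LinearMap.range (irrProj θ.1 (U.toRepresentation.res N))).map U.toSubmodule.subtype := by
      ext v
      simp only [Submodule.mem_map, LinearMap.mem_range, Submodule.subtype_apply]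
      have h4 : ∀ u : U.toSubmodule, (irrProj θ.1 (U.toRepresentation.res N) u : V) =
          irrProj θ.1 (ρ.res N) u := fun u => by
        simp only [irrProj, LinearMap.smul_apply, LinearMap.sum_apply, Submodule.coe_smul,
          Submodule.coe_sum]
        rfl
      constructor
      · rintro ⟨u, hu, rfl⟩
        exact ⟨_, ⟨⟨u, hu⟩, rfl⟩, h4 _⟩
      · rintro ⟨_, ⟨u, rfl⟩, rfl⟩
        exact ⟨u, u.2, (h4 u).symm⟩
    rw [h3, Submodule.finrank_map_subtype_eq]
    exact h1
  · intro U W hUW hU hW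
    have hle : ∀ U : Subrepresentation ρ,
        U.toSubmodule.map (irrProj θ.1 (ρ.res N)) ≤ U.toSubmodule := fun U =>
      Submodule.map_le_iff_le_comap.2 fun u hu =>
        irrProj_mem (ρ := ρ.res N) θ.1 (fun g u hu => U.apply_mem_toSubmodule g hu) hu
    have h := Submodule.finrank_sup_add_finrank_inf_eq
      (U.toSubmodule.map (irrProj θ.1 (ρ.res N))) (W.toSubmodule.map (irrProj θ.1 (ρ.res N)))
    rw [(hUW.mono (hle U) (hle W)).eq_bot, finrank_bot, add_zero] at h
    rw [← Submodule.map_sup] at h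
    have hs := dvd_add hU hW
    rw [← h] at hs
    exact hs

variable {X : Type*} [MulAction G X]

theorem finrank_range_irrProj_permRep {N : Subgroup G} [Fintype N] [Fintype X]
    (hfree : ∀ (n : N) (x : X), (n : G) • x = x → n = 1)
    (hcard : Fintype.card X = Fintype.card N) (θ : Irr N) :
    Module.finrank ℂ (LinearMap.range (irrProj θ.1 ((permRep G X).res N))) = θ.degree ^ 2 := by
  classical
  have h := finrank_range_irrProj ((permRep G X).res N) θ
  have h1 : ∀ n : N, ((permRep G X).res N).character n =
      if n = 1 then (Fintype.card N : ℂ) else 0 :=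
    fun n => by
      change (permRep G X).character n = _
      rw [character_permRep]
      split_ifs with hn
      · subst hn
        rw [← hcard, ← Nat.card_eq_fintype_card]
        exact congrArg Nat.cast (Nat.card_congr (Equiv.subtypeUnivEquiv fun x => one_smul G x))
      · have : IsEmpty {x : X // (n : G) • x = x} := ⟨fun x => hn (hfree n x.1 x.2)⟩
        rw [Nat.card_of_isEmpty, Nat.cast_zero]
  have h4 : (Fintype.card N : ℂ) ≠ 0 := Nat.cast_ne_zero.2 Fintype.card_ne_zero
  simp only [h1, mul_ite, mul_zero, Finset.sum_ite_eq', Finset.mem_univ, if_true, inv_one,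
    θ.apply_one] at h
  rw [← @Nat.cast_inj ℂ, h]
  push_cast
  field_simp

theorem IsGCStar.invariant_linear [Fintype G] [Fintype N] [Fintype X] {p : ℕ} (hp : p.Prime)
    (hG : IsGCStar G) (hN : IsPResidual p N) (hpN : ¬ p ∣ Fintype.card N)
    (hfree : ∀ (n : N) (x : X), (n : G) • x = x → n = 1)
    (hcard : Fintype.card X = Fintype.card N) {θ : Irr N}
    (hT : ¬ MulAction.stabilizer G θ ≤ N) : (∀ g : G, g • θ = θ) ∧ θ.degree = 1 := by
  obtain ⟨n, τ, hτ, hm⟩ := exists_irreducible_not_dvd (permRep G X) θ (p := p) (by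
    rw [finrank_range_irrProj_permRep hfree hcard]
    exact fun h => hpN ((hp.dvd_of_dvd_pow h).trans θ.degree_dvd_card))
  obtain rfl := hG.finrank_eq_one hp hN hτ hm hT
  have hsub : (τ.res N).IsIrreducible := by
    rw [isIrreducible_iff_submodule]
    refine ⟨inferInstance, fun U _ => ?_⟩
    have : IsSimpleModule ℂ (Fin 1 → ℂ) := by
      rw [isSimpleModule_iff_finrank_eq_one, Module.finrank_fin_fun]
    exact eq_bot_or_eq_top U
  have hχ : θ.1 = (τ.res N).character := by
    by_contra h
    rw [irrProj_of_isIrreducible θ.2 hsub, if_neg h, LinearMap.range_zero, finrank_bot] at hm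
    exact hm (dvd_zero p)
  refine ⟨fun g => Subtype.ext (funext fun n => ?_), ?_⟩
  · rw [Irr.smul_apply, hχ]
    change τ.character (g⁻¹ * n * g⁻¹⁻¹) = τ.character n
    exact Representation.char_conj τ _ _
  · have := θ.apply_one
    rw [hχ, char_one, Module.finrank_fin_fun] at this
    exact_mod_cast this.symm

theorem sum_card_fixed {N : Subgroup G} [Fintype N] [Fintype X]
    (hfree : ∀ (n : N) (x : X), (n : G) • x = x → n = 1)
    (hcard : Fintype.card X = Fintype.card N) (g : G) :
    ∑ n : N, Nat.card {x : X // (g * n) • x = x} = Fintype.card N := by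
  classical
  have hbij : ∀ x : X, Function.Bijective fun n : N => (n : G) • x := fun x => by
    rw [Fintype.bijective_iff_injective_and_card]
    refine ⟨fun a b hab => ?_, hcard.symm⟩
    have := hfree (b⁻¹ * a) x (by
      rw [Subgroup.coe_mul, mul_smul, Subgroup.coe_inv, inv_smul_eq_iff]; exact hab)
    exact (inv_mul_eq_one.1 this).symm
  rw [← Nat.card_sigma, ← hcard, ← Nat.card_eq_fintype_card]
  refine Nat.card_congr (Equiv.ofBijective (fun y => y.2.1) ⟨?_, fun x => ?_⟩)
  · rintro ⟨n, x, hx⟩ ⟨n', x', hx'⟩ h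
    obtain rfl : x = x' := h
    have : n = n' := (hbij x).1 (by
      change (n : G) • x = (n' : G) • x
      rw [mul_smul] at hx hx'
      exact smul_left_cancel g (hx.trans hx'.symm))
    subst this
    rfl
  · obtain ⟨n, hn⟩ := (hbij x).2 (g⁻¹ • x)
    refine ⟨⟨n, x, ?_⟩, rfl⟩
    rw [mul_smul]
    exact (congrArg (g • ·) hn).trans (smul_inv_smul g x)

theorem norm_trace_le {N : Subgroup G} [Fintype N] [Fintype X]
    (hfree : ∀ (n : N) (x : X), (n : G) • x = x → n = 1)
    (hcard : Fintype.card X = Fintype.card N) {θ : Irr N} (hθ : θ.degree = 1) (g : G) :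
    ‖LinearMap.trace ℂ _ (permRep G X g * irrProj θ.1 ((permRep G X).res N))‖ ≤ 1 := by
  obtain ⟨f, hf⟩ := Irr.exists_hom hθ
  have hnorm : ∀ n, ‖θ.1 n‖ = 1 := fun n => by
    rw [hf]
    have : f n ^ Fintype.card N = 1 := by rw [← map_pow, pow_card_eq_one, map_one]
    exact Complex.norm_eq_one_of_pow_eq_one (n := Fintype.card N)
      (by rw [← Units.val_pow_eq_pow_val, this, Units.val_one]) Fintype.card_ne_zero
  have h1 : permRep G X g * irrProj θ.1 ((permRep G X).res N) =
      (θ.1 1 / Fintype.card N) • ∑ n : N, θ.1 n⁻¹ • permRep G X (g * n) := by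
    rw [irrProj, mul_smul_comm, Finset.mul_sum]
    congr 1
    refine Finset.sum_congr rfl fun n _ => ?_
    rw [mul_smul_comm, map_mul]
    rfl
  have h2 : ∀ n : N, LinearMap.trace ℂ _ (permRep G X (g * n)) =
      Nat.card {x : X // (g * n) • x = x} := fun n => character_permRep _
  rw [h1, map_smul, map_sum, norm_smul, norm_div, hnorm, Complex.norm_natCast]
  have h3 : ‖∑ n : N, LinearMap.trace ℂ _ (θ.1 n⁻¹ • permRep G X (g * n))‖ ≤ Fintype.card N := by
    refine (norm_sum_le _ _).trans (le_of_eq ?_)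
    rw [← sum_card_fixed hfree hcard g, Nat.cast_sum]
    refine Finset.sum_congr rfl fun n _ => ?_
    rw [map_smul, norm_smul, hnorm, one_mul, h2, Complex.norm_natCast]
  have h4 : (0 : ℝ) < Fintype.card N := Nat.cast_pos.2 Fintype.card_pos
  rw [one_div, inv_mul_le_iff₀ h4, mul_one]
  exact h3

theorem trace_mul_irrProj_eq_zero [Fintype N] {V : Type*} [AddCommGroup V] [Module ℂ V]
    [FiniteDimensional ℂ V] (ρ : Representation ℂ G V) {g : G} {θ : Irr N} (h : g • θ ≠ θ) :
    LinearMap.trace ℂ V (ρ g * irrProj θ.1 (ρ.res N)) = 0 := by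
  classical
  rw [← (irrProj_isIdempotent (ρ.res N) θ).eq, ← mul_assoc, LinearMap.trace_mul_comm,
    map_mul_irrProj, ← mul_assoc, irrProj_mul_irrProj, if_neg (Ne.symm h), zero_mul, map_zero]

/-- The number of fixed points of an element outside `N` is bounded by the number of invariant
linear characters of `N`. -/
theorem IsGCStar.card_fixed_le [Fintype G] [Fintype N] [Fintype X] {p : ℕ} (hp : p.Prime)
    (hG : IsGCStar G) (hN : IsPResidual p N) (hpN : ¬ p ∣ Fintype.card N)
    (hfree : ∀ (n : N) (x : X), (n : G) • x = x → n = 1)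
    (hcard : Fintype.card X = Fintype.card N) {g : G} (hg : g ∉ N) :
    Nat.card {x : X // g • x = x} ≤ Nat.card (invHom N) := by
  classical
  have h1 : (Nat.card {x : X // g • x = x} : ℂ) =
      ∑ θ : Irr N, LinearMap.trace ℂ _ (permRep G X g * irrProj θ.1 ((permRep G X).res N)) := by
    rw [← map_sum, ← Finset.mul_sum, sum_irrProj, mul_one]
    exact (character_permRep g).symm
  have h2 : (Nat.card {x : X // g • x = x} : ℝ) ≤
      ∑ θ : Irr N, if (∀ g : G, g • θ = θ) ∧ θ.degree = 1 then (1 : ℝ) else 0 := by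
    rw [← Complex.norm_natCast, h1]
    refine (norm_sum_le _ _).trans (Finset.sum_le_sum fun θ _ => ?_)
    split_ifs with hθ
    · exact norm_trace_le hfree hcard hθ.2 g
    · rw [trace_mul_irrProj_eq_zero, norm_zero]
      exact fun h => hθ (hG.invariant_linear hp hN hpN hfree hcard fun hT => hg (hT h))
  rw [Finset.sum_boole, ← Fintype.card_subtype, ← Nat.card_eq_fintype_card,
    card_invariant_linear] at h2
  exact_mod_cast h2

end Regular

end Characters

section Assembly
variable {G : Type*} [Group G]

theorem isPResidual_closure [Finite G] {p : ℕ} (hp : p.Prime) :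
    IsPResidual p (Subgroup.closure {g : G | (orderOf g).Coprime p}) where
  pow_mem g := by
    obtain ⟨k, l, hl, h⟩ := Nat.exists_eq_pow_mul_and_not_dvd (orderOf_pos g).ne' p hp.ne_one
    refine ⟨k, Subgroup.subset_closure ?_⟩
    have h1 : orderOf (g ^ p ^ k) = l := by
      rw [orderOf_pow_of_dvd (pow_pos hp.pos k).ne' (h ▸ dvd_mul_right _ _), h,
        Nat.mul_div_cancel_left _ (pow_pos hp.pos k)]
    rw [Set.mem_ofPred_eq, h1]
    exact ((Nat.Prime.coprime_iff_not_dvd hp).2 hl).symm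
  hom_eq_one f k hf := by
    have hle : Subgroup.closure {g : G | (orderOf g).Coprime p} ≤
        f.ker.map (Subgroup.subtype _) := by
      rw [Subgroup.closure_le]
      intro g hg
      refine ⟨⟨g, Subgroup.subset_closure hg⟩, ?_, rfl⟩
      rw [SetLike.mem_coe, MonoidHom.mem_ker]
      refine orderOf_eq_one_iff.1 (Nat.eq_one_of_dvd_coprimes (Nat.Coprime.pow_right k hg) ?_
        (orderOf_dvd_of_pow_eq_one (hf _)))
      refine orderOf_dvd_of_pow_eq_one ?_
      rw [← map_pow]
      have : (⟨g, Subgroup.subset_closure hg⟩ :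
          Subgroup.closure {g : G | (orderOf g).Coprime p}) ^ orderOf g = 1 :=
        Subtype.ext (pow_orderOf_eq_one g)
      rw [this, map_one]
    intro n
    obtain ⟨m, hm, hmn⟩ := hle n.2
    obtain rfl : m = n := Subtype.ext hmn
    exact hm

instance normal_closure_coprime (p : ℕ) :
    (Subgroup.closure {g : G | (orderOf g).Coprime p}).Normal where
  conj_mem n hn g := by
    have : Subgroup.closure {g : G | (orderOf g).Coprime p} ≤
        (Subgroup.closure {g : G | (orderOf g).Coprime p}).comap (MulAut.conj g).toMonoidHom := by
      rw [Subgroup.closure_le]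
      intro s hs
      refine Subgroup.subset_closure ?_
      rw [Set.mem_ofPred_eq] at hs ⊢
      change (orderOf (MulAut.conj g s)).Coprime p
      rwa [MulEquiv.orderOf_eq]
    exact this hn

theorem closure_coprime_ne_top [Finite G] {p : ℕ} (hp : p.Prime)
    (hpG : p ∣ Nat.card (Abelianization G)) :
    Subgroup.closure {g : G | (orderOf g).Coprime p} ≠ ⊤ := fun htop => by
  have := Fact.mk hp
  obtain ⟨k, m, hm, h⟩ := Nat.exists_eq_pow_mul_and_not_dvd
    (Nat.card_pos (α := Abelianization G)).ne' p hp.ne_one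
  have hle : Subgroup.closure {g : G | (orderOf g).Coprime p} ≤
      ((powMonoidHom m).comp (Abelianization.of (G := G))).ker := by
    rw [Subgroup.closure_le]
    intro s hs
    have h1 : orderOf (Abelianization.of s) ∣ m := by
      refine Nat.Coprime.dvd_of_dvd_mul_left (k := orderOf (Abelianization.of s)) (m := p ^ k) ?_
        (h ▸ orderOf_dvd_natCard _)
      exact (Nat.Coprime.coprime_dvd_left (orderOf_map_dvd Abelianization.of s) hs).pow_right k
    exact orderOf_dvd_iff_pow_eq_one.1 h1
  obtain ⟨a, ha⟩ := exists_prime_orderOf_dvd_card' p hpG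
  obtain ⟨g, rfl⟩ := QuotientGroup.mk_surjective a
  have hg : g ∈ ((powMonoidHom m).comp (Abelianization.of (G := G))).ker :=
    hle (htop ▸ Subgroup.mem_top g)
  exact hm (ha ▸ orderOf_dvd_of_pow_eq_one hg)

variable {N : Subgroup G} [N.Normal]

theorem IsGCStar.card_centralizer_le [Fintype G] [Fintype N] {p : ℕ} (hp : p.Prime)
    (hG : IsGCStar G) (hN : IsPResidual p N) (hpN : ¬ p ∣ Fintype.card N) {x : G}
    (hx : orderOf x = p) (hxN : x ∉ N) :
    Nat.card {n : N // MulAut.conjNormal x n = n} ≤ Nat.card (invHom N) := by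
  classical
  have := Fact.mk hp
  obtain ⟨P, hP⟩ := IsPGroup.exists_le_sylow (p := p) (P := Subgroup.zpowers x)
    (IsPGroup.of_card (n := 1) (by rw [Nat.card_zpowers, hx, pow_one]))
  have hxP : x ∈ (P : Subgroup G) := hP (Subgroup.mem_zpowers x)
  have hQ : IsPGroup p (G ⧸ N) := fun a => by
    obtain ⟨g, rfl⟩ := QuotientGroup.mk_surjective a
    obtain ⟨k, hk⟩ := hN.pow_mem g
    exact ⟨k, (QuotientGroup.eq_one_iff (g ^ p ^ k)).2 hk⟩
  obtain ⟨k, hk⟩ := IsPGroup.iff_card.1 hQ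
  rw [← Nat.card_eq_fintype_card] at hpN
  have hGN : Nat.card G = p ^ k * Nat.card N := by
    rw [Subgroup.card_eq_card_quotient_mul_card_subgroup N, hk]
  have hPc : Nat.card P = p ^ k := by
    rw [P.card_eq_multiplicity, hGN, Nat.factorization_mul (pow_pos hp.pos k).ne'
      Nat.card_pos.ne', Finsupp.add_apply, hp.factorization_pow, Finsupp.single_eq_same,
      Nat.factorization_eq_zero_of_not_dvd hpN, add_zero]
  have hcard : Fintype.card (G ⧸ (P : Subgroup G)) = Fintype.card N := by
    rw [← Nat.card_eq_fintype_card, ← Nat.card_eq_fintype_card]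
    have h1 := Subgroup.card_eq_card_quotient_mul_card_subgroup (P : Subgroup G)
    have h2 : Nat.card (P : Subgroup G) = p ^ k := hPc
    rw [hGN, h2, mul_comm] at h1
    exact (Nat.eq_of_mul_eq_mul_right (pow_pos hp.pos k) h1).symm
  have hfree : ∀ (n : N) (y : G ⧸ (P : Subgroup G)), (n : G) • y = y → n = 1 := by
    intro n y hy
    obtain ⟨g, rfl⟩ := QuotientGroup.mk_surjective y
    have h1 : g⁻¹ * n * g ∈ (P : Subgroup G) := by
      have := QuotientGroup.eq.1 hy.symm
      change g⁻¹ * ((n : G) * g) ∈ (P : Subgroup G) at this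
      rwa [← mul_assoc] at this
    have h2 : g⁻¹ * n * g ∈ N := by
      simpa using ‹N.Normal›.conj_mem n n.2 g⁻¹
    have h3 : Disjoint (P : Subgroup G) N := by
      refine Subgroup.disjoint_of_coprime_natCard ?_
      have : Nat.card (P : Subgroup G) = p ^ k := hPc
      rw [this]
      exact Nat.Coprime.pow_left k ((Nat.Prime.coprime_iff_not_dvd hp).2 hpN)
    have h4 : g⁻¹ * n * g = 1 := Subgroup.disjoint_def.1 h3 h1 h2
    refine Subtype.ext ?_
    have h5 : (n : G) = g * (g⁻¹ * n * g) * g⁻¹ := by group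
    rw [h5, h4, mul_one, mul_inv_cancel, Subgroup.coe_one]
  rw [Nat.card_eq_fintype_card] at hpN
  refine le_trans ?_ (hG.card_fixed_le hp hN hpN hfree hcard hxN)
  refine Nat.card_le_card_of_injective
    (fun n => ⟨((n.1 : G) : G ⧸ (P : Subgroup G)), ?_⟩) fun a b hab => ?_
  · have h1 : x * n.1 * x⁻¹ = (n.1 : G) := congrArg Subtype.val n.2
    have h2 : x * n.1 = n.1 * x := mul_inv_eq_iff_eq_mul.1 h1
    change ((x * n.1 : G) : G ⧸ (P : Subgroup G)) = _
    rw [h2]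
    exact (QuotientGroup.eq.2 (by rwa [inv_mul_cancel_left])).symm
  · have h1 : ((a.1 : G) : G ⧸ (P : Subgroup G)) = ((b.1 : G) : G ⧸ (P : Subgroup G)) :=
      congrArg Subtype.val hab
    have h2 := hfree (b.1⁻¹ * a.1) ((1 : G) : G ⧸ (P : Subgroup G)) (by
      have : ((b.1⁻¹ * a.1 : N) : G) ∈ (P : Subgroup G) := QuotientGroup.eq.1 h1.symm
      exact (QuotientGroup.eq.2 (by simpa using this)).symm)
    exact Subtype.ext (inv_mul_eq_one.1 h2).symm

/-- The product of all invariant linear characters of `N`. -/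
def invHomPi (N : Subgroup G) [N.Normal] : N →* (invHom N → ℂˣ) := MonoidHom.pi fun f => f.1

theorem mem_ker_invHomPi {n : N} : n ∈ (invHomPi N).ker ↔ ∀ f ∈ invHom N, f n = 1 :=
  ⟨fun h f hf => congrFun h ⟨f, hf⟩, fun h => funext fun f => h f.1 f.2⟩

theorem conjNormal_mem_ker_invHomPi (g : G) {n : N} (hn : n ∈ (invHomPi N).ker) :
    MulAut.conjNormal g n ∈ (invHomPi N).ker :=
  mem_ker_invHomPi.2 fun f hf => (hf g n).trans (mem_ker_invHomPi.1 hn f hf)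

theorem card_invHom_le [Finite N] : Nat.card (invHom N) ≤ Nat.card (N ⧸ (invHomPi N).ker) := by
  classical
  let A := N ⧸ (invHomPi N).ker
  have := Fintype.ofFinite A
  let F : invHom N → (A →* ℂ) := fun f => (Units.coeHom ℂ).comp
    (QuotientGroup.lift (invHomPi N).ker f.1 fun n hn => mem_ker_invHomPi.1 hn f.1 f.2)
  have hF : Function.Injective F := fun f f' h => by
    refine Subtype.ext (MonoidHom.ext fun n => Units.ext ?_)
    exact DFunLike.congr_fun h (n : A)
  have hli := (linearIndependent_monoidHom A ℂ).comp F hF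
  have := hli.finite
  have := Fintype.ofFinite (invHom N)
  have h := hli.fintype_card_le_finrank
  rwa [Module.finrank_fintype_fun_eq_card, ← Nat.card_eq_fintype_card,
    ← Nat.card_eq_fintype_card] at h

theorem isFPF_of_card_le [Finite N] {p : ℕ} (hp : p.Prime) (hpN : ¬ p ∣ Nat.card N) {x : G}
    (hx : x ^ p = 1)
    (hle : Nat.card {n : N // MulAut.conjNormal x n = n} ≤ Nat.card (invHom N)) :
    IsFPF p
        (((MulAut.conjNormal x : MulAut N).toMonoidHom.comp (invHomPi N).ker.subtype).codRestrict
      (invHomPi N).ker fun m => conjNormal_mem_ker_invHomPi x m.2) := by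
  set K := (invHomPi N).ker with hK
  have hit : ∀ (j : ℕ) (n : N), (⇑(MulAut.conjNormal x : MulAut N))^[j] n =
      MulAut.conjNormal (x ^ j) n := fun j n => by
    induction j with
    | zero => simp
    | succ j ih => rw [Function.iterate_succ_apply', ih, pow_succ', map_mul]; rfl
  have hcoset : ∀ n : N, n⁻¹ * MulAut.conjNormal x n ∈ K := fun n =>
    mem_ker_invHomPi.2 fun f hf => by rw [map_mul, map_inv, hf, inv_mul_cancel]
  have hsurj : Function.Surjective
      fun n : {n : N // MulAut.conjNormal x n = n} => (n.1 : N ⧸ K) := fun a => by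
    obtain ⟨n, rfl⟩ := QuotientGroup.mk_surjective a
    have hmem : ∀ m : {m : N // n⁻¹ * m ∈ K}, n⁻¹ * MulAut.conjNormal x m.1 ∈ K := fun m => by
      have := K.mul_mem m.2 (hcoset m.1)
      rwa [mul_assoc, mul_inv_cancel_left] at this
    let e : K ≃ {m : N // n⁻¹ * m ∈ K} :=
      { toFun := fun m => ⟨n * m, by rw [inv_mul_cancel_left]; exact m.2⟩
        invFun := fun m => ⟨n⁻¹ * m, m.2⟩
        left_inv := fun m => Subtype.ext (inv_mul_cancel_left _ _)
        right_inv := fun m => Subtype.ext (mul_inv_cancel_left _ _) }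
    let g : {m : N // n⁻¹ * m ∈ K} → {m : N // n⁻¹ * m ∈ K} :=
      fun m => ⟨MulAut.conjNormal x m.1, hmem m⟩
    have hg : ∀ (j : ℕ) m, (g^[j] m).1 =
        (⇑(MulAut.conjNormal x : MulAut N))^[j] m.1 := fun j m => by
      induction j with
      | zero => rfl
      | succ j ih => rw [Function.iterate_succ_apply', Function.iterate_succ_apply', ← ih]
    obtain ⟨m, hm⟩ := exists_fixed_of_not_dvd hp (g := g)
      (fun m => Subtype.ext (by rw [hg, hit, hx, map_one]; rfl)) (by
        rw [← Nat.card_congr e]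
        exact fun h => hpN (h.trans (Subgroup.card_subgroup_dvd_card K)))
    exact ⟨⟨m.1, congrArg Subtype.val hm⟩, (QuotientGroup.eq.2 m.2).symm⟩
  have hinj : Function.Injective
      fun n : {n : N // MulAut.conjNormal x n = n} => (n.1 : N ⧸ K) :=
    (hsurj.bijective_of_nat_card_le (hle.trans card_invHom_le)).1
  refine ⟨fun m => ?_, fun m hm => ?_⟩
  · have hg : ∀ j : ℕ,
      (((⇑(((MulAut.conjNormal x : MulAut N).toMonoidHom.comp K.subtype).codRestrict K
        fun m => conjNormal_mem_ker_invHomPi x m.2))^[j] m : K) : N) =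
        (⇑(MulAut.conjNormal x : MulAut N))^[j] m.1 := fun j => by
      induction j with
      | zero => rfl
      | succ j ih =>
        rw [Function.iterate_succ_apply', Function.iterate_succ_apply', ← ih]
        rfl
    refine Subtype.ext ?_
    rw [hg, hit, hx, map_one]
    rfl
  · have h1 : MulAut.conjNormal x m.1 = m.1 := congrArg Subtype.val hm
    have h2 := @hinj ⟨m.1, h1⟩ ⟨1, map_one _⟩ (by
      change (m.1 : N ⧸ K) = ((1 : N) : N ⧸ K)
      exact (QuotientGroup.eq_one_iff m.1).2 m.2)
    have h3 : m.1 = 1 := Subtype.ext_iff.1 h2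
    exact Subtype.ext h3

theorem IsGCStar.isSolvable_of_dvd [Finite G] {p : ℕ} (hp : p.Prime) (hG : IsGCStar G)
    (hpG : p ∣ Nat.card (Abelianization G)) : Group.IsSolvable G := by
  classical
  have := Fact.mk hp
  have := Fintype.ofFinite G
  let N := Subgroup.closure {g : G | (orderOf g).Coprime p}
  have hN : IsPResidual p N := isPResidual_closure hp
  have hpN : ¬ p ∣ Fintype.card N := hG.not_dvd_card hp hN (closure_coprime_ne_top hp hpG)
  obtain ⟨x, hx⟩ := exists_prime_orderOf_dvd_card' p
    (hpG.trans (Subgroup.card_quotient_dvd_card (commutator G)))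
  have hxN : x ∉ N := fun h => hpN (by
    rw [← hx, ← Nat.card_eq_fintype_card]
    exact Subgroup.orderOf_dvd_natCard N h)
  have hfpf := isFPF_of_card_le hp (by rwa [Nat.card_eq_fintype_card]) (hx ▸ pow_orderOf_eq_one x)
    (hG.card_centralizer_le hp hN hpN hx hxN)
  have := hfpf.isNilpotent hp
  have hNs : Group.IsSolvable N :=
      Group.isSolvable_of_ker_le_range (invHomPi N).ker.subtype (invHomPi N)
    (by rw [Subgroup.range_subtype])
  have hQ : IsPGroup p (G ⧸ N) := fun a => by
    obtain ⟨g, rfl⟩ := QuotientGroup.mk_surjective a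
    obtain ⟨k, hk⟩ := hN.pow_mem g
    exact ⟨k, (QuotientGroup.eq_one_iff (g ^ p ^ k)).2 hk⟩
  have := hQ.isNilpotent
  exact Group.isSolvable_of_ker_le_range N.subtype (QuotientGroup.mk' N)
    (by rw [Subgroup.range_subtype, QuotientGroup.ker_mk'])

end Assembly

/-- A finite non-solvable `GC*`-group is perfect. -/
theorem nonsolvable_gcstar_perfect {G : Type*} [Group G] [Finite G]
    (hGC : IsGCStar G) (hns : ¬ IsSolvable G) : commutator G = ⊤ := by
  by_contra h
  obtain ⟨p, hp, hpG⟩ := Nat.exists_prime_and_dvd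
    (n := Nat.card (Abelianization G)) fun h1 => h (Subgroup.index_eq_one.1 h1)
  exact hns (hGC.isSolvable_of_dvd hp hpG)
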